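/- (Rigidity of nondegenerate singularities.) Let m = p + q and let X_{i,θ} (i = 1, ..., p) and F_{j,θ} (j = 1, ..., q) be complex analytic in (x, θ) on U × Θ, where U is a neighborhood of z_0 in ℂ^m and Θ a neighborhood of 0 in ℂ^s, such that for each fixed θ ∈ Θ the tuple (X_{1,θ}, ..., X_{p,θ}, F_{1,θ}, ..., F_{q,θ}) is an integrable system of type (p, q) on U. Assume z_0 is a nondegenerate fixed point of the system at θ = 0 (i.e. X_{i,0}(z_0) = 0 for all i, the matrices D_x X_{i,0}(z_0) are semisimple and the associated linear vector fields are linearly independent on a dense subset of ℂ^m, and the lowest-degree nonzero homogeneous Taylor terms of the F_{j,0} at z_0 have differentials linearly independent on a dense subset). Then there exist a neighborhood Θ' ⊆ Θ of 0 and an analytic map θ ↦ z_θ on Θ' with value z_0 at θ = 0, such that X_{i,θ}(z_θ) = 0 for all i and all θ ∈ Θ', and for each θ ∈ Θ' the system (X_{1,θ}, ..., X_{p,θ}) near z_θ is geometrically equivalent to the system (X_{1,0}, ..., X_{p,0}) near z_0: there are an analytic diffeomorphism φ_θ from a neighborhood of z_θ onto a neighborhood of z_0 with φ_θ(z_θ)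 = z_0, and analytic functions f_{ij,θ} near z_0 with everywhere nonvanishing determinant, each a common first integral of (X_{1,0}, ..., X_{p,0}), such that Dφ_θ(x)(X_{i,θ}(x)) = Σ_j f_{ij,θ}(φ_θ(x)) · X_{j,0}(φ_θ(x)) for all i and all x near z_θ. -/

import Mathlib

open scoped BigOperators

/-- A complex square matrix is semisimple iff it is diagonalizable (over ℂ). -/
def IsSemisimpleMatrixC {m : ℕ} (A : Matrix (Fin m) (Fin m) ℂ) : Prop :=
  ∃ P : Matrix (Fin m) (Fin m) ℂ, IsUnit P ∧ ∃ d : Fin m → ℂ,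
    A = P * Matrix.diagonal d * P⁻¹

section
open scoped BigOperators
open MeasureTheory Set Filter Topology Metric

namespace Rig

noncomputable section

abbrev J : Type := Icc (0:ℝ) (2*Real.pi)

instance : MeasureSpace J := Measure.Subtype.measureSpace

instance : IsFiniteMeasure (volume : Measure J) := by
  constructor
  rw [Measure.Subtype.volume_univ nullMeasurableSet_Icc]
  exact isCompact_Icc.measure_lt_top

theorem integrable_J {F : Type*} [NormedAddCommGroup F] {g : J → F} (hg : Continuous g) :
    Integrable g (volume : Measure J) :=
  hg.integrable_of_hasCompactSupport (HasCompactSupport.of_compactSpace g)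

theorem integral_J {F : Type*} [NormedAddCommGroup F] [NormedSpace ℝ F] (g : ℝ → F) :
    ∫ θ : J, g θ = ∫ θ in (0:ℝ)..(2*Real.pi), g θ := by
  rw [intervalIntegral.integral_of_le (by positivity), ← integral_Icc_eq_integral_Ioc]
  exact integral_subtype measurableSet_Icc g

/-- bilinear integration map -/
def Lam (K : Type) [PseudoMetricSpace K] [CompactSpace K] (F : Type*) [NormedAddCommGroup F]
    [NormedSpace ℂ F] : C(J, ℂ) →L[ℂ] C(K × J, F) →L[ℂ] C(K, F) :=
  LinearMap.mkContinuous₂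
    (LinearMap.mk₂ ℂ (fun (k : C(J,ℂ)) (G : C(K × J, F)) =>
      (⟨fun κ => ∫ θ : J, k θ • G (κ, θ), by
        have := continuous_parametric_integral_of_continuous (μ := (volume : Measure J))
          (f := fun (κ : K) (θ : J) => k θ • G (κ, θ)) (by
            simp only [Function.uncurry_def]; fun_prop) (isCompact_univ)
        simpa using this⟩ : C(K, F)))
      (by
        intro k k' G; ext κ
        simp only [ContinuousMap.add_apply, add_smul, ContinuousMap.coe_mk]
        exact integral_add (integrable_J (by fun_prop)) (integrable_J (by fun_prop)))
      (by
        intro c k G; ext κ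
        simp only [ContinuousMap.smul_apply, smul_assoc, ContinuousMap.coe_mk]
        exact integral_smul _ _)
      (by
        intro k G G'; ext κ
        simp only [ContinuousMap.add_apply, smul_add, ContinuousMap.coe_mk]
        exact integral_add (integrable_J (by fun_prop)) (integrable_J (by fun_prop)))
      (by
        intro c k G; ext κ
        simp only [ContinuousMap.smul_apply, smul_comm _ c, ContinuousMap.coe_mk]
        exact integral_smul _ _))
    ((volume : Measure J).real univ) (by
      intro k G
      rw [ContinuousMap.norm_le _ (by positivity)]
      intro κ
      simp only [LinearMap.mk₂_apply, ContinuousMap.coe_mk]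
      refine (norm_integral_le_of_norm_le_const (C := ‖k‖ * ‖G‖) ?_).trans (le_of_eq (by ring))
      filter_upwards with θ
      rw [norm_smul]
      gcongr
      · exact k.norm_coe_le_norm θ
      · exact G.norm_coe_le_norm _)

theorem Lam_apply (K : Type) [PseudoMetricSpace K] [CompactSpace K] (F : Type*)
    [NormedAddCommGroup F] [NormedSpace ℂ F] (k : C(J,ℂ)) (G : C(K × J, F)) (κ : K) :
    Lam K F k G κ = ∫ θ : J, k θ • G (κ, θ) := rfl

/-- circle as a continuous map -/
def circ (c : ℂ) (r : ℝ) : C(J, ℂ) := ⟨fun θ => circleMap c r θ, by fun_prop⟩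
def dcirc (c : ℂ) (r : ℝ) : C(J, ℂ) := ⟨fun θ => (2 * Real.pi * Complex.I : ℂ)⁻¹ *
  (circleMap 0 r θ * Complex.I), by fun_prop⟩

/-- the Cauchy kernel -/
def ker (c : ℂ) (r : ℝ) (z : ℂ) : C(J, ℂ) :=
  dcirc c r * Ring.inverse (circ c r - algebraMap ℂ C(J,ℂ) z)

theorem isUnit_circ_sub {c z : ℂ} {r : ℝ} (hz : z ∈ ball c r) :
    IsUnit (circ c r - algebraMap ℂ C(J,ℂ) z) := by
  rw [ContinuousMap.isUnit_iff_forall_ne_zero]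
  intro θ
  have : circleMap c r θ ≠ z := circleMap_ne_mem_ball hz θ
  simpa [circ, sub_eq_zero] using this

theorem ker_analytic {c z : ℂ} {r : ℝ} (hz : z ∈ ball c r) : AnalyticAt ℂ (ker c r) z := by
  unfold ker
  refine analyticAt_const.mul ?_
  obtain ⟨u, hu⟩ := isUnit_circ_sub hz
  have h1 : AnalyticAt ℂ (Ring.inverse : C(J,ℂ) → C(J,ℂ)) (circ c r - algebraMap ℂ C(J,ℂ) z) := by
    rw [← hu]; exact analyticAt_inverse u
  have h2 : AnalyticAt ℂ (fun z : ℂ => circ c r - algebraMap ℂ C(J,ℂ) z) z :=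
    analyticAt_const.sub ((Algebra.linearMap ℂ C(J,ℂ)).toContinuousLinearMap.analyticAt z)
  exact AnalyticAt.comp (g := Ring.inverse) h1 h2

theorem ker_apply {c z : ℂ} {r : ℝ} (hz : z ∈ ball c r) (θ : J) :
    ker c r z θ = (2 * Real.pi * Complex.I : ℂ)⁻¹ *
      (circleMap 0 r θ * Complex.I) * (circleMap c r θ - z)⁻¹ := by
  have hu := isUnit_circ_sub hz
  have := congrArg (fun g : C(J,ℂ) => g θ) (Ring.mul_inverse_cancel _ hu)
  simp only [ContinuousMap.mul_apply, ContinuousMap.one_apply] at this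
  have e : (Ring.inverse (circ c r - algebraMap ℂ C(J,ℂ) z)) θ = (circleMap c r θ - z)⁻¹ := by
    refine eq_inv_of_mul_eq_one_right ?_
    simpa [circ] using this
  simp [ker, e, dcirc]

theorem cauchy_ker {F : Type*} [NormedAddCommGroup F] [NormedSpace ℂ F] [CompleteSpace F]
    {c z : ℂ} {r : ℝ} (hz : z ∈ ball c r) {f : ℂ → F} (hc : ContinuousOn f (closedBall c r))
    (hd : ∀ x ∈ ball c r, DifferentiableAt ℂ f x) :
    ∫ θ : J, ker c r z θ • f (circleMap c r θ) = f z := by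
  have := Complex.two_pi_I_inv_smul_circleIntegral_sub_inv_smul_of_differentiable_on_off_countable
    (s := ∅) countable_empty hz hc (by simpa using hd)
  rw [← this, circleIntegral, ← intervalIntegral.integral_smul, ← integral_J]
  congr 1; ext θ
  rw [ker_apply hz, smul_smul, smul_smul]
  congr 1
  simp only [deriv_circleMap]


theorem lemG (F : Type*) [NormedAddCommGroup F] [NormedSpace ℂ F] [CompleteSpace F] (n : ℕ) :
    ∀ (K : Type) [PseudoMetricSpace K] [CompactSpace K] (f : K → (Fin n → ℂ) → F)
      (x0 : Fin n → ℂ) (R : ℝ), 0 < R →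
      ContinuousOn (fun z : K × (Fin n → ℂ) => f z.1 z.2) (univ ×ˢ ball x0 R) →
      (∀ κ, ∀ x ∈ ball x0 R, ∀ i, DifferentiableAt ℂ (fun t => f κ (Function.update x i t)) (x i)) →
      ∃ G : (Fin n → ℂ) → C(K, F), AnalyticAt ℂ G x0 ∧ ∀ᶠ x in 𝓝 x0, ∀ κ, G x κ = f κ x := by
  induction n with
  | zero =>
    intro K _ _ f x0 R hR hc hd
    have : Continuous fun κ => f κ x0 := by
      rw [← continuousOn_univ]
      exact hc.comp (f := fun κ => (κ, x0)) (by fun_prop) (fun κ _ => ⟨trivial, by simpa using hR⟩)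
    refine ⟨fun _ => ⟨fun κ => f κ x0, this⟩, analyticAt_const, ?_⟩
    filter_upwards with x κ
    rw [Subsingleton.elim x x0]; rfl
  | succ n ih =>
    intro K _ _ f x0 R hR hc hd
    set z0 := x0 0 with hz0
    set y0 : Fin n → ℂ := Fin.tail x0 with hy0
    have hx0 : x0 = Fin.cons z0 y0 := (Fin.cons_self_tail x0).symm
    have hmem : ∀ z y, z ∈ ball z0 R → y ∈ ball y0 R → (Fin.cons z y : Fin (n+1) → ℂ) ∈ ball x0 R := by
      intro z y hz hy
      rw [mem_ball, dist_pi_lt_iff hR] at *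
      intro i
      refine Fin.cases ?_ (fun i => ?_) i
      · simpa using hz
      · simpa [hy0, Fin.tail] using hy i
    have hccons : Continuous fun p : ℂ × (Fin n → ℂ) => (Fin.cons p.1 p.2 : Fin (n+1) → ℂ) := by
      refine continuous_pi fun i => ?_
      refine Fin.cases ?_ (fun i => ?_) i
      · simpa using continuous_fst
      · simp only [Fin.cons_succ]; fun_prop
    have hcirc : ∀ θ : ℝ, circleMap z0 (R/2) θ ∈ ball z0 R := by
      intro θ
      have := circleMap_mem_closedBall z0 (by positivity : 0 ≤ R/2) θ
      exact closedBall_subset_ball (by linarith) this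
    obtain ⟨G', hG', hG'e⟩ := ih (K × J) (fun κ y => f κ.1 (Fin.cons (circleMap z0 (R/2) κ.2) y))
      y0 R hR (by
        refine hc.comp (f := fun z : (K × J) × (Fin n → ℂ) =>
          (z.1.1, (Fin.cons (circleMap z0 (R/2) z.1.2) z.2 : Fin (n+1) → ℂ))) ?_ ?_
        · apply Continuous.continuousOn
          refine (by fun_prop : Continuous _).prodMk (hccons.comp (f := fun z : (K × J) × (Fin n → ℂ) => (circleMap z0 (R/2) z.1.2, z.2)) ?_)
          refine Continuous.prodMk ?_ (by fun_prop)
          exact (continuous_circleMap z0 (R/2)).comp (by fun_prop)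
        · rintro ⟨⟨κ, θ⟩, y⟩ ⟨-, hy⟩
          exact ⟨trivial, hmem _ _ (hcirc _) hy⟩) (by
        rintro ⟨κ, θ⟩ y hy i
        have := hd κ (Fin.cons (circleMap z0 (R/2) θ) y) (hmem _ _ (hcirc _) hy) i.succ
        simpa [← Fin.cons_update] using this)
    refine ⟨fun x => Lam K F (ker z0 (R/2) (x 0)) (G' (Fin.tail x)), ?_, ?_⟩
    · have h1 : AnalyticAt ℂ (fun x : Fin (n+1) → ℂ => ker z0 (R/2) (x 0)) x0 := by
        refine AnalyticAt.comp (g := ker z0 (R/2)) (ker_analytic (by simpa [← hz0] using hR)) ?_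
        exact (ContinuousLinearMap.proj (R := ℂ) (φ := fun _ : Fin (n+1) => ℂ) 0).analyticAt x0
      have h2 : AnalyticAt ℂ (fun x : Fin (n+1) → ℂ => G' (Fin.tail x)) x0 := by
        refine AnalyticAt.comp (g := G') hG' ?_
        exact (ContinuousLinearMap.pi (fun i : Fin n => ContinuousLinearMap.proj (R := ℂ)
          (φ := fun _ : Fin (n+1) => ℂ) i.succ)).analyticAt x0
      exact ((Lam K F).analyticAt_bilinear _ |>.comp₂ h1 h2)
    · have hc0 : Tendsto (fun x : Fin (n+1) → ℂ => x 0) (𝓝 x0) (𝓝 z0) :=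
        (continuous_apply 0).tendsto x0
      have hct : Tendsto (fun x : Fin (n+1) → ℂ => (Fin.tail x : Fin n → ℂ)) (𝓝 x0) (𝓝 y0) :=
        (by unfold Fin.tail; fun_prop : Continuous (fun x : Fin (n+1) → ℂ => (Fin.tail x : Fin n → ℂ))).tendsto x0
      filter_upwards [hc0.eventually (ball_mem_nhds z0 (half_pos hR)),
        hct.eventually hG'e, hct.eventually (ball_mem_nhds y0 hR)] with x hx hxG hxy κ
      rw [Lam_apply]
      simp only [hxG]
      have hcz : ∀ z ∈ closedBall z0 (R/2), z ∈ ball z0 R := fun z hz =>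
        closedBall_subset_ball (by linarith) hz
      have := cauchy_ker (F := F) (f := fun z => f κ (Fin.cons z (Fin.tail x))) hx (by
        refine hc.comp (f := fun z : ℂ => (κ, (Fin.cons z (Fin.tail x) : Fin (n+1) → ℂ))) ?_ ?_
        · apply Continuous.continuousOn
          exact continuous_const.prodMk (hccons.comp (f := fun z : ℂ => (z, Fin.tail x)) (by fun_prop))
        · intro z hz
          exact ⟨trivial, hmem _ _ (hcz _ hz) hxy⟩) (by
        intro z hz
        have := hd κ (Fin.cons z (Fin.tail x)) (hmem _ _ (hcz _ (ball_subset_closedBall hz)) hxy) 0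
        simpa [Fin.update_cons_zero] using this)
      rw [Fin.cons_self_tail] at this
      exact this

/-- Osgood lemma, coordinates. -/
theorem osgood_pi {F : Type*} [NormedAddCommGroup F] [NormedSpace ℂ F] [CompleteSpace F] {n : ℕ}
    {Ω : Set (Fin n → ℂ)} (hΩ : IsOpen Ω) {f : (Fin n → ℂ) → F} (hc : ContinuousOn f Ω)
    (hd : ∀ x ∈ Ω, ∀ d, DifferentiableAt ℂ (fun t : ℂ => f (x + t • d)) 0) :
    AnalyticOnNhd ℂ f Ω := by
  intro x0 hx0
  obtain ⟨R, hR, hRΩ⟩ := Metric.isOpen_iff.1 hΩ x0 hx0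
  obtain ⟨G, hG, hGe⟩ := lemG F n Unit (fun _ => f) x0 R hR (by
    refine (hc.mono hRΩ).comp continuousOn_snd ?_
    rintro ⟨_, x⟩ ⟨-, hx⟩; exact hx) (by
    intro _ x hx i
    have h1 := hd x (hRΩ hx) (Pi.single i 1)
    have h2 : DifferentiableAt ℂ (fun t : ℂ => t - x i) (x i) := by fun_prop
    have h3 := DifferentiableAt.comp (x i) (g := fun t : ℂ => f (x + t • Pi.single i 1))
      (f := fun t : ℂ => t - x i) (by simpa using h1) h2
    refine h3.congr_of_eventuallyEq ?_
    filter_upwards with t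
    simp only [Function.comp]
    congr 1
    ext l
    by_cases h : l = i
    · subst h; simp
    · simp [h])
  have h2 : AnalyticAt ℂ ((ContinuousMap.evalCLM ℂ () : C(Unit, F) →L[ℂ] F) ∘ G) x0 :=
    ((ContinuousMap.evalCLM ℂ () : C(Unit, F) →L[ℂ] F).analyticAt (G x0)).comp hG
  exact h2.congr (by filter_upwards [hGe] with x hx using hx ())

/-- Osgood lemma. -/
theorem osgood {E F : Type*} [NormedAddCommGroup E] [NormedSpace ℂ E]
    [FiniteDimensional ℂ E] [NormedAddCommGroup F] [NormedSpace ℂ F] [CompleteSpace F]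
    {Ω : Set E} (hΩ : IsOpen Ω) {f : E → F} (hc : ContinuousOn f Ω)
    (hd : ∀ x ∈ Ω, ∀ d, DifferentiableAt ℂ (fun t : ℂ => f (x + t • d)) 0) :
    AnalyticOnNhd ℂ f Ω := by
  let e : E ≃L[ℂ] (Fin (Module.finrank ℂ E) → ℂ) := ContinuousLinearEquiv.ofFinrankEq (by simp)
  have h := osgood_pi (Ω := e.symm ⁻¹' Ω) (hΩ.preimage e.symm.continuous) (f := f ∘ e.symm)
    (hc.comp e.symm.continuous.continuousOn (fun x hx => hx)) (by
      intro x hx d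
      simpa using hd (e.symm x) hx (e.symm d))
  intro x hx
  have h2 := (h (e x) (by simpa using hx)).comp (e.toContinuousLinearMap.analyticAt x)
  refine h2.congr ?_
  filter_upwards with y
  simp

/-- Differentiable on an open subset of a finite-dimensional space implies analytic. -/
theorem analytic_of_diff {E F : Type*} [NormedAddCommGroup E] [NormedSpace ℂ E]
    [FiniteDimensional ℂ E] [NormedAddCommGroup F] [NormedSpace ℂ F] [CompleteSpace F]
    {Ω : Set E} (hΩ : IsOpen Ω) {f : E → F} (hd : DifferentiableOn ℂ f Ω) :
    AnalyticOnNhd ℂ f Ω := by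
  refine osgood hΩ hd.continuousOn fun x hx d => ?_
  have h1 : DifferentiableAt ℂ f (x + (0:ℂ) • d) := by
    simpa using (hd x hx).differentiableAt (hΩ.mem_nhds hx)
  exact DifferentiableAt.comp (0:ℂ) (g := f) (f := fun t : ℂ => x + t • d) h1 (by fun_prop)

/-- Uniform limits of analytic functions are analytic. -/
theorem analytic_limit {E F : Type*} [NormedAddCommGroup E] [NormedSpace ℂ E]
    [FiniteDimensional ℂ E] [NormedAddCommGroup F] [NormedSpace ℂ F] [CompleteSpace F]
    {Ω : Set E} (hΩ : IsOpen Ω) {f : E → F} {g : ℕ → E → F} (hg : ∀ n, AnalyticOnNhd ℂ (g n) Ω)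
    (hl : TendstoUniformlyOn g f atTop Ω) : AnalyticOnNhd ℂ f Ω := by
  refine osgood hΩ (hl.continuousOn (Frequently.of_forall fun n => (hg n).continuousOn)) ?_
  intro x hx d
  have hcont : Continuous fun t : ℂ => x + t • d := by fun_prop
  have h1 : TendstoUniformlyOn (fun n (t : ℂ) => g n (x + t • d)) (fun t => f (x + t • d)) atTop
    ((fun t : ℂ => x + t • d) ⁻¹' Ω) := hl.comp _
  have h2 := h1.tendstoLocallyUniformlyOn.differentiableOn (Eventually.of_forall fun n t ht => by
    have h3 : DifferentiableAt ℂ (g n) (x + t • d) := (hg n _ ht).differentiableAt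
    exact (DifferentiableAt.comp t (g := g n) (f := fun t : ℂ => x + t • d) h3
      (by fun_prop)).differentiableWithinAt) (hΩ.preimage hcont)
  exact (h2 0 (by simpa using hx)).differentiableAt
    ((hΩ.preimage hcont).mem_nhds (by simpa using hx))

section Param
variable {E F : Type*} [NormedAddCommGroup E] [NormedSpace ℂ E]
    [FiniteDimensional ℂ E] [NormedAddCommGroup F] [NormedSpace ℂ F] [CompleteSpace F]

/-- The set of parameters over which the unit interval lies in `Ω`. -/
def tube (Ω : Set (ℂ × E)) : Set E := {x | ∀ u ∈ Icc (0:ℝ) 1, ((u:ℂ), x) ∈ Ω}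

theorem exists_tube {Ω : Set (ℂ × E)} (hΩ : IsOpen Ω) {x : E} (hx : x ∈ tube Ω) :
    ∃ r > 0, ∀ u ∈ Icc (0:ℝ) 1, ∀ y ∈ closedBall x r, ((u:ℂ), y) ∈ Ω := by
  obtain ⟨A, B, hA, hB, hIA, hxB, hAB⟩ := generalized_tube_lemma (s := Icc (0:ℝ) 1) isCompact_Icc
    (t := {x}) isCompact_singleton (n := (fun p : ℝ × E => ((p.1:ℂ), p.2)) ⁻¹' Ω)
    (hΩ.preimage (by fun_prop)) (by rintro ⟨u, y⟩ ⟨hu, rfl⟩; exact hx u hu)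
  obtain ⟨r, hr, hrB⟩ := Metric.isOpen_iff.1 hB x (hxB rfl)
  refine ⟨r/2, half_pos hr, fun u hu y hy => @hAB (u, y) ⟨hIA hu, hrB ?_⟩⟩
  exact closedBall_subset_ball (by linarith) hy

theorem isOpen_tube {Ω : Set (ℂ × E)} (hΩ : IsOpen Ω) : IsOpen (tube Ω) := by
  rw [Metric.isOpen_iff]
  intro x hx
  obtain ⟨r, hr, h⟩ := exists_tube hΩ hx
  exact ⟨r, hr, fun y hy u hu => h u hu y (ball_subset_closedBall hy)⟩

theorem paramInt {Ω : Set (ℂ × E)} (hΩ : IsOpen Ω) {K : ℂ × E → F} (hK : AnalyticOnNhd ℂ K Ω)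
    {x : E} (hx : x ∈ tube Ω) :
    HasFDerivAt (fun x => ∫ u in (0:ℝ)..1, K ((u:ℂ), x))
      (∫ u in (0:ℝ)..1, (fderiv ℂ K ((u:ℂ), x)).comp (ContinuousLinearMap.inr ℂ ℂ E)) x := by
  obtain ⟨r, hr, h⟩ := exists_tube hΩ hx
  have hI : uIoc (0:ℝ) 1 ⊆ Icc (0:ℝ) 1 := by rw [uIoc_of_le zero_le_one]; exact Ioc_subset_Icc_self
  have hcompl : CompleteSpace E := FiniteDimensional.complete ℂ E
  have hprop : ProperSpace E := FiniteDimensional.proper ℂ E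
  have hKc : ∀ y ∈ closedBall x r, ContinuousOn (fun u : ℝ => K ((u:ℂ), y)) (Icc 0 1) := by
    intro y hy
    exact hK.continuousOn.comp (f := fun u : ℝ => ((u:ℂ), y)) (by fun_prop) (fun u hu => h u hu y hy)
  have hF'c : ContinuousOn (fun p : ℝ × E => (fderiv ℂ K ((p.1:ℂ), p.2)).comp
      (ContinuousLinearMap.inr ℂ ℂ E)) (Icc 0 1 ×ˢ closedBall x r) := by
    have h1 : ContinuousOn (fun p : ℝ × E => fderiv ℂ K ((p.1:ℂ), p.2)) (Icc 0 1 ×ˢ closedBall x r) :=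
      hK.fderiv.continuousOn.comp (f := fun p : ℝ × E => ((p.1:ℂ), p.2)) (by fun_prop)
        (fun p hp => h p.1 hp.1 p.2 hp.2)
    exact h1.clm_comp continuousOn_const
  obtain ⟨C, hC⟩ := (isCompact_Icc.prod (isCompact_closedBall x r)).exists_bound_of_continuousOn hF'c
  refine intervalIntegral.hasFDerivAt_integral_of_dominated_of_fderiv_le (s := closedBall x r)
    (F' := fun x (u:ℝ) => (fderiv ℂ K ((u:ℂ), x)).comp (ContinuousLinearMap.inr ℂ ℂ E))
    (bound := fun _ => C) (closedBall_mem_nhds x hr) ?_ ?_ ?_ ?_ ?_ ?_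
  · filter_upwards [closedBall_mem_nhds x hr] with y hy
    exact ((hKc y hy).mono hI).aestronglyMeasurable measurableSet_uIoc
  · exact ContinuousOn.intervalIntegrable (by
      rw [uIcc_of_le zero_le_one]; exact hKc x (mem_closedBall_self hr.le))
  · refine ContinuousOn.aestronglyMeasurable ?_ measurableSet_uIoc
    exact hF'c.comp (f := fun u : ℝ => (u, x)) (by fun_prop)
      (fun u hu => ⟨hI hu, mem_closedBall_self hr.le⟩)
  · filter_upwards with u hu y hy
    exact hC (u, y) ⟨hI hu, hy⟩
  · exact intervalIntegrable_const
  · filter_upwards with u hu y hy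
    have h1 : HasFDerivAt K (fderiv ℂ K ((u:ℂ), y)) ((u:ℂ), y) :=
      (hK _ (h u (hI hu) y hy)).differentiableAt.hasFDerivAt
    exact h1.comp y (hasFDerivAt_prodMk_right (u:ℂ) y)

theorem paramInt_analytic {Ω : Set (ℂ × E)} (hΩ : IsOpen Ω) {K : ℂ × E → F}
    (hK : AnalyticOnNhd ℂ K Ω) :
    AnalyticOnNhd ℂ (fun x => ∫ u in (0:ℝ)..1, K ((u:ℂ), x)) (tube Ω) :=
  analytic_of_diff (isOpen_tube hΩ) fun _ hx =>
    (paramInt hΩ hK hx).differentiableAt.differentiableWithinAt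

theorem paramInt_fderiv {Ω : Set (ℂ × E)} (hΩ : IsOpen Ω) {K : ℂ × E → F}
    (hK : AnalyticOnNhd ℂ K Ω) {x : E} (hx : x ∈ tube Ω) (d : E) :
    fderiv ℂ (fun x => ∫ u in (0:ℝ)..1, K ((u:ℂ), x)) x d =
      ∫ u in (0:ℝ)..1, fderiv ℂ K ((u:ℂ), x) (0, d) := by
  have hcompl : CompleteSpace E := FiniteDimensional.complete ℂ E
  rw [(paramInt hΩ hK hx).fderiv, ContinuousLinearMap.intervalIntegral_apply]
  · simp
  · refine ContinuousOn.intervalIntegrable ?_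
    rw [uIcc_of_le zero_le_one]
    have h1 : ContinuousOn (fun u : ℝ => fderiv ℂ K ((u:ℂ), x)) (Icc 0 1) :=
      hK.fderiv.continuousOn.comp (f := fun u : ℝ => ((u:ℂ), x)) (by fun_prop)
        (fun u hu => hx u hu)
    exact h1.clm_comp continuousOn_const

end Param

end

end Rig

end

section
open scoped BigOperators
open MeasureTheory Set Filter Topology Metric Asymptotics

namespace Rig

noncomputable section

theorem anal {E F : Type*} [NormedAddCommGroup E] [NormedSpace ℂ E]
    [FiniteDimensional ℂ E] [NormedAddCommGroup F] [NormedSpace ℂ F] [CompleteSpace F]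
    {f : E → F} (hf : Differentiable ℂ f) (x : E) : AnalyticAt ℂ f x :=
  analytic_of_diff isOpen_univ hf.differentiableOn x trivial

section Div
variable {A B F : Type*} [NormedAddCommGroup A] [NormedSpace ℂ A] [FiniteDimensional ℂ A]
  [NormedAddCommGroup B] [NormedSpace ℂ B] [FiniteDimensional ℂ B]
  [NormedAddCommGroup F] [NormedSpace ℂ F] [CompleteSpace F]

def scl (p : ℂ × (A × (ℂ × B))) : A × (ℂ × B) := (p.2.1, (p.1 * p.2.2.1, p.2.2.2))

theorem scl_analytic (p : ℂ × (A × (ℂ × B))) : AnalyticAt ℂ (scl : ℂ × (A × (ℂ × B)) → _) p := by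
  have := FiniteDimensional.complete ℂ A
  have := FiniteDimensional.complete ℂ B
  refine anal ?_ p
  unfold scl
  fun_prop

theorem division {Ω : Set (A × (ℂ × B))} (hΩ : IsOpen Ω)
    (hstar : ∀ x ∈ Ω, ∀ u ∈ Icc (0:ℝ) 1, scl ((u:ℂ), x) ∈ Ω)
    {f : A × (ℂ × B) → F} (hf : AnalyticOnNhd ℂ f Ω)
    (h0 : ∀ a b, (a, ((0:ℂ), b)) ∈ Ω → f (a, (0, b)) = 0) :
    ∃ g : A × (ℂ × B) → F, AnalyticOnNhd ℂ g Ω ∧ ∀ x ∈ Ω, f x = x.2.1 • g x := by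
  let d : A × (ℂ × B) := (0, (1, 0))
  let K : ℂ × (A × (ℂ × B)) → F := fun p => fderiv ℂ f (scl p) d
  have hcont : Continuous (scl : ℂ × (A × (ℂ × B)) → _) := by unfold scl; fun_prop
  have hK : AnalyticOnNhd ℂ K (scl ⁻¹' Ω) := by
    intro p hp
    have h1 : AnalyticAt ℂ (fun p => fderiv ℂ f (scl p)) p :=
      AnalyticAt.comp (g := fderiv ℂ f) (hf _ hp).fderiv (scl_analytic p)
    exact ((ContinuousLinearMap.apply ℂ F d).analyticAt _).comp h1
  refine ⟨fun x => ∫ u in (0:ℝ)..1, K ((u:ℂ), x), ?_, ?_⟩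
  · exact (paramInt_analytic (hΩ.preimage hcont) hK).mono fun x hx u hu => hstar x hx u hu
  · intro x hx
    have hder : ∀ u ∈ uIcc (0:ℝ) 1, HasDerivAt (fun u : ℝ => f (scl ((u:ℂ), x)))
        (x.2.1 • K ((u:ℂ), x)) u := by
      intro u hu
      rw [uIcc_of_le zero_le_one] at hu
      have h1 : HasFDerivAt f (fderiv ℂ f (scl ((u:ℂ), x))) (scl ((u:ℂ), x)) :=
        (hf _ (hstar x hx u hu)).differentiableAt.hasFDerivAt
      have h2 : HasDerivAt (fun u : ℝ => scl ((u:ℂ), x)) (x.2.1 • d) u := by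
        have e1 : HasDerivAt (fun u : ℝ => (u:ℂ) * x.2.1) (1 * x.2.1) u :=
          (Complex.ofRealCLM.hasDerivAt (x := u)).mul_const x.2.1
        have := (hasDerivAt_const u x.1).prodMk (e1.prodMk (hasDerivAt_const u x.2.2))
        simpa [scl, d] using this
      have := (h1.restrictScalars ℝ).comp_hasDerivAt u h2
      simpa [K, map_smul, Function.comp_def] using this
    have hKc : ContinuousOn (fun u : ℝ => K ((u:ℂ), x)) (uIcc (0:ℝ) 1) := by
      rw [uIcc_of_le zero_le_one]
      exact hK.continuousOn.comp (f := fun u : ℝ => ((u:ℂ), x)) (by fun_prop)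
        (fun u hu => hstar x hx u hu)
    have := intervalIntegral.integral_eq_sub_of_hasDerivAt hder
      ((hKc.const_smul x.2.1).intervalIntegrable)
    rw [intervalIntegral.integral_smul] at this
    rw [this]
    have h00 := h0 x.1 x.2.2 (by simpa [scl] using hstar x hx 0 (by simp))
    simp [scl, h00]

theorem division_pow (k : ℕ) {Ω : Set (A × (ℂ × B))} (hΩ : IsOpen Ω)
    (hstar : ∀ x ∈ Ω, ∀ u ∈ Icc (0:ℝ) 1, scl ((u:ℂ), x) ∈ Ω) :
    ∀ {f : A × (ℂ × B) → F}, AnalyticOnNhd ℂ f Ω →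
    (∀ a b, (a, ((0:ℂ), b)) ∈ Ω →
      (fun s : ℂ => f (a, (s, b))) =O[𝓝[≠] 0] (fun s : ℂ => s ^ k)) →
    ∃ g : A × (ℂ × B) → F, AnalyticOnNhd ℂ g Ω ∧ ∀ x ∈ Ω, f x = x.2.1 ^ k • g x := by
  induction k with
  | zero => intro f hf _; exact ⟨f, hf, by simp⟩
  | succ k ih =>
    intro f hf hO
    have hline : ∀ a b, (a, ((0:ℂ), b)) ∈ Ω → ∀ᶠ s in 𝓝 (0:ℂ), (a, (s, b)) ∈ Ω := by
      intro a b hab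
      have : Continuous fun s : ℂ => (a, (s, b)) := by fun_prop
      exact this.continuousAt.eventually (hΩ.mem_nhds hab)
    obtain ⟨g, hg, hfg⟩ := division hΩ hstar hf (by
      intro a b hab
      have h1 : Tendsto (fun s : ℂ => f (a, (s, b))) (𝓝[≠] 0) (𝓝 0) := by
        refine (hO a b hab).trans_tendsto ?_
        have : Tendsto (fun s : ℂ => s ^ (k+1)) (𝓝 0) (𝓝 (0 ^ (k+1))) :=
          (continuous_pow (k+1)).tendsto 0
        rw [zero_pow (by omega)] at this
        exact this.mono_left nhdsWithin_le_nhds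
      have h2 : Tendsto (fun s : ℂ => f (a, (s, b))) (𝓝[≠] 0) (𝓝 (f (a, (0, b)))) := by
        have hc : ContinuousAt (fun s : ℂ => f (a, (s, b))) 0 :=
          ContinuousAt.comp (g := f) (hf _ hab).continuousAt (by fun_prop)
        exact hc.tendsto.mono_left nhdsWithin_le_nhds
      exact tendsto_nhds_unique h2 h1)
    obtain ⟨g', hg', hgg'⟩ := ih hg (by
      intro a b hab
      obtain ⟨C, hC⟩ := (hO a b hab).bound
      refine IsBigO.of_bound C ?_
      filter_upwards [hC, self_mem_nhdsWithin, (hline a b hab).filter_mono nhdsWithin_le_nhds]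
        with s hs hs0 hsΩ
      rw [hfg _ hsΩ, norm_smul, norm_pow, pow_succ'] at hs
      have h0 : 0 < ‖s‖ := norm_pos_iff.2 hs0
      rw [norm_pow]
      refine le_of_mul_le_mul_left ?_ h0
      simp only at hs
      linarith)
    refine ⟨g', hg', fun x hx => ?_⟩
    rw [hfg x hx, hgg' x hx, smul_smul, pow_succ']

end Div

end

end Rig

end

section
open scoped BigOperators
open MeasureTheory Set Filter Topology Metric Asymptotics

namespace Rig

noncomputable section

theorem contraction_fix {E F : Type*} [NormedAddCommGroup E] [NormedSpace ℂ E]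
    [FiniteDimensional ℂ E] [NormedAddCommGroup F] [NormedSpace ℂ F] [CompleteSpace F]
    {Ω : Set E} (hΩ : IsOpen Ω) (c : E → F) (ρ : ℝ) (S : (E → F) → (E → F))
    (hS : ∀ g, AnalyticOnNhd ℂ g Ω → (∀ x ∈ Ω, ‖g x - c x‖ ≤ ρ) →
      AnalyticOnNhd ℂ (S g) Ω ∧ (∀ x ∈ Ω, ‖S g x - c x‖ ≤ ρ))
    (hL : ∀ g g', AnalyticOnNhd ℂ g Ω → (∀ x ∈ Ω, ‖g x - c x‖ ≤ ρ) →
      AnalyticOnNhd ℂ g' Ω → (∀ x ∈ Ω, ‖g' x - c x‖ ≤ ρ) →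
      ∀ C, (∀ x ∈ Ω, ‖g x - g' x‖ ≤ C) → ∀ x ∈ Ω, ‖S g x - S g' x‖ ≤ C / 2)
    (hρ : 0 ≤ ρ) (hc : AnalyticOnNhd ℂ c Ω) :
    ∃ g, AnalyticOnNhd ℂ g Ω ∧ (∀ x ∈ Ω, ‖g x - c x‖ ≤ ρ) ∧ ∀ x ∈ Ω, g x = S g x := by
  let G : ℕ → E → F := fun n => S^[n] c
  have hsucc : ∀ n, G (n+1) = S (G n) := fun n => Function.iterate_succ_apply' S n c
  have hG : ∀ n, AnalyticOnNhd ℂ (G n) Ω ∧ ∀ x ∈ Ω, ‖G n x - c x‖ ≤ ρ := by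
    intro n
    induction n with
    | zero => exact ⟨hc, fun x _ => by simpa [G] using hρ⟩
    | succ n ih => rw [hsucc]; exact hS _ ih.1 ih.2
  have hd : ∀ n, ∀ x ∈ Ω, ‖G n x - G (n+1) x‖ ≤ ρ * (1/2)^n := by
    intro n
    induction n with
    | zero => intro x hx; rw [norm_sub_rev]; simpa [G] using (hG 1).2 x hx
    | succ n ih =>
      intro x hx
      have := hL _ _ (hG n).1 (hG n).2 (hG (n+1)).1 (hG (n+1)).2 _ ih x hx
      rw [hsucc (n+1)]
      nth_rewrite 1 [hsucc n]
      refine this.trans (le_of_eq ?_)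
      rw [pow_succ]; ring
  have hcau : ∀ x ∈ Ω, CauchySeq fun n => G n x := fun x hx =>
    cauchySeq_of_le_geometric (1/2) ρ (by norm_num) (fun n => by
      rw [dist_eq_norm]; exact hd n x hx)
  have hlim : ∀ x, ∃ y, x ∈ Ω → Tendsto (fun n => G n x) atTop (𝓝 y) := by
    intro x
    by_cases hx : x ∈ Ω
    · obtain ⟨y, hy⟩ := cauchySeq_tendsto_of_complete (hcau x hx)
      exact ⟨y, fun _ => hy⟩
    · exact ⟨0, fun h => absurd h hx⟩
  choose g hg using hlim
  have hb : ∀ n, ∀ x ∈ Ω, ‖G n x - g x‖ ≤ ρ * (1/2)^n / (1 - 1/2) := by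
    intro n x hx
    rw [← dist_eq_norm]
    exact dist_le_of_le_geometric_of_tendsto (1/2) ρ (by norm_num) (fun n => by
      rw [dist_eq_norm]; exact hd n x hx) (hg x hx) n
  have hz : Tendsto (fun n : ℕ => ρ * (1/2:ℝ)^n / (1 - 1/2)) atTop (𝓝 0) := by
    have := (tendsto_pow_atTop_nhds_zero_of_lt_one (r := (1/2:ℝ)) (by norm_num) (by norm_num))
    simpa using (this.const_mul ρ).div_const (1 - 1/2)
  have hu : TendstoUniformlyOn G g atTop Ω := by
    rw [Metric.tendstoUniformlyOn_iff]
    intro ε hε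
    filter_upwards [hz.eventually (gt_mem_nhds hε)] with n hn x hx
    rw [dist_comm, dist_eq_norm]
    exact (hb n x hx).trans_lt hn
  have hga : AnalyticOnNhd ℂ g Ω := analytic_limit hΩ (fun n => (hG n).1) hu
  have hgb : ∀ x ∈ Ω, ‖g x - c x‖ ≤ ρ := fun x hx =>
    le_of_tendsto ((hg x hx).sub_const _).norm (Eventually.of_forall fun n => (hG n).2 x hx)
  refine ⟨g, hga, hgb, fun x hx => ?_⟩
  have h1 : Tendsto (fun n => G (n+1) x) atTop (𝓝 (g x)) := (tendsto_add_atTop_iff_nat 1).2 (hg x hx)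
  have h2 : Tendsto (fun n => G (n+1) x) atTop (𝓝 (S g x)) := by
    rw [tendsto_iff_norm_sub_tendsto_zero]
    refine squeeze_zero (fun _ => norm_nonneg _) (fun n => ?_) (by simpa only [zero_div] using hz.div_const 2)
    rw [hsucc]
    exact hL _ _ (hG n).1 (hG n).2 hga hgb _ (hb n) x hx
  exact tendsto_nhds_unique h1 h2

end

end Rig

end

section
open scoped BigOperators
open MeasureTheory Set Filter Topology Metric Asymptotics

namespace Rig

noncomputable section

abbrev Ev (m : ℕ) := Fin m → ℂ
abbrev Pm (n : ℕ) := ℂ × (Fin n → ℂ)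
abbrev tpi : ℂ := 2 * Real.pi * Complex.I

variable {m p n : ℕ}

def wt (w : Fin p → Fin m → ℤ) (j : Fin p) : Ev m := fun k => (w j k : ℂ)

def ex (w : Fin p → Fin m → ℤ) (τ : Fin p → ℂ) : Ev m :=
  fun k => Complex.exp (tpi * ∑ j, τ j * (w j k : ℂ))

def Tset (p : ℕ) (κ : ℝ) : Set (Fin p → ℂ) := {τ | ‖τ‖ < 3 ∧ ∀ j, |(τ j).im| < κ}

def Dom (m n : ℕ) (r e : ℝ) : Set (Ev m × Pm n) := ball 0 r ×ˢ ball 0 e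

theorem isOpen_Dom (r e : ℝ) : IsOpen (Dom m n r e) := isOpen_ball.prod isOpen_ball

theorem isOpen_Tset (κ : ℝ) : IsOpen (Tset p κ) := by
  unfold Tset
  have h1 : IsOpen {τ : Fin p → ℂ | ‖τ‖ < 3} := isOpen_lt continuous_norm continuous_const
  have h2 : IsOpen {τ : Fin p → ℂ | ∀ j, |(τ j).im| < κ} := by
    simp only [Set.ofPred_forall]
    exact isOpen_iInter_of_finite fun j => isOpen_lt (by fun_prop) continuous_const
  exact h1.inter h2

theorem Tset_smul {κ : ℝ} {τ : Fin p → ℂ} (h : τ ∈ Tset p κ) {u : ℝ} (hu : |u| ≤ 1) :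
    (u : ℂ) • τ ∈ Tset p κ := by
  refine ⟨?_, fun j => ?_⟩
  · rw [norm_smul]
    have : ‖(u:ℂ)‖ ≤ 1 := by simpa using hu
    calc ‖(u:ℂ)‖ * ‖τ‖ ≤ 1 * ‖τ‖ := by gcongr
      _ < 3 := by simpa using h.1
  · have : (((u : ℂ) • τ) j).im = u * (τ j).im := by simp
    rw [this, abs_mul]
    calc |u| * |(τ j).im| ≤ 1 * |(τ j).im| := by gcongr
      _ < κ := by simpa using h.2 j

theorem ex_zero (w : Fin p → Fin m → ℤ) : ex w 0 = 1 := by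
  ext k; simp [ex]

theorem ex_add (w : Fin p → Fin m → ℤ) (τ τ' : Fin p → ℂ) : ex w (τ + τ') = ex w τ * ex w τ' := by
  ext k
  simp only [ex, Pi.mul_apply, ← Complex.exp_add, Pi.add_apply, add_mul, Finset.sum_add_distrib,
    mul_add]

theorem ex_neg_mul (w : Fin p → Fin m → ℤ) (τ : Fin p → ℂ) : ex w (-τ) * ex w τ = 1 := by
  rw [← ex_add, neg_add_cancel, ex_zero]

theorem ex_diff (w : Fin p → Fin m → ℤ) : Differentiable ℂ (ex w) := by
  unfold ex; fun_prop

theorem ex_fderiv (w : Fin p → Fin m → ℤ) (τ d : Fin p → ℂ) :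
    fderiv ℂ (ex w) τ d = tpi • ((∑ j, d j • wt w j) * ex w τ) := by
  have h : HasFDerivAt (ex w) (ContinuousLinearMap.pi fun k =>
      (Complex.exp (tpi * ∑ j, τ j * (w j k : ℂ))) •
        (tpi • ∑ j, (w j k : ℂ) • ContinuousLinearMap.proj (R := ℂ) (φ := fun _ : Fin p => ℂ) j)) τ := by
    rw [hasFDerivAt_pi]
    intro k
    refine HasFDerivAt.cexp ?_
    refine HasFDerivAt.const_mul ?_ _
    refine HasFDerivAt.fun_sum fun j _ => ?_
    exact (hasFDerivAt_apply j τ).mul_const _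
  rw [h.fderiv]
  ext k
  simp [ex, wt, Finset.sum_apply, mul_comm, mul_assoc, mul_left_comm]

theorem ex_bound (w : Fin p → Fin m → ℤ) : ∃ κ > 0, ∀ τ ∈ Tset p κ, ‖ex w τ‖ ≤ 3/2 := by
  set W : ℝ := ∑ j, ∑ k, |(w j k : ℝ)| + 1 with hW
  have hWpos : 0 < W := by positivity
  have hlog : 0 < Real.log (3/2) := Real.log_pos (by norm_num)
  refine ⟨Real.log (3/2) / (2 * Real.pi * W), by positivity, fun τ hτ => ?_⟩
  rw [pi_norm_le_iff_of_nonneg (by norm_num)]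
  intro k
  have h1 : ‖ex w τ k‖ = Real.exp (-(2 * Real.pi * ∑ j, (τ j).im * (w j k : ℝ))) := by
    rw [ex, Complex.norm_exp]
    congr 1
    have : tpi * ∑ j, τ j * (w j k : ℂ) = ((2 * Real.pi : ℝ) : ℂ) * (Complex.I * ∑ j, τ j * (w j k : ℂ)) := by
      simp only [tpi]; push_cast; ring
    rw [this, Complex.re_ofReal_mul]
    simp [Complex.mul_re]
  rw [h1]
  have h2 : -(2 * Real.pi * ∑ j, (τ j).im * (w j k : ℝ)) ≤ Real.log (3/2) := by
    have h3 : |∑ j, (τ j).im * (w j k : ℝ)| ≤ Real.log (3/2) / (2 * Real.pi * W) * W := by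
      refine (Finset.abs_sum_le_sum_abs _ _).trans ?_
      calc ∑ j, |(τ j).im * (w j k : ℝ)| ≤ ∑ j, Real.log (3/2) / (2 * Real.pi * W) * |(w j k : ℝ)| := by
            refine Finset.sum_le_sum fun j _ => ?_
            rw [abs_mul]
            exact mul_le_mul_of_nonneg_right (hτ.2 j).le (abs_nonneg _)
        _ = Real.log (3/2) / (2 * Real.pi * W) * ∑ j, |(w j k : ℝ)| := by rw [Finset.mul_sum]
        _ ≤ _ := by
            refine mul_le_mul_of_nonneg_left ?_ (by positivity)
            rw [hW]
            have : ∑ j, |(w j k : ℝ)| ≤ ∑ j, ∑ k, |(w j k : ℝ)| :=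
              Finset.sum_le_sum fun j _ => Finset.single_le_sum (f := fun k => |(w j k : ℝ)|)
                (fun _ _ => abs_nonneg _) (Finset.mem_univ k)
            linarith
    have h4 : Real.log (3/2) / (2 * Real.pi * W) * W = Real.log (3/2) / (2 * Real.pi) := by
      field_simp
    rw [h4] at h3
    have h5 := (abs_le.1 h3).1
    have : 2 * Real.pi * (Real.log (3/2) / (2 * Real.pi)) = Real.log (3/2) := by field_simp
    nlinarith [Real.pi_pos]
  calc _ ≤ Real.exp (Real.log (3/2)) := Real.exp_le_exp.2 h2
    _ = 3/2 := Real.exp_log (by norm_num)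

/-- The perturbed fields. -/
def Yf (w : Fin p → Fin m → ℤ) (R : Fin p → Ev m × Pm n → Ev m) (j : Fin p) (x : Ev m × Pm n) : Ev m :=
  wt w j * x.1 + x.2.1 • R j x

theorem hasFDerivAt_slice {A B F : Type*} [NormedAddCommGroup A] [NormedSpace ℂ A]
    [NormedAddCommGroup B] [NormedSpace ℂ B] [NormedAddCommGroup F] [NormedSpace ℂ F]
    {f : A × B → F} {a : A} {b : B} (h : DifferentiableAt ℂ f (a, b)) :
    HasFDerivAt (fun v => f (v, b)) ((fderiv ℂ f (a, b)).comp (ContinuousLinearMap.inl ℂ A B)) a :=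
  h.hasFDerivAt.comp a (hasFDerivAt_prodMk_left a b)

theorem exists_bounds {R : Fin p → Ev m × Pm n → Ev m} {e0 : ℝ} (he0 : 0 < e0)
    (hR : ∀ j, AnalyticOnNhd ℂ (R j) (Dom m n 4 e0)) :
    ∃ C > 0, ∀ j, (∀ v ∈ closedBall (0 : Ev m) (15/4), ∀ ε ∈ ball (0 : Pm n) (e0/2), ‖R j (v, ε)‖ ≤ C) ∧
      (∀ v ∈ closedBall (0 : Ev m) (15/4), ∀ v' ∈ closedBall (0 : Ev m) (15/4),
        ∀ ε ∈ ball (0 : Pm n) (e0/2), ‖R j (v, ε) - R j (v', ε)‖ ≤ C * ‖v - v'‖) := by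
  have hK : IsCompact (closedBall (0 : Ev m) (15/4) ×ˢ closedBall (0 : Pm n) (e0/2)) :=
    (isCompact_closedBall _ _).prod (isCompact_closedBall _ _)
  have hKD : closedBall (0 : Ev m) (15/4) ×ˢ closedBall (0 : Pm n) (e0/2) ⊆ Dom m n 4 e0 :=
    prod_mono (closedBall_subset_ball (by norm_num)) (closedBall_subset_ball (by linarith))
  have h1 : ∀ j, ∃ C, ∀ x ∈ closedBall (0 : Ev m) (15/4) ×ˢ closedBall (0 : Pm n) (e0/2), ‖R j x‖ ≤ C :=
    fun j => hK.exists_bound_of_continuousOn ((hR j).continuousOn.mono hKD)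
  have h2 : ∀ j, ∃ C, ∀ x ∈ closedBall (0 : Ev m) (15/4) ×ˢ closedBall (0 : Pm n) (e0/2),
      ‖(fderiv ℂ (R j) x).comp (ContinuousLinearMap.inl ℂ (Ev m) (Pm n))‖ ≤ C :=
    fun j => by
    have hc0 : ContinuousOn (fun x => fderiv ℂ (R j) x)
      (closedBall (0 : Ev m) (15/4) ×ˢ closedBall (0 : Pm n) (e0/2)) :=
      (hR j).fderiv.continuousOn.mono hKD
    have hc1 : ContinuousOn (fun x => (fderiv ℂ (R j) x).comp (ContinuousLinearMap.inl ℂ (Ev m) (Pm n)))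
      (closedBall (0 : Ev m) (15/4) ×ˢ closedBall (0 : Pm n) (e0/2)) :=
      hc0.clm_comp continuousOn_const
    exact hK.exists_bound_of_continuousOn hc1
  choose C1 hC1 using h1
  choose C2 hC2 using h2
  refine ⟨∑ j, (|C1 j| + |C2 j|) + 1, by positivity, fun j => ⟨?_, ?_⟩⟩
  · intro v hv ε hε
    have h3 := hC1 j (v, ε) ⟨hv, ball_subset_closedBall hε⟩
    have h4 : |C1 j| + |C2 j| ≤ ∑ j, (|C1 j| + |C2 j|) :=
      Finset.single_le_sum (f := fun j => |C1 j| + |C2 j|) (fun _ _ => by positivity) (Finset.mem_univ j)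
    linarith [le_abs_self (C1 j), abs_nonneg (C2 j)]
  · intro v hv v' hv' ε hε
    have h4 : |C1 j| + |C2 j| ≤ ∑ j, (|C1 j| + |C2 j|) :=
      Finset.single_le_sum (f := fun j => |C1 j| + |C2 j|) (fun _ _ => by positivity) (Finset.mem_univ j)
    refine Convex.norm_image_sub_le_of_norm_hasFDerivWithin_le (𝕜 := ℂ)
      (f := fun v => R j (v, ε))
      (f' := fun v => (fderiv ℂ (R j) (v, ε)).comp (ContinuousLinearMap.inl ℂ (Ev m) (Pm n)))
      (s := closedBall (0 : Ev m) (15/4)) ?_ ?_ (convex_closedBall _ _) hv' hv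
    · intro x hx
      have hmem : (x, ε) ∈ Dom m n 4 e0 := hKD ⟨hx, ball_subset_closedBall hε⟩
      exact (hasFDerivAt_slice (hR j (x, ε) hmem).differentiableAt).hasFDerivWithinAt
    · intro x hx
      have h3 := hC2 j (x, ε) ⟨hx, ball_subset_closedBall hε⟩
      linarith [le_abs_self (C2 j), abs_nonneg (C1 j)]

end

end Rig

end

section
open scoped BigOperators
open MeasureTheory Set Filter Topology Metric Asymptotics

namespace Rig

noncomputable section
variable {m p n : ℕ}

abbrev Tot (p m n : ℕ) := (Fin p → ℂ) × (Ev m × Pm n)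

def Kf (w : Fin p → Fin m → ℤ) (R : Fin p → Ev m × Pm n → Ev m) (g : Tot p m n → Ev m)
    (z : ℂ × Tot p m n) : Ev m :=
  ex w (-(z.1 • z.2.1)) * (tpi • ∑ j, z.2.1 j •
    R j (ex w (z.1 • z.2.1) * g (z.1 • z.2.1, z.2.2), z.2.2.2))

def Om (p m n : ℕ) (κ e : ℝ) : Set (Tot p m n) := Tset p κ ×ˢ Dom m n 2 e

theorem Om_t {κ e : ℝ} {π : Tot p m n} (h : π ∈ Om p m n κ e) : π.1 ∈ Tset p κ := h.1
theorem Om_x {κ e : ℝ} {π : Tot p m n} (h : π ∈ Om p m n κ e) : π.2 ∈ Dom m n 2 e := h.2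
theorem Om_v {κ e : ℝ} {π : Tot p m n} (h : π ∈ Om p m n κ e) : π.2.1 ∈ ball (0 : Ev m) 2 := h.2.1
theorem Om_e {κ e : ℝ} {π : Tot p m n} (h : π ∈ Om p m n κ e) : π.2.2 ∈ ball (0 : Pm n) e := h.2.2

theorem isOpen_Om (κ e : ℝ) : IsOpen (Om p m n κ e) := (isOpen_Tset κ).prod (isOpen_Dom 2 e)

def Omu (p m n : ℕ) (κ e : ℝ) : Set (ℂ × Tot p m n) := {z | (z.1 • z.2.1, z.2.2) ∈ Om p m n κ e}

theorem isOpen_Omu (κ e : ℝ) : IsOpen (Omu p m n κ e) :=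
  (isOpen_Om κ e).preimage (by fun_prop : Continuous fun z : ℂ × Tot p m n => (z.1 • z.2.1, z.2.2))

theorem Om_tube {κ e : ℝ} {π : Tot p m n} (h : π ∈ Om p m n κ e) : π ∈ tube (Omu p m n κ e) :=
  fun u hu => ⟨Tset_smul h.1 (by rw [abs_of_nonneg hu.1]; exact hu.2), h.2⟩

theorem Kf_bd (w : Fin p → Fin m → ℤ)
    {κ : ℝ} (hκ : ∀ τ ∈ Tset p κ, ‖ex w τ‖ ≤ 3/2) {τ : Fin p → ℂ} (hτ : ‖τ‖ ≤ 3)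
    {τ' : Fin p → ℂ} (hτ' : τ' ∈ Tset p κ) (a : Fin p → Ev m) {C : ℝ} (ha : ∀ j, ‖a j‖ ≤ C) :
    ‖ex w (-τ') * (tpi • ∑ j, τ j • a j)‖ ≤ 9 * Real.pi * p * C := by
  have h0 : ‖ex w (-τ')‖ ≤ 3/2 := by
    apply hκ
    have := Tset_smul hτ' (u := -1) (by norm_num)
    simpa using this
  have h1 : ‖tpi‖ = 2 * Real.pi := by simp [tpi, abs_of_pos Real.pi_pos]
  have h2 : ‖∑ j, τ j • a j‖ ≤ p * (3 * C) := by
    refine (norm_sum_le _ _).trans ?_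
    have : ∀ j ∈ Finset.univ, ‖τ j • a j‖ ≤ 3 * C := fun j _ => by
      rw [norm_smul]
      exact mul_le_mul ((norm_le_pi_norm τ j).trans hτ) (ha j) (norm_nonneg _) (by norm_num)
    simpa using Finset.sum_le_card_nsmul _ _ _ this
  calc _ ≤ ‖ex w (-τ')‖ * ‖tpi • ∑ j, τ j • a j‖ := norm_mul_le _ _
    _ = ‖ex w (-τ')‖ * (2 * Real.pi * ‖∑ j, τ j • a j‖) := by rw [norm_smul, h1]
    _ ≤ (3/2) * (2 * Real.pi * (p * (3 * C))) := by gcongr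
    _ = _ := by ring

theorem arg_mem (w : Fin p → Fin m → ℤ) 
    {κ e : ℝ} (hκ : ∀ τ ∈ Tset p κ, ‖ex w τ‖ ≤ 3/2)
    {g : Tot p m n → Ev m} 
    (hgb : ∀ π ∈ Om p m n κ e, ‖g π - π.2.1‖ ≤ 1/2) {τ : Fin p → ℂ} {x : Ev m × Pm n}
    (h : (τ, x) ∈ Om p m n κ e) : ‖ex w τ * g (τ, x)‖ ≤ 15/4 := by
  have h1 : ‖x.1‖ ≤ 2 := by
    have := Om_v h; rw [mem_ball_zero_iff] at this; exact this.le
  have h2 : ‖g (τ, x)‖ ≤ 5/2 := by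
    have := norm_sub_norm_le (g (τ, x)) x.1
    linarith [hgb _ h]
  have h3 := hκ _ (Om_t h)
  calc _ ≤ ‖ex w τ‖ * ‖g (τ, x)‖ := norm_mul_le _ _
    _ ≤ (3/2) * (5/2) := by gcongr
    _ = _ := by norm_num

theorem Kf_analytic (w : Fin p → Fin m → ℤ) {R : Fin p → Ev m × Pm n → Ev m} 
    {κ e e0 : ℝ} (hκ : ∀ τ ∈ Tset p κ, ‖ex w τ‖ ≤ 3/2) (he : e ≤ e0 / 2) (he0 : 0 < e0)
    (hR : ∀ j, AnalyticOnNhd ℂ (R j) (Dom m n 4 e0)) 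
    {g : Tot p m n → Ev m} (hg : AnalyticOnNhd ℂ g (Om p m n κ e))
    (hgb : ∀ π ∈ Om p m n κ e, ‖g π - π.2.1‖ ≤ 1/2) :
    AnalyticOnNhd ℂ (Kf w R g) (Omu p m n κ e) := by
  refine analytic_of_diff (isOpen_Omu κ e) fun z hz => DifferentiableAt.differentiableWithinAt ?_
  have hin : DifferentiableAt ℂ (fun z : ℂ × Tot p m n => (z.1 • z.2.1, z.2.2)) z := by fun_prop
  have hgz : DifferentiableAt ℂ (fun z : ℂ × Tot p m n => g (z.1 • z.2.1, z.2.2)) z :=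
    DifferentiableAt.comp (g := g) z (hg _ hz).differentiableAt hin
  have hex : DifferentiableAt ℂ (fun z : ℂ × Tot p m n => ex w (z.1 • z.2.1)) z :=
    ((ex_diff w) _).comp z (by fun_prop : DifferentiableAt ℂ (fun z : ℂ × Tot p m n => z.1 • z.2.1) z)
  have hexn : DifferentiableAt ℂ (fun z : ℂ × Tot p m n => ex w (-(z.1 • z.2.1))) z :=
    ((ex_diff w) _).comp z (by fun_prop : DifferentiableAt ℂ (fun z : ℂ × Tot p m n => -(z.1 • z.2.1)) z)
  have hRj : ∀ j, DifferentiableAt ℂ (fun z : ℂ × Tot p m n =>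
      R j (ex w (z.1 • z.2.1) * g (z.1 • z.2.1, z.2.2), z.2.2.2)) z := by
    intro j
    refine DifferentiableAt.comp (g := R j) z (hR j _ ?_).differentiableAt
      ((hex.mul hgz).prodMk (by fun_prop))
    have h1 := arg_mem w hκ hgb hz
    refine ⟨?_, ?_⟩
    · rw [mem_ball_zero_iff]; exact lt_of_le_of_lt h1 (by norm_num)
    · exact ball_subset_ball (by linarith) hz.2.2
  have hsum : DifferentiableAt ℂ (fun z : ℂ × Tot p m n => ∑ j, z.2.1 j •
      R j (ex w (z.1 • z.2.1) * g (z.1 • z.2.1, z.2.2), z.2.2.2)) z :=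
    DifferentiableAt.fun_sum fun j _ => DifferentiableAt.smul
      (by fun_prop : DifferentiableAt ℂ (fun z : ℂ × Tot p m n => z.2.1 j) z) (hRj j)
  exact hexn.mul (hsum.const_smul tpi)

set_option maxHeartbeats 1000000 in
theorem flow_aux (w : Fin p → Fin m → ℤ) {R : Fin p → Ev m × Pm n → Ev m} {e0 : ℝ} (he0 : 0 < e0)
    (hR : ∀ j, AnalyticOnNhd ℂ (R j) (Dom m n 4 e0)) :
    ∃ κ > 0, (∀ τ ∈ Tset p κ, ‖ex w τ‖ ≤ 3/2) ∧ ∃ e1 > 0, e1 ≤ e0 / 2 ∧ ∃ C, 0 < C ∧ ∃ g : Tot p m n → Ev m,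
      AnalyticOnNhd ℂ g (Om p m n κ e1) ∧ (∀ π ∈ Om p m n κ e1, ‖g π - π.2.1‖ ≤ 1/2) ∧
      (∀ π ∈ Om p m n κ e1, ‖g π - π.2.1‖ ≤ ‖π.2.2.1‖ * C) ∧
      ∀ π ∈ Om p m n κ e1, g π = π.2.1 + π.2.2.1 • ∫ u in (0:ℝ)..1, Kf w R g ((u:ℂ), π) := by
  obtain ⟨κ, hκ0, hκ⟩ := ex_bound w
  obtain ⟨C, hC, hCb⟩ := exists_bounds he0 hR
  set M : ℝ := 9 * Real.pi * p * C with hM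
  have hM0 : 0 ≤ M := by positivity
  set e1 : ℝ := min (e0 / 2) (1 / (2 * (2 * M + 1))) with he1
  have he1pos : 0 < e1 := lt_min (by positivity) (by positivity)
  have he1le : e1 ≤ e0 / 2 := min_le_left _ _
  have he1M : e1 * (2 * M + 1) ≤ 1/2 := by
    calc e1 * (2 * M + 1) ≤ 1 / (2 * (2 * M + 1)) * (2 * M + 1) := by
          gcongr; exact min_le_right _ _
      _ = 1/2 := by field_simp
  have hs : ∀ π ∈ Om p m n κ e1, ‖π.2.2.1‖ ≤ e1 := by
    intro π h
    have := Om_e h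
    rw [mem_ball_zero_iff] at this
    exact (norm_fst_le π.2.2).trans this.le
  have heb : ∀ π ∈ Om p m n κ e1, π.2.2 ∈ ball (0 : Pm n) (e0 / 2) :=
    fun π h => ball_subset_ball he1le (Om_e h)
  have hKb : ∀ g : Tot p m n → Ev m, (∀ π ∈ Om p m n κ e1, ‖g π - π.2.1‖ ≤ 1/2) →
      ∀ π ∈ Om p m n κ e1, ‖∫ u in (0:ℝ)..1, Kf w R g ((u:ℂ), π)‖ ≤ M := by
    intro g hgb π h
    have : ∀ u ∈ uIoc (0:ℝ) 1, ‖Kf w R g ((u:ℂ), π)‖ ≤ M := by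
      intro u hu
      rw [uIoc_of_le zero_le_one] at hu
      have hz : ((u:ℂ) • π.1, π.2) ∈ Om p m n κ e1 := Om_tube h u (Ioc_subset_Icc_self hu)
      have ha : ∀ j, ‖R j (ex w ((u:ℂ) • π.1) * g ((u:ℂ) • π.1, π.2), π.2.2)‖ ≤ C := by
        intro j
        refine (hCb j).1 (ex w ((u:ℂ) • π.1) * g ((u:ℂ) • π.1, π.2)) ?_ π.2.2
          (heb π h)
        rw [mem_closedBall_zero_iff]
        exact arg_mem w hκ hgb hz
      exact Kf_bd w hκ (Om_t h).1.le (Om_t hz)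
        (fun j => R j (ex w ((u:ℂ) • π.1) * g ((u:ℂ) • π.1, π.2), π.2.2)) ha
    simpa using intervalIntegral.norm_integral_le_of_norm_le_const this
  have hcan : AnalyticOnNhd ℂ (fun π : Tot p m n => π.2.1) (Om p m n κ e1) :=
    fun π _ => anal (by fun_prop) π
  obtain ⟨g, hg, hgb, hfix⟩ := contraction_fix (isOpen_Om κ e1) (fun π : Tot p m n => π.2.1) (1/2)
    (fun g π => π.2.1 + π.2.2.1 • ∫ u in (0:ℝ)..1, Kf w R g ((u:ℂ), π)) (by
      intro g hg hgb
      refine ⟨?_, ?_⟩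
      · have h1 := (paramInt_analytic (isOpen_Omu κ e1) (Kf_analytic w hκ he1le he0 hR hg hgb)).mono
          (fun π hπ => Om_tube hπ)
        exact hcan.add (AnalyticOnNhd.smul (fun π _ => anal (f := fun π : Tot p m n => π.2.2.1) (by fun_prop) π) h1)
      · intro π h
        simp only [add_sub_cancel_left, norm_smul]
        have := hKb g hgb π h
        calc ‖π.2.2.1‖ * ‖∫ u in (0:ℝ)..1, Kf w R g ((u:ℂ), π)‖ ≤ e1 * M := by
              gcongr; exact hs π h
          _ ≤ 1/2 := by nlinarith) (by
      intro g g' hg hgb hg' hgb' D hD π h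
      simp only [add_sub_add_left_eq_sub, ← smul_sub]
      have hitg : ∀ g : Tot p m n → Ev m, AnalyticOnNhd ℂ g (Om p m n κ e1) →
          (∀ π ∈ Om p m n κ e1, ‖g π - π.2.1‖ ≤ 1/2) →
          IntervalIntegrable (fun u : ℝ => Kf w R g ((u:ℂ), π)) volume 0 1 := by
        intro g hg hgb
        refine ContinuousOn.intervalIntegrable ?_
        rw [uIcc_of_le zero_le_one]
        exact (Kf_analytic w hκ he1le he0 hR hg hgb).continuousOn.comp
          (f := fun u : ℝ => ((u:ℂ), π)) (by fun_prop) (Om_tube h)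
      rw [← intervalIntegral.integral_sub (hitg g hg hgb) (hitg g' hg' hgb'), norm_smul]
      have hD0 : 0 ≤ D := (norm_nonneg _).trans (hD π h)
      have : ∀ u ∈ uIoc (0:ℝ) 1, ‖Kf w R g ((u:ℂ), π) - Kf w R g' ((u:ℂ), π)‖ ≤ M * (3/2 * D) := by
        intro u hu
        rw [uIoc_of_le zero_le_one] at hu
        have hz : ((u:ℂ) • π.1, π.2) ∈ Om p m n κ e1 := Om_tube h u (Ioc_subset_Icc_self hu)
        have e : Kf w R g ((u:ℂ), π) - Kf w R g' ((u:ℂ), π) = ex w (-((u:ℂ) • π.1)) * (tpi • ∑ j, π.1 j •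
          (R j (ex w ((u:ℂ) • π.1) * g ((u:ℂ) • π.1, π.2), π.2.2) -
            R j (ex w ((u:ℂ) • π.1) * g' ((u:ℂ) • π.1, π.2), π.2.2))) := by
          simp only [Kf, smul_sub, Finset.sum_sub_distrib, mul_sub]
        rw [e]
        have := Kf_bd w hκ (Om_t h).1.le (Om_t hz) (fun j =>
          (R j (ex w ((u:ℂ) • π.1) * g ((u:ℂ) • π.1, π.2), π.2.2) -
            R j (ex w ((u:ℂ) • π.1) * g' ((u:ℂ) • π.1, π.2), π.2.2))) (C := C * (3/2 * D)) (by
          intro j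
          refine ((hCb j).2 (ex w ((u:ℂ) • π.1) * g ((u:ℂ) • π.1, π.2)) ?_
            (ex w ((u:ℂ) • π.1) * g' ((u:ℂ) • π.1, π.2)) ?_ π.2.2 (heb π h)).trans ?_
          · rw [mem_closedBall_zero_iff]; exact arg_mem w hκ hgb hz
          · rw [mem_closedBall_zero_iff]; exact arg_mem w hκ hgb' hz
          · rw [← mul_sub]
            gcongr
            refine (norm_mul_le _ _).trans ?_
            gcongr
            · exact hκ _ (Om_t hz)
            · exact hD _ hz)
        refine this.trans (le_of_eq ?_)
        rw [hM]; ring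
      have h2 := intervalIntegral.norm_integral_le_of_norm_le_const this
      simp only [sub_zero, abs_one, mul_one] at h2
      calc _ ≤ e1 * (M * (3/2 * D)) := by gcongr; exact hs π h
        _ ≤ D / 2 := by
          have : e1 * M * (3/2) ≤ 1/2 := by nlinarith
          nlinarith) (by norm_num) hcan
  refine ⟨κ, hκ0, hκ, e1, he1pos, he1le, M + 1, by positivity, g, hg, hgb, ?_, hfix⟩
  intro π h
  have h1 : g π - π.2.1 = π.2.2.1 • ∫ u in (0:ℝ)..1, Kf w R g ((u:ℂ), π) := by
    rw [hfix π h]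
    simp only [add_sub_cancel_left]
  rw [h1, norm_smul]
  gcongr
  linarith [hKb g hgb π h]

end

end Rig

end

section
open scoped BigOperators
open MeasureTheory Set Filter Topology Metric Asymptotics

namespace Rig

noncomputable section
variable {m p n : ℕ}

theorem hasDerivAt_ofReal {F : Type*} [NormedAddCommGroup F] [NormedSpace ℂ F] {f : ℂ → F} {f' : F} {σ : ℝ}
    (h : HasDerivAt f f' (σ:ℂ)) : HasDerivAt (fun t : ℝ => f (t:ℂ)) f' σ := by
  have h2 : HasDerivAt (fun t : ℝ => (t:ℂ)) 1 σ := Complex.ofRealCLM.hasDerivAt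
  simpa [Function.comp_def] using h.scomp σ h2

theorem ex_line (w : Fin p → Fin m → ℤ) (τ : Fin p → ℂ) (σ : ℝ) :
    HasDerivAt (fun t : ℝ => ex w ((t:ℂ) • τ)) (tpi • ((∑ j, τ j • wt w j) * ex w ((σ:ℂ) • τ))) σ := by
  have h1 : HasDerivAt (fun t : ℂ => ex w (t • τ)) (fderiv ℂ (ex w) ((σ:ℂ) • τ) τ) (σ:ℂ) := by
    have h2 : HasDerivAt (fun t : ℂ => t • τ) τ (σ:ℂ) := by
      simpa using (hasDerivAt_id (σ:ℂ)).smul_const τ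
    exact ((ex_diff w _).hasFDerivAt).comp_hasDerivAt (σ:ℂ) h2
  rw [ex_fderiv] at h1
  exact hasDerivAt_ofReal h1

theorem euler (w : Fin p → Fin m → ℤ) {R : Fin p → Ev m × Pm n → Ev m} {e0 κ e : ℝ} (he0 : 0 < e0)
    (hR : ∀ j, AnalyticOnNhd ℂ (R j) (Dom m n 4 e0))
    (hκ : ∀ τ ∈ Tset p κ, ‖ex w τ‖ ≤ 3/2) (he : e ≤ e0 / 2) {g : Tot p m n → Ev m}
    (hg : AnalyticOnNhd ℂ g (Om p m n κ e)) (hgb : ∀ π ∈ Om p m n κ e, ‖g π - π.2.1‖ ≤ 1/2)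
    (hfix : ∀ π ∈ Om p m n κ e, g π = π.2.1 + π.2.2.1 • ∫ u in (0:ℝ)..1, Kf w R g ((u:ℂ), π))
    {τ : Fin p → ℂ} {x : Ev m × Pm n} (h : (τ, x) ∈ Om p m n κ e) {σ : ℝ} (hσ : σ ∈ Icc (0:ℝ) 1) :
    HasDerivAt (fun t : ℝ => ex w ((t:ℂ) • τ) * g ((t:ℂ) • τ, x))
      (tpi • ∑ j, τ j • Yf w R j (ex w ((σ:ℂ) • τ) * g ((σ:ℂ) • τ, x), x.2)) σ := by
  set S : Set ℝ := {t : ℝ | ((t:ℂ) • τ, x) ∈ Om p m n κ e} with hS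
  have hSo : IsOpen S := (isOpen_Om κ e).preimage (by fun_prop : Continuous fun t : ℝ => ((t:ℂ) • τ, x))
  have hSI : Icc (0:ℝ) 1 ⊆ S := fun u hu => Om_tube h u hu
  have hKc : ContinuousOn (fun t : ℝ => Kf w R g ((t:ℂ), (τ, x))) S :=
    (Kf_analytic w hκ he he0 hR hg hgb).continuousOn.comp
      (f := fun u : ℝ => ((u:ℂ), (τ, x))) (by fun_prop) (fun u hu => hu)
  have hSσ : S ∈ 𝓝 σ := hSo.mem_nhds (hSI hσ)
  have hF : HasDerivAt (fun t : ℝ => ∫ u in (0:ℝ)..t, Kf w R g ((u:ℂ), (τ, x)))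
      (Kf w R g ((σ:ℂ), (τ, x))) σ := by
    refine intervalIntegral.integral_hasDerivAt_right ?_ ?_ (hKc.continuousAt hSσ)
    · refine ContinuousOn.intervalIntegrable (hKc.mono ?_)
      rw [uIcc_of_le hσ.1]
      exact fun u hu => hSI ⟨hu.1, hu.2.trans hσ.2⟩
    · exact hKc.stronglyMeasurableAtFilter hSo σ (hSI hσ)
  have hgd : HasDerivAt (fun t : ℝ => g ((t:ℂ) • τ, x)) (x.2.1 • Kf w R g ((σ:ℂ), (τ, x))) σ := by
    have h1 := (hF.const_smul x.2.1).const_add x.1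
    refine h1.congr_of_eventuallyEq ?_
    filter_upwards [hSσ] with t ht
    rw [hfix _ ht]
    congr 2
    have h2 := intervalIntegral.smul_integral_comp_mul_right (a := 0) (b := 1)
      (fun u : ℝ => Kf w R g ((u:ℂ), (τ, x))) t
    simp only [zero_mul, one_mul] at h2
    beta_reduce
    rw [← h2, ← intervalIntegral.integral_smul]
    refine intervalIntegral.integral_congr fun u _ => ?_
    simp only [Kf, smul_smul, Complex.ofReal_mul, Pi.smul_apply]
    rw [← mul_smul_comm, smul_comm t tpi]
    rw [Finset.smul_sum (r := t)]
    refine congrArg _ (congrArg _ (Finset.sum_congr rfl fun j _ => ?_))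
    rw [smul_eq_mul, mul_smul]
    rfl
  have := (ex_line w τ σ).mul hgd
  refine this.congr_deriv ?_
  simp only [Kf, Yf, smul_add, Finset.sum_add_distrib]
  congr 1
  · rw [smul_mul_assoc, mul_assoc, Finset.sum_mul]
    simp only [smul_mul_assoc]
  · rw [mul_smul_comm, ← mul_assoc, mul_comm (ex w _) (ex w _), ex_neg_mul, one_mul, smul_comm,
      Finset.smul_sum]
    congr 1
    exact Finset.sum_congr rfl fun j _ => smul_comm _ _ _

end

end Rig

end

section
open scoped BigOperators
open MeasureTheory Set Filter Topology Metric Asymptotics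

namespace Rig

noncomputable section
variable {m p n : ℕ}

theorem Yf_an (w : Fin p → Fin m → ℤ) {R : Fin p → Ev m × Pm n → Ev m} {Ω : Set (Ev m × Pm n)}
    (hΩ : IsOpen Ω) (hR : ∀ j, AnalyticOnNhd ℂ (R j) Ω) (j : Fin p) :
    AnalyticOnNhd ℂ (Yf w R j) Ω := by
  refine analytic_of_diff hΩ fun x hx => DifferentiableAt.differentiableWithinAt ?_
  have h1 := (hR j x hx).differentiableAt
  have h2 : DifferentiableAt ℂ (fun x : Ev m × Pm n => wt w j * x.1) x := by fun_prop
  have h3 : DifferentiableAt ℂ (fun x : Ev m × Pm n => x.2.1) x := by fun_prop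
  exact h2.add (h3.smul h1)

set_option maxHeartbeats 1000000 in
theorem variation (Y : Fin p → Ev m × Pm n → Ev m) {e0 κ e : ℝ}
    (hY : ∀ j, AnalyticOnNhd ℂ (Y j) (Dom m n 4 e0)) (he : e ≤ e0 / 2)
    (hcomm : ∀ x ∈ Dom m n 4 e0, ∀ i j, fderiv ℂ (Y j) x (Y i x, 0) = fderiv ℂ (Y i) x (Y j x, 0))
    {Ψ : Tot p m n → Ev m} (hΨ : AnalyticOnNhd ℂ Ψ (Om p m n κ e))
    (hb : ∀ π ∈ Om p m n κ e, ‖Ψ π‖ ≤ 15/4)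
    (h0 : ∀ x ∈ Dom m n 2 e, Ψ (0, x) = x.1)
    (hE : ∀ τ x, (τ, x) ∈ Om p m n κ e → ∀ σ ∈ Icc (0:ℝ) 1,
      HasDerivAt (fun t : ℝ => Ψ ((t:ℂ) • τ, x)) (tpi • ∑ j, τ j • Y j (Ψ ((σ:ℂ) • τ, x), x.2)) σ)
    {τ : Fin p → ℂ} {x : Ev m × Pm n} (h : (τ, x) ∈ Om p m n κ e) (i : Fin p) (c d : ℂ) :
    fderiv ℂ Ψ (τ, x) (Pi.single i c, (d • Y i x, 0)) = (tpi * c + d) • Y i (Ψ (τ, x), x.2) := by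
  have hmem : ∀ σ ∈ Icc (0:ℝ) 1, ((σ:ℂ) • τ, x) ∈ Om p m n κ e := fun σ hσ => Om_tube h σ hσ
  have hmem' : ∀ τ' x', (τ', x') ∈ Om p m n κ e → ∀ σ ∈ Icc (0:ℝ) 1,
    ((σ:ℂ) • τ', x') ∈ Om p m n κ e := fun τ' x' h' σ hσ => Om_tube h' σ hσ
  have hΨd : ∀ π ∈ Om p m n κ e, (Ψ π, π.2.2) ∈ Dom m n 4 e0 := by
    intro π hπ
    have h2 := Om_e hπ
    rw [mem_ball_zero_iff] at h2
    have h3 := hb π hπ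
    refine ⟨?_, ?_⟩
    · rw [mem_ball_zero_iff]; linarith
    · rw [mem_ball_zero_iff]; linarith [norm_nonneg π.2.2]
  -- complex form of the Euler relation
  have hEc : ∀ σ ∈ Icc (0:ℝ) 1, ∀ τ' x', (τ', x') ∈ Om p m n κ e →
      fderiv ℂ Ψ ((σ:ℂ) • τ', x') (τ', 0) = tpi • ∑ j, τ' j • Y j (Ψ ((σ:ℂ) • τ', x'), x'.2) := by
    intro σ hσ τ' x' h'
    have h1 : HasDerivAt (fun t : ℂ => Ψ (t • τ', x')) (fderiv ℂ Ψ ((σ:ℂ) • τ', x') (τ', 0)) (σ:ℂ) := by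
      have h2 : HasDerivAt (fun t : ℂ => (t • τ', x')) (τ', 0) (σ:ℂ) := by
        have := (hasDerivAt_id (σ:ℂ)).smul_const τ'
        simp only [id, one_smul] at this
        exact this.prodMk (hasDerivAt_const _ _)
      exact ((hΨ _ (hmem' τ' x' h' σ hσ)).differentiableAt.hasFDerivAt).comp_hasDerivAt (σ:ℂ) h2
    exact (hasDerivAt_ofReal h1).unique (hE τ' x' h' σ hσ)
  set a : Fin p → ℂ := Pi.single i c with ha
  set b : Ev m × Pm n := (d • Y i x, 0) with hbdef
  have hline : ∀ σ : ℝ, HasDerivAt (fun t : ℂ => (t • τ, x)) ((τ, 0) : Tot p m n) (σ:ℂ) := by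
    intro σ
    have := (hasDerivAt_id (σ:ℂ)).smul_const τ
    simp only [id, one_smul] at this
    exact this.prodMk (hasDerivAt_const _ _)
  -- derivative of P
  set P : ℝ → Ev m := fun σ => fderiv ℂ Ψ ((σ:ℂ) • τ, x) ((σ:ℂ) • a, b) with hP
  have hPd : ∀ σ ∈ Icc (0:ℝ) 1, HasDerivAt P ((tpi * c) • Y i (Ψ ((σ:ℂ) • τ, x), x.2) +
      tpi • ∑ j, τ j • fderiv ℂ (Y j) (Ψ ((σ:ℂ) • τ, x), x.2) (P σ, 0)) σ := by
    intro σ hσ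
    have hm := hmem σ hσ
    have hDD : HasFDerivAt (fderiv ℂ Ψ) (fderiv ℂ (fderiv ℂ Ψ) ((σ:ℂ) • τ, x)) ((σ:ℂ) • τ, x) :=
      (hΨ.fderiv _ hm).differentiableAt.hasFDerivAt
    have h1 : HasDerivAt (fun t : ℂ => fderiv ℂ Ψ (t • τ, x) (t • a, b))
        (fderiv ℂ (fderiv ℂ Ψ) ((σ:ℂ) • τ, x) (τ, 0) ((σ:ℂ) • a, b) +
          fderiv ℂ Ψ ((σ:ℂ) • τ, x) (a, 0)) (σ:ℂ) := by
      have h2 := hDD.comp_hasDerivAt (σ:ℂ) (hline σ)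
      have h3 : HasDerivAt (fun t : ℂ => (t • a, b)) ((a, 0) : Tot p m n) (σ:ℂ) := by
        have := (hasDerivAt_id (σ:ℂ)).smul_const a
        simp only [id, one_smul] at this
        exact this.prodMk (hasDerivAt_const _ _)
      exact h2.clm_apply h3
    have hsym : fderiv ℂ (fderiv ℂ Ψ) ((σ:ℂ) • τ, x) (τ, 0) ((σ:ℂ) • a, b) =
        fderiv ℂ (fderiv ℂ Ψ) ((σ:ℂ) • τ, x) ((σ:ℂ) • a, b) (τ, 0) :=
      (((hΨ _ hm).contDiffAt (n := ⊤)).isSymmSndFDerivAt_of_omega) _ _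
    -- differentiate the Euler relation in direction (a,b)
    have hl : HasFDerivAt (fun π : Tot p m n => ((σ:ℂ) • π.1, π.2))
        (((σ:ℂ) • ContinuousLinearMap.fst ℂ (Fin p → ℂ) (Ev m × Pm n)).prod
          (ContinuousLinearMap.snd ℂ (Fin p → ℂ) (Ev m × Pm n))) (τ, x) :=
      (hasFDerivAt_fst.const_smul (σ:ℂ)).prodMk hasFDerivAt_snd
    have hq : HasFDerivAt (fun π : Tot p m n => fderiv ℂ Ψ ((σ:ℂ) • π.1, π.2))
      ((fderiv ℂ (fderiv ℂ Ψ) ((σ:ℂ) • τ, x)).comp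
        (((σ:ℂ) • ContinuousLinearMap.fst ℂ (Fin p → ℂ) (Ev m × Pm n)).prod
          (ContinuousLinearMap.snd ℂ (Fin p → ℂ) (Ev m × Pm n)))) (τ, x) := hDD.comp (τ, x) hl
    have hr : HasFDerivAt (fun π : Tot p m n => ((π.1, 0) : Tot p m n))
      ((ContinuousLinearMap.fst ℂ (Fin p → ℂ) (Ev m × Pm n)).prod 0) (τ, x) :=
      hasFDerivAt_fst.prodMk (hasFDerivAt_const _ _)
    have hL := hq.clm_apply hr
    have hΨl : HasFDerivAt (fun π : Tot p m n => Ψ ((σ:ℂ) • π.1, π.2))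
      ((fderiv ℂ Ψ ((σ:ℂ) • τ, x)).comp
        (((σ:ℂ) • ContinuousLinearMap.fst ℂ (Fin p → ℂ) (Ev m × Pm n)).prod
          (ContinuousLinearMap.snd ℂ (Fin p → ℂ) (Ev m × Pm n)))) (τ, x) :=
      HasFDerivAt.comp (g := Ψ) (τ, x) (hΨ _ hm).differentiableAt.hasFDerivAt hl
    have hee : HasFDerivAt (fun π : Tot p m n => π.2.2)
        ((ContinuousLinearMap.snd ℂ (Ev m) (Pm n)).comp
          (ContinuousLinearMap.snd ℂ (Fin p → ℂ) (Ev m × Pm n))) (τ, x) :=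
      ContinuousLinearMap.hasFDerivAt ((ContinuousLinearMap.snd ℂ (Ev m) (Pm n)).comp
          (ContinuousLinearMap.snd ℂ (Fin p → ℂ) (Ev m × Pm n)))
    have hYl : ∀ j, HasFDerivAt (fun π : Tot p m n => Y j (Ψ ((σ:ℂ) • π.1, π.2), π.2.2)) _ (τ, x) :=
      fun j => HasFDerivAt.comp (g := Y j) (τ, x)
        (hY j _ (hΨd _ hm)).differentiableAt.hasFDerivAt (hΨl.prodMk hee)
    have hpj : ∀ j, HasFDerivAt (fun π : Tot p m n => π.1 j)
        ((ContinuousLinearMap.proj (R := ℂ) (φ := fun _ : Fin p => ℂ) j).comp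
          (ContinuousLinearMap.fst ℂ (Fin p → ℂ) (Ev m × Pm n))) (τ, x) := fun j =>
      ContinuousLinearMap.hasFDerivAt ((ContinuousLinearMap.proj (R := ℂ) (φ := fun _ : Fin p => ℂ) j).comp
          (ContinuousLinearMap.fst ℂ (Fin p → ℂ) (Ev m × Pm n)))
    have hRr := (HasFDerivAt.fun_sum (u := Finset.univ) fun j _ => (hpj j).smul (hYl j)).const_smul tpi
    have heq := hL.unique (hRr.congr_of_eventuallyEq (by
      filter_upwards [(isOpen_Om κ e).mem_nhds h] with π hπ
      exact hEc σ hσ π.1 π.2 hπ))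
    have h4 := congrArg (fun T : Tot p m n →L[ℂ] Ev m => T (a, b)) heq
    simp only [ContinuousLinearMap.add_apply, ContinuousLinearMap.comp_apply, 
      ContinuousLinearMap.prod_apply, ContinuousLinearMap.flip_apply, ContinuousLinearMap.smul_apply,
      ContinuousLinearMap.coe_fst', ContinuousLinearMap.coe_snd', ContinuousLinearMap.zero_apply,
      ContinuousLinearMap.sum_apply, ContinuousLinearMap.smulRight_apply,
      ContinuousLinearMap.proj_apply] at h4
    have h5 := hasDerivAt_ofReal h1
    refine h5.congr_deriv ?_
    rw [hsym, add_comm, h4]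
    rw [Finset.sum_add_distrib, smul_add, add_comm]
    congr 1
    rw [mul_smul tpi c]
    congr 1
    rw [Finset.sum_eq_single i]
    · simp [ha]
    · intro j _ hj; simp [ha, hj]
    · simp
  set y : ℝ → Ev m × Pm n := fun σ => (Ψ ((σ:ℂ) • τ, x), x.2) with hy
  have hyD : ∀ σ ∈ Icc (0:ℝ) 1, y σ ∈ Dom m n 4 e0 := fun σ hσ => hΨd _ (hmem σ hσ)
  have hyd : ∀ σ ∈ Icc (0:ℝ) 1, HasDerivAt y (tpi • ∑ j, τ j • Y j (y σ), 0) σ := fun σ hσ =>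
    (hE τ x h σ hσ).prodMk (hasDerivAt_const _ _)
  have hYd : ∀ σ ∈ Icc (0:ℝ) 1, HasDerivAt (fun t => Y i (y t))
      (tpi • ∑ j, τ j • fderiv ℂ (Y j) (y σ) (Y i (y σ), 0)) σ := by
    intro σ hσ
    have h1 := ((hY i _ (hyD σ hσ)).differentiableAt.hasFDerivAt.restrictScalars ℝ).comp_hasDerivAt σ (hyd σ hσ)
    refine h1.congr_deriv ?_
    have e1 : ((tpi • ∑ j, τ j • Y j (y σ), 0) : Ev m × Pm n) =
        tpi • ∑ j, τ j • ((Y j (y σ), 0) : Ev m × Pm n) := by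
      ext1
      · simp [Prod.fst_sum]
      · simp [Prod.snd_sum]
    rw [ContinuousLinearMap.coe_restrictScalars', e1, map_smul, map_sum]
    refine congrArg _ (Finset.sum_congr rfl fun j _ => ?_)
    rw [map_smul, hcomm _ (hyD σ hσ) j i]
  set z : ℝ → Ev m := fun σ => P σ - (tpi * c * (σ:ℂ) + d) • Y i (y σ) with hz
  have hzd : ∀ σ ∈ Icc (0:ℝ) 1, HasDerivAt z
      (tpi • ∑ j, τ j • fderiv ℂ (Y j) (y σ) (z σ, 0)) σ := by
    intro σ hσ
    have h1 : HasDerivAt (fun t : ℝ => tpi * c * (t:ℂ) + d) (tpi * c) σ := by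
      have h2 : HasDerivAt (fun t : ℝ => (t:ℂ)) 1 σ := Complex.ofRealCLM.hasDerivAt
      simpa using (h2.const_mul (tpi * c)).add_const d
    have h3 := (hPd σ hσ).sub (h1.smul (hYd σ hσ))
    refine h3.congr_deriv ?_
    have e1 : ∀ j, fderiv ℂ (Y j) (y σ) (z σ, 0) = fderiv ℂ (Y j) (y σ) (P σ, 0) -
        (tpi * c * (σ:ℂ) + d) • fderiv ℂ (Y j) (y σ) (Y i (y σ), 0) := by
      intro j
      rw [← map_smul, ← map_sub]
      congr 1
      simp [hz]
    simp only [e1, smul_sub, Finset.sum_sub_distrib]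
    have e2 : ∀ j, τ j • (tpi * c * (σ:ℂ) + d) • fderiv ℂ (Y j) (y σ) (Y i (y σ), 0) =
        (tpi * c * (σ:ℂ) + d) • τ j • fderiv ℂ (Y j) (y σ) (Y i (y σ), 0) := fun j => smul_comm _ _ _
    simp only [e2, ← Finset.smul_sum]
    rw [smul_comm tpi (tpi * c * (σ:ℂ) + d)]
    simp only [hy]
    abel
  have hyc : ContinuousOn y (Icc 0 1) := fun σ hσ => (hyd σ hσ).continuousAt.continuousWithinAt
  have hLc : ContinuousOn (fun σ => tpi • ∑ j, τ j •
      (fderiv ℂ (Y j) (y σ)).comp (ContinuousLinearMap.inl ℂ (Ev m) (Pm n))) (Icc 0 1) := by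
    have : ∀ j, ContinuousOn (fun σ => fderiv ℂ (Y j) (y σ)) (Icc 0 1) := fun j =>
      (hY j).fderiv.continuousOn.comp hyc hyD
    have h2 : ContinuousOn (fun σ => ∑ j, τ j •
      (fderiv ℂ (Y j) (y σ)).comp (ContinuousLinearMap.inl ℂ (Ev m) (Pm n))) (Icc 0 1) := by
     refine continuousOn_finsetSum _ fun j _ => ?_
     exact ((this j).clm_comp continuousOn_const).const_smul (τ j)
    exact h2.const_smul tpi
  obtain ⟨K, hK⟩ := isCompact_Icc.exists_bound_of_continuousOn hLc
  have hz0 : z 0 = 0 := by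
    have hx : x ∈ Dom m n 2 e := Om_x h
    have h1 : HasFDerivAt (fun x' : Ev m × Pm n => Ψ (0, x'))
        ((fderiv ℂ Ψ (0, x)).comp (ContinuousLinearMap.inr ℂ (Fin p → ℂ) (Ev m × Pm n))) x := by
      have hm := hmem 0 (by simp)
      simp only [Complex.ofReal_zero, zero_smul] at hm
      exact HasFDerivAt.comp (g := Ψ) x (hΨ _ hm).differentiableAt.hasFDerivAt
        (hasFDerivAt_prodMk_right (0 : Fin p → ℂ) x)
    have h2 : HasFDerivAt (fun x' : Ev m × Pm n => Ψ (0, x')) (ContinuousLinearMap.fst ℂ (Ev m) (Pm n)) x :=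
      hasFDerivAt_fst.congr_of_eventuallyEq (by
        filter_upwards [(isOpen_Dom 2 e).mem_nhds hx] with x' hx'
        exact h0 x' hx')
    have h3 := congrArg (fun T : Ev m × Pm n →L[ℂ] Ev m => T b) (h1.unique h2)
    simp only [ContinuousLinearMap.comp_apply, ContinuousLinearMap.inr_apply,
      ContinuousLinearMap.coe_fst'] at h3
    simp only [hz, hP, hy, Complex.ofReal_zero, zero_smul, mul_zero, zero_add, h3, h0 x hx]
    simp [hbdef]
  have hfin := norm_le_gronwallBound_of_norm_deriv_right_le (f := z) (δ := 0) (K := K) (ε := 0) (a := 0) (b := 1)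
    (f' := fun σ => tpi • ∑ j, τ j • fderiv ℂ (Y j) (y σ) (z σ, 0))
    (fun σ hσ => (hzd σ hσ).continuousAt.continuousWithinAt)
    (fun σ hσ => (hzd σ (Ico_subset_Icc_self hσ)).hasDerivWithinAt) (by simp [hz0]) (by
      intro σ hσ
      have h1 := (tpi • ∑ j, τ j •
        (fderiv ℂ (Y j) (y σ)).comp (ContinuousLinearMap.inl ℂ (Ev m) (Pm n))).le_of_opNorm_le
          (hK σ (Ico_subset_Icc_self hσ)) (z σ)
      simpa [ContinuousLinearMap.sum_apply] using h1) 1 (by simp)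
  have hz1 : z 1 = 0 := by
    rw [← norm_le_zero_iff]
    simpa [gronwallBound_ε0_δ0] using hfin
  have := sub_eq_zero.1 hz1
  simpa [hP, hy] using this

structure IsFlow (w : Fin p → Fin m → ℤ) (R : Fin p → Ev m × Pm n → Ev m) (κ e C : ℝ)
    (Ψ : Tot p m n → Ev m) : Prop where
  kpos : 0 < κ
  epos : 0 < e
  Cpos : 0 < C
  exb : ∀ τ ∈ Tset p κ, ‖ex w τ‖ ≤ 3/2
  an : AnalyticOnNhd ℂ Ψ (Om p m n κ e)
  bd : ∀ π ∈ Om p m n κ e, ‖Ψ π‖ ≤ 15/4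
  cl : ∀ τ x, (τ, x) ∈ Om p m n κ e → ‖ex w (-τ) * Ψ (τ, x) - x.1‖ ≤ ‖x.2.1‖ * C
  zero : ∀ x ∈ Dom m n 2 e, Ψ (0, x) = x.1
  dt : ∀ τ x, (τ, x) ∈ Om p m n κ e → ∀ d, fderiv ℂ Ψ (τ, x) (d, 0) =
    tpi • ∑ j, d j • Yf w R j (Ψ (τ, x), x.2)
  dx : ∀ τ x, (τ, x) ∈ Om p m n κ e → ∀ i, fderiv ℂ Ψ (τ, x) (0, (Yf w R i x, 0)) =
    Yf w R i (Ψ (τ, x), x.2)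

theorem flow_exists (w : Fin p → Fin m → ℤ) {R : Fin p → Ev m × Pm n → Ev m} {e0 : ℝ} (he0 : 0 < e0)
    (hR : ∀ j, AnalyticOnNhd ℂ (R j) (Dom m n 4 e0))
    (hcomm : ∀ x ∈ Dom m n 4 e0, ∀ i j, fderiv ℂ (Yf w R j) x (Yf w R i x, 0) =
      fderiv ℂ (Yf w R i) x (Yf w R j x, 0)) :
    ∃ κ e C, e ≤ e0 / 2 ∧ ∃ Ψ, IsFlow w R κ e C Ψ := by
  obtain ⟨κ, hκ0, hκ, e, he, hee, C, hC, g, hg, hgb, hgc, hfix⟩ := flow_aux w he0 hR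
  refine ⟨κ, e, C, hee, fun π => ex w π.1 * g π, ?_⟩
  have han : AnalyticOnNhd ℂ (fun π : Tot p m n => ex w π.1 * g π) (Om p m n κ e) := by
    refine analytic_of_diff (isOpen_Om κ e) fun π hπ => DifferentiableAt.differentiableWithinAt ?_
    have h1 : DifferentiableAt ℂ (fun π : Tot p m n => ex w π.1) π :=
      (ex_diff w _).comp π (by fun_prop : DifferentiableAt ℂ (fun π : Tot p m n => π.1) π)
    exact h1.mul (hg π hπ).differentiableAt
  have hzero : ∀ x ∈ Dom m n 2 e, ex w 0 * g (0, x) = x.1 := by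
    intro x hx
    have hm : ((0 : Fin p → ℂ), x) ∈ Om p m n κ e := ⟨⟨by simp, fun j => by simpa using hκ0⟩, hx⟩
    have : ∀ u : ℝ, Kf w R g ((u:ℂ), ((0 : Fin p → ℂ), x)) = 0 := by
      intro u; simp [Kf]
    rw [hfix _ hm, ex_zero]
    simp [this]
  have hv : ∀ τ x, (τ, x) ∈ Om p m n κ e → ∀ (i : Fin p) (c d : ℂ), 
    fderiv ℂ (fun π : Tot p m n => ex w π.1 * g π) (τ, x) (Pi.single i c, (d • Yf w R i x, 0)) =
      (tpi * c + d) • Yf w R i (ex w τ * g (τ, x), x.2) := by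
    intro τ x h i c d
    exact variation (Yf w R) (Yf_an w (isOpen_Dom 4 e0) hR) hee hcomm han
      (fun π hπ => arg_mem w hκ hgb hπ) hzero
      (fun τ x h σ hσ => euler w he0 hR hκ hee hg hgb hfix h hσ) h i c d
  refine ⟨hκ0, he, hC, hκ, han, fun π hπ => arg_mem w hκ hgb hπ, ?_, hzero, ?_, ?_⟩
  · intro τ x h
    beta_reduce
    rw [← mul_assoc, ex_neg_mul, one_mul]
    exact hgc _ h
  · intro τ x h d
    have e1 : ((d, 0) : Tot p m n) = ∑ j, d j • ((Pi.single j 1, 0) : Tot p m n) := by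
      ext1
      · simp only [Prod.fst_sum, Prod.smul_mk]
        ext j
        simp [Finset.sum_apply, Pi.single_apply]
      · simp [Prod.snd_sum]
    rw [e1, map_sum, Finset.smul_sum]
    refine Finset.sum_congr rfl fun j _ => ?_
    have := hv τ x h j 1 0
    simp only [zero_smul, mul_one, add_zero] at this
    rw [map_smul, smul_comm]
    congr 1
  · intro τ x h i
    have := hv τ x h i 0 1
    simpa using this

end

end Rig

end

section
open scoped BigOperators
open MeasureTheory Set Filter Topology Metric Asymptotics

namespace Rig

noncomputable section
variable {m p n : ℕ}

/-- Solving `a = c + H (a, x)` with a small analytic `H`. -/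
theorem solve_fix {E F : Type*} [NormedAddCommGroup E] [NormedSpace ℂ E] [FiniteDimensional ℂ E]
    [NormedAddCommGroup F] [NormedSpace ℂ F] [FiniteDimensional ℂ F]
    {Ω : Set E} (hΩ : IsOpen Ω) (c : F) {ρ : ℝ} (hρ : 0 < ρ) (H : F × E → F)
    (hH : AnalyticOnNhd ℂ H (ball c (2 * ρ) ×ˢ Ω)) (hb : ∀ π ∈ ball c (2 * ρ) ×ˢ Ω, ‖H π‖ ≤ ρ / 4) :
    ∃ a : E → F, AnalyticOnNhd ℂ a Ω ∧ (∀ x ∈ Ω, ‖a x - c‖ ≤ ρ / 4) ∧ (∀ x ∈ Ω, a x = c + H (a x, x)) ∧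
      ∀ x ∈ Ω, ∀ t, ‖t - c‖ ≤ ρ / 4 → t = c + H (t, x) → t = a x := by
  have : CompleteSpace F := FiniteDimensional.complete ℂ F
  have hL : ∀ x ∈ Ω, ∀ t t', ‖t - c‖ ≤ ρ / 4 → ‖t' - c‖ ≤ ρ / 4 → ‖H (t, x) - H (t', x)‖ ≤ ‖t - t'‖ / 2 := by
    intro x hx t t' ht ht'
    have hsub : ball t' ρ ⊆ ball c (2 * ρ) := by
      intro y hy
      rw [mem_ball, dist_eq_norm] at hy ⊢
      have := norm_sub_le_norm_sub_add_norm_sub y t' c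
      linarith
    have h1 := Complex.dist_le_div_mul_dist_of_mapsTo_ball (f := fun t => H (t, x)) (c := t') (z := t)
      (R₁ := ρ) (R₂ := ρ / 2) (fun y hy => by
        have h2 : DifferentiableAt ℂ H (y, x) := (hH (y, x) ⟨hsub hy, hx⟩).differentiableAt
        exact (h2.comp y (by fun_prop : DifferentiableAt ℂ (fun y => (y, x)) y)).differentiableWithinAt)
      (fun y hy => by
        rw [mem_closedBall, dist_eq_norm]
        have h2 := hb (y, x) ⟨hsub hy, hx⟩
        have h3 := hb (t', x) ⟨hsub (mem_ball_self hρ), hx⟩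
        have h4 := norm_sub_le (H (y, x)) (H (t', x))
        linarith)
      (by
        rw [mem_ball, dist_eq_norm]
        have := norm_sub_le_norm_sub_add_norm_sub t c t'
        rw [norm_sub_rev c t'] at this
        linarith)
    rw [dist_eq_norm, dist_eq_norm] at h1
    refine h1.trans (le_of_eq ?_)
    field_simp
  have hmem : ∀ x ∈ Ω, ∀ t, ‖t - c‖ ≤ ρ / 4 → (t, x) ∈ ball c (2 * ρ) ×ˢ Ω := by
    intro x hx t ht
    refine ⟨?_, hx⟩
    rw [mem_ball, dist_eq_norm]; linarith
  obtain ⟨a, ha, hab, hfix⟩ := contraction_fix hΩ (fun _ => c) (ρ / 4) (fun a x => c + H (a x, x)) (by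
      intro g hg hgb
      refine ⟨?_, ?_⟩
      · refine analytic_of_diff hΩ fun x hx => DifferentiableAt.differentiableWithinAt ?_
        have h2 : DifferentiableAt ℂ H (g x, x) := (hH _ (hmem x hx _ (hgb x hx))).differentiableAt
        exact (DifferentiableAt.comp (g := H) (f := fun x => (g x, x)) x h2
          ((hg x hx).differentiableAt.prodMk differentiableAt_id)).const_add c
      · intro x hx
        simpa using hb _ (hmem x hx _ (hgb x hx))) (by
      intro g g' hg hgb hg' hgb' C hC x hx
      simp only [add_sub_add_left_eq_sub]
      refine (hL x hx _ _ (hgb x hx) (hgb' x hx)).trans ?_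
      linarith [hC x hx]) (by positivity) analyticOnNhd_const
  refine ⟨a, ha, hab, hfix, ?_⟩
  intro x hx t ht hteq
  have h1 := hL x hx t (a x) ht (hab x hx)
  have h2 : t - a x = H (t, x) - H (a x, x) := by
    conv_lhs => rw [hteq, hfix x hx]
    abel
  rw [← h2] at h1
  have h3 : ‖t - a x‖ = 0 := le_antisymm (by linarith [norm_nonneg (t - a x)]) (norm_nonneg _)
  exact sub_eq_zero.1 (norm_eq_zero.1 h3)

/-- Region: coordinates in `S` in the disc, the others in the annulus. -/
def Reg (m n : ℕ) (S : Set (Fin m)) (e : ℝ) : Set (Ev m × Pm n) :=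
  {v : Ev m | ∀ l, ‖v l‖ < 3/2 ∧ (l ∉ S → 1/2 < ‖v l‖)} ×ˢ ball 0 e

theorem Reg_lt {S : Set (Fin m)} {e : ℝ} {x : Ev m × Pm n} (h : x ∈ Reg m n S e) (l : Fin m) :
    ‖x.1 l‖ < 3/2 := (h.1 l).1
theorem Reg_gt {S : Set (Fin m)} {e : ℝ} {x : Ev m × Pm n} (h : x ∈ Reg m n S e) {l : Fin m} (hl : l ∉ S) :
    1/2 < ‖x.1 l‖ := (h.1 l).2 hl
theorem Reg_e {S : Set (Fin m)} {e : ℝ} {x : Ev m × Pm n} (h : x ∈ Reg m n S e) :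
    x.2 ∈ ball (0 : Pm n) e := h.2
theorem Reg_mk {S : Set (Fin m)} {e : ℝ} {x : Ev m × Pm n} (h1 : ∀ l, ‖x.1 l‖ < 3/2)
    (h2 : ∀ l, l ∉ S → 1/2 < ‖x.1 l‖) (h3 : x.2 ∈ ball (0 : Pm n) e) : x ∈ Reg m n S e :=
  ⟨fun l => ⟨h1 l, h2 l⟩, h3⟩

theorem Reg_mono {S T : Set (Fin m)} {e e' : ℝ} (hST : S ⊆ T) (he : e ≤ e') :
    Reg m n S e ⊆ Reg m n T e' := fun _ h =>
  Reg_mk (Reg_lt h) (fun _ hl => Reg_gt h fun hS => hl (hST hS)) (ball_subset_ball he (Reg_e h))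

theorem Reg_Dom {S : Set (Fin m)} {e e' : ℝ} (he : e ≤ e') : Reg m n S e ⊆ Dom m n 2 e' := by
  intro x h
  refine ⟨?_, ball_subset_ball he (Reg_e h)⟩
  rw [mem_ball_zero_iff, pi_norm_lt_iff (by norm_num)]
  intro l
  linarith [Reg_lt h l]

theorem isOpen_Reg (S : Set (Fin m)) (e : ℝ) : IsOpen (Reg m n S e) := by
  refine IsOpen.prod ?_ isOpen_ball
  simp only [Set.ofPred_forall]
  refine isOpen_iInter_of_finite fun l => ?_
  refine IsOpen.and (isOpen_lt (by fun_prop) continuous_const) ?_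
  by_cases h : l ∈ S
  · simp [h]
  · simpa [h] using isOpen_lt continuous_const (by fun_prop : Continuous fun v : Ev m => ‖v l‖)

theorem preconn_ann : IsPreconnected {z : ℂ | ‖z‖ < 3/2 ∧ 1/2 < ‖z‖} := by
  have h : {z : ℂ | ‖z‖ < 3/2 ∧ 1/2 < ‖z‖} =
      Complex.exp '' {z : ℂ | Real.log (1/2) < z.re ∧ z.re < Real.log (3/2)} := by
    ext z
    constructor
    · rintro ⟨h1, h2⟩
      have hz : z ≠ 0 := by rintro rfl; simp at h2; linarith
      refine ⟨Complex.log z, ⟨?_, ?_⟩, Complex.exp_log hz⟩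
      · rw [Complex.log_re]; exact Real.log_lt_log (by norm_num) h2
      · rw [Complex.log_re]; exact Real.log_lt_log (norm_pos_iff.2 hz) h1
    · rintro ⟨y, ⟨h1, h2⟩, rfl⟩
      simp only [mem_setOf_eq, Complex.norm_exp]
      exact ⟨(Real.lt_log_iff_exp_lt (by norm_num)).1 h2, (Real.log_lt_iff_lt_exp (by norm_num)).1 h1⟩
  rw [h]
  refine IsPreconnected.image ?_ _ Complex.continuous_exp.continuousOn
  refine Convex.isPreconnected ?_
  exact (convex_halfSpace_re_gt _).inter (convex_halfSpace_re_lt _)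

theorem preconn_Reg (S : Set (Fin m)) (e : ℝ) : IsPreconnected (Reg m n S e) := by
  refine IsPreconnected.prod ?_ (convex_ball _ _).isPreconnected
  have : {v : Ev m | ∀ l, ‖v l‖ < 3/2 ∧ (l ∉ S → 1/2 < ‖v l‖)} =
      Set.pi univ fun l => {z : ℂ | ‖z‖ < 3/2 ∧ (l ∉ S → 1/2 < ‖z‖)} := by
    ext v; simp
  rw [this]
  refine isPreconnected_univ_pi fun l => ?_
  by_cases h : l ∈ S
  · have : {z : ℂ | ‖z‖ < 3/2 ∧ (l ∉ S → 1/2 < ‖z‖)} = ball 0 (3/2) := by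
      ext z; simp [h]
    rw [this]
    exact (convex_ball _ _).isPreconnected
  · simpa [h] using preconn_ann

theorem strict_inj {E F : Type*} [NormedAddCommGroup E] [NormedSpace ℂ E] [FiniteDimensional ℂ E]
    [NormedAddCommGroup F] [NormedSpace ℂ F] {f : E → F} {f' : E →L[ℂ] F} {x : E}
    (h : HasStrictFDerivAt f f' x) (hi : ∀ d, f' d = 0 → d = 0) :
    ∃ U ∈ 𝓝 x, InjOn f U := by
  obtain ⟨K, hK, hA⟩ := LinearMap.exists_antilipschitzWith (f' : E →ₗ[ℂ] F) (LinearMap.ker_eq_bot'.2 hi)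
  have h1 := h.isLittleO.def (c := 1 / (2 * (K:ℝ))) (by positivity)
  rw [nhds_prod_eq] at h1
  obtain ⟨U, hU, hU'⟩ := (eventually_prod_self_iff
    (r := fun a b => ‖f a - f b - f' (a - b)‖ ≤ 1 / (2 * (K:ℝ)) * ‖a - b‖)).1 h1
  refine ⟨U, hU, ?_⟩
  intro y hy z hz hyz
  have h2 := hU' y hy z hz
  simp only [hyz, sub_self, zero_sub, norm_neg] at h2
  have h3 := hA.le_mul_dist y z
  rw [dist_eq_norm, dist_eq_norm] at h3
  have h4 : ‖(f' : E →ₗ[ℂ] F) y - (f' : E →ₗ[ℂ] F) z‖ = ‖f' (y - z)‖ := by simp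
  rw [h4] at h3
  have h5 : (K:ℝ) * ‖f' (y - z)‖ ≤ K * (1 / (2 * (K:ℝ)) * ‖y - z‖) := by gcongr
  have h6 : (K:ℝ) * (1 / (2 * (K:ℝ)) * ‖y - z‖) = ‖y - z‖ / 2 := by
    have : (K:ℝ) ≠ 0 := by positivity
    field_simp
  have h7 : ‖y - z‖ = 0 := le_antisymm (by linarith) (norm_nonneg _)
  exact sub_eq_zero.1 (norm_eq_zero.1 h7)

set_option maxHeartbeats 2000000 in
/-- Invariants are constant along the flow. -/
theorem inv_flow {w : Fin p → Fin m → ℤ} {R : Fin p → Ev m × Pm n → Ev m} {κ e C : ℝ}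
    {Ψ : Tot p m n → Ev m} (hF : IsFlow w R κ e C Ψ) {F : Type*} [NormedAddCommGroup F] [NormedSpace ℂ F]
    {h : Ev m × Pm n → F} {Ω : Set (Ev m × Pm n)} (hd : ∀ x ∈ Ω, DifferentiableAt ℂ h x)
    (hinv : ∀ x ∈ Ω, ∀ i, fderiv ℂ h x (Yf w R i x, 0) = 0) {τ : Fin p → ℂ} {x : Ev m × Pm n}
    (hm : (τ, x) ∈ Om p m n κ e) (hin : ∀ t ∈ Icc (0:ℝ) 1, (Ψ ((t:ℂ) • τ, x), x.2) ∈ Ω) :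
    h (Ψ (τ, x), x.2) = h x := by
  have hder : ∀ t ∈ Icc (0:ℝ) 1, HasDerivAt (fun t : ℝ => h (Ψ ((t:ℂ) • τ, x), x.2)) 0 t := by
    intro t ht
    have hmt := Om_tube hm t ht
    have h2 : HasDerivAt (fun t : ℂ => (t • τ, x)) ((τ, 0) : Tot p m n) (t:ℂ) := by
      have := (hasDerivAt_id (t:ℂ)).smul_const τ
      simp only [id, one_smul] at this
      exact this.prodMk (hasDerivAt_const _ _)
    have h3 : HasDerivAt (fun t : ℂ => Ψ (t • τ, x)) (fderiv ℂ Ψ ((t:ℂ) • τ, x) (τ, 0)) (t:ℂ) :=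
      ((hF.an _ hmt).differentiableAt.hasFDerivAt).comp_hasDerivAt (t:ℂ) h2
    rw [hF.dt _ _ hmt] at h3
    have h4 := ((hd _ (hin t ht)).hasFDerivAt).comp_hasDerivAt (t:ℂ) (h3.prodMk (hasDerivAt_const (t:ℂ) x.2))
    refine (hasDerivAt_ofReal h4).congr_deriv ?_
    have e1 : ((tpi • ∑ j, τ j • Yf w R j (Ψ ((t:ℂ) • τ, x), x.2), 0) : Ev m × Pm n) =
        tpi • ∑ j, τ j • ((Yf w R j (Ψ ((t:ℂ) • τ, x), x.2), 0) : Ev m × Pm n) := by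
      ext1
      · simp [Prod.fst_sum]
      · simp [Prod.snd_sum]
    rw [e1, map_smul, map_sum]
    simp only [map_smul, hinv _ (hin t ht), smul_zero, Finset.sum_const_zero]
  have h5 := constant_of_has_deriv_right_zero (f := fun t : ℝ => h (Ψ ((t:ℂ) • τ, x), x.2)) (a := 0) (b := 1)
    (fun t ht => (hder t ht).continuousAt.continuousWithinAt)
    (fun t ht => (hder t (Ico_subset_Icc_self ht)).hasDerivWithinAt) 1 (by simp)
  have h6 := hF.zero x (Om_x hm)
  simpa [h6] using h5

end

end Rig

end

section
open scoped BigOperators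
open MeasureTheory Set Filter Topology Metric Asymptotics

namespace Rig

noncomputable section
variable {m p n : ℕ}

abbrev sg (j : Fin p) : Fin p → ℂ := Pi.single j 1

def Hf (w : Fin p → Fin m → ℤ) (Ψ : Tot p m n → Ev m) (N : Fin m → Fin p → ℂ) (π : Tot p m n) : Fin p → ℂ :=
  -(tpi⁻¹ • ∑ l, Complex.log ((ex w (-π.1) * Ψ π) l / π.2.1 l) • N l)

theorem tpi_ne : tpi ≠ 0 := by simp [tpi, Real.pi_ne_zero]

theorem norm_tpi : ‖tpi‖ = 2 * Real.pi := by simp [tpi, abs_of_pos Real.pi_pos]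

theorem sg_ball {κ ρ : ℝ} (hρ1 : 2 * ρ ≤ 1) (hρκ : 2 * ρ ≤ κ) (j : Fin p) {τ : Fin p → ℂ}
    (h : τ ∈ ball (sg j) (2 * ρ)) : τ ∈ Tset p κ := by
  rw [mem_ball, dist_eq_norm] at h
  have h1 : ‖sg j‖ ≤ 1 := by
    rw [pi_norm_le_iff_of_nonneg zero_le_one]
    intro l
    by_cases hl : l = j
    · subst hl; simp
    · simp [hl]
  refine ⟨?_, fun l => ?_⟩
  · have := norm_sub_norm_le τ (sg j)
    linarith
  · have h2 : (τ l).im = ((τ - sg j) l).im := by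
      by_cases hl : l = j
      · subst hl; simp
      · simp [hl]
    rw [h2]
    calc _ ≤ ‖(τ - sg j) l‖ := Complex.abs_im_le_norm _
      _ ≤ ‖τ - sg j‖ := norm_le_pi_norm _ l
      _ < κ := by linarith

theorem period_solve {w : Fin p → Fin m → ℤ} {R : Fin p → Ev m × Pm n → Ev m} {κ e C : ℝ}
    {Ψ : Tot p m n → Ev m} (hF : IsFlow w R κ e C Ψ) (N : Fin m → Fin p → ℂ) (S : Set (Fin m))
    (hNS : ∀ l ∈ S, N l = 0) (j : Fin p) {ρ : ℝ} (hρ : 0 < ρ) (hρ1 : 2 * ρ ≤ 1) (hρκ : 2 * ρ ≤ κ) :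
    ∃ e' > 0, e' ≤ e ∧
      (∀ τ ∈ ball (sg j) (2 * ρ), ∀ x ∈ Reg m n S e', ∀ l ∉ S,
        ‖Complex.log ((ex w (-τ) * Ψ (τ, x)) l / x.1 l)‖ ≤ 1 ∧ (ex w (-τ) * Ψ (τ, x)) l ≠ 0) ∧
      ∃ a : Ev m × Pm n → Fin p → ℂ, AnalyticOnNhd ℂ a (Reg m n S e') ∧
        (∀ x ∈ Reg m n S e', ‖a x - sg j‖ ≤ ρ / 4) ∧
        (∀ x ∈ Reg m n S e', a x = sg j + Hf w Ψ N (a x, x)) ∧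
        ∀ x ∈ Reg m n S e', ∀ t, ‖t - sg j‖ ≤ ρ / 4 → t = sg j + Hf w Ψ N (t, x) → t = a x := by
  set K : ℝ := ∑ l, ‖N l‖ + 1 with hK
  have hKpos : 0 < K := by positivity
  set μ : ℝ := min 1 (ρ / 4 / K) with hμ
  have hμpos : 0 < μ := lt_min one_pos (by positivity)
  have hlog : ∀ᶠ z : ℂ in 𝓝 1, z ∈ Complex.slitPlane ∧ ‖Complex.log z‖ ≤ μ := by
    refine Filter.Eventually.and (Complex.isOpen_slitPlane.mem_nhds Complex.one_mem_slitPlane) ?_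
    have h1 : Tendsto (fun z : ℂ => ‖Complex.log z‖) (𝓝 1) (𝓝 0) := by
      have := (continuousAt_clog Complex.one_mem_slitPlane).norm
      simpa [ContinuousAt] using this
    exact (h1.eventually (gt_mem_nhds hμpos)).mono fun z hz => hz.le
  obtain ⟨δ, hδ, hδ'⟩ := Metric.eventually_nhds_iff.1 hlog
  have hC := hF.Cpos
  set e' : ℝ := min e (δ / (2 * C + 1)) with he'
  have he'pos : 0 < e' := lt_min hF.epos (by positivity)
  have he'e : e' ≤ e := min_le_left _ _
  have he'δ : 2 * C * e' < δ := by
    have : e' ≤ δ / (2 * C + 1) := min_le_right _ _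
    rw [le_div_iff₀ (by positivity)] at this
    nlinarith
  have hOm : ∀ τ ∈ ball (sg j) (2 * ρ), ∀ x ∈ Reg m n S e', (τ, x) ∈ Om p m n κ e := fun τ hτ x hx =>
    ⟨sg_ball hρ1 hρκ j hτ, Reg_Dom he'e hx⟩
  have hnear : ∀ τ ∈ ball (sg j) (2 * ρ), ∀ x ∈ Reg m n S e', ∀ l ∉ S,
      dist ((ex w (-τ) * Ψ (τ, x)) l / x.1 l) 1 < δ := by
    intro τ hτ x hx l hl
    have h1 := hF.cl τ x (hOm τ hτ x hx)
    have h2 := (norm_le_pi_norm _ l).trans h1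
    have h3 := Reg_gt hx hl
    have h4 : ‖x.2.1‖ ≤ e' := by
      have := Reg_e hx
      rw [mem_ball_zero_iff] at this
      exact (norm_fst_le x.2).trans this.le
    have h5 : x.1 l ≠ 0 := by
      intro h; rw [h, norm_zero] at h3; linarith
    rw [dist_eq_norm, div_sub_one h5, norm_div, div_lt_iff₀ (by linarith)]
    rw [Pi.sub_apply] at h2
    have h6 : ‖x.2.1‖ * C ≤ e' * C := by gcongr
    nlinarith
  refine ⟨e', he'pos, he'e, ?_, ?_⟩
  · intro τ hτ x hx l hl
    have h1 := hδ' (hnear τ hτ x hx l hl)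
    refine ⟨h1.2.trans (min_le_left _ _), ?_⟩
    intro h0
    have := h1.1
    rw [h0, zero_div] at this
    simp at this
  · refine solve_fix (isOpen_Reg S e') (sg j) hρ (Hf w Ψ N) ?_ ?_
    · refine analytic_of_diff (isOpen_ball.prod (isOpen_Reg S e')) ?_
      rintro ⟨τ, x⟩ ⟨hτ, hx⟩
      refine DifferentiableAt.differentiableWithinAt ?_
      have hΨ : DifferentiableAt ℂ Ψ (τ, x) := (hF.an _ (hOm τ hτ x hx)).differentiableAt
      have hex : DifferentiableAt ℂ (fun π : Tot p m n => ex w (-π.1)) (τ, x) :=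
        (ex_diff w _).comp (τ, x) (by fun_prop : DifferentiableAt ℂ (fun π : Tot p m n => -π.1) (τ, x))
      have hγ := hex.mul hΨ
      have hsum : DifferentiableAt ℂ (fun π : Tot p m n =>
          ∑ l, Complex.log ((ex w (-π.1) * Ψ π) l / π.2.1 l) • N l) (τ, x) := ?_
      · exact (hsum.const_smul tpi⁻¹).neg
      refine DifferentiableAt.fun_sum fun l _ => ?_
      by_cases hl : l ∈ S
      · simp [hNS l hl]
      · refine DifferentiableAt.smul_const ?_ _
        have h3 := Reg_gt hx hl
        have h5 : x.1 l ≠ 0 := by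
          intro h; rw [h, norm_zero] at h3; linarith
        refine DifferentiableAt.clog ?_ (hδ' (hnear τ hτ x hx l hl)).1
        have h6 : DifferentiableAt ℂ (fun π : Tot p m n => (ex w (-π.1) * Ψ π) l) (τ, x) :=
          differentiableAt_pi.1 hγ l
        have h7 : DifferentiableAt ℂ (fun π : Tot p m n => π.2.1 l) (τ, x) := by fun_prop
        simp only [div_eq_mul_inv]
        exact h6.mul (h7.inv h5)
    · rintro ⟨τ, x⟩ ⟨hτ, hx⟩
      rw [Hf, norm_neg, norm_smul]
      have h1 : ‖∑ l, Complex.log ((ex w (-τ) * Ψ (τ, x)) l / x.1 l) • N l‖ ≤ ∑ l, μ * ‖N l‖ := by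
        refine norm_sum_le_of_le _ fun l _ => ?_
        by_cases hl : l ∈ S
        · simp [hNS l hl]
        · rw [norm_smul]
          exact mul_le_mul_of_nonneg_right (hδ' (hnear τ hτ x hx l hl)).2 (norm_nonneg _)
      have h2 : ∑ l, μ * ‖N l‖ ≤ ρ / 4 := by
        rw [← Finset.mul_sum]
        have : μ ≤ ρ / 4 / K := min_le_right _ _
        rw [le_div_iff₀ hKpos] at this
        have h3 : μ * ∑ l, ‖N l‖ ≤ μ * K := by gcongr; rw [hK]; linarith
        linarith
      have h3 : ‖tpi⁻¹‖ ≤ 1 := by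
        rw [norm_inv, norm_tpi]
        exact inv_le_one_of_one_le₀ (by linarith [Real.pi_gt_three])
      calc _ ≤ 1 * (ρ / 4) := by
            refine mul_le_mul h3 (h1.trans h2) (norm_nonneg _) zero_le_one
        _ = _ := one_mul _

end

end Rig

end

section
open scoped BigOperators
open MeasureTheory Set Filter Topology Metric Asymptotics

namespace Rig

noncomputable section
variable {m p n q : ℕ}

theorem ker_span (hm : m = p + q) (g : Fin q → (Ev m →L[ℂ] ℂ)) (hg : LinearIndependent ℂ g)
    (u : Fin p → Ev m) (hu : LinearIndependent ℂ u) (h0 : ∀ i j, g j (u i) = 0) (d : Ev m)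
    (hd : ∀ j, g j d = 0) : d ∈ Submodule.span ℂ (range u) := by
  let g' : Fin q → Module.Dual ℂ (Ev m) := fun j => (g j : Ev m →ₗ[ℂ] ℂ)
  have hg' : LinearIndependent ℂ g' := by
    rw [Fintype.linearIndependent_iff] at hg ⊢
    intro c hc
    apply hg
    ext1 x
    have := congrArg (fun T : Module.Dual ℂ (Ev m) => T x) hc
    simpa [g'] using this
  set Wd := Submodule.span ℂ (range g')
  have h1 : Module.finrank ℂ Wd = q := by
    rw [finrank_span_eq_card hg', Fintype.card_fin]
  have h2 := Subspace.finrank_add_finrank_dualCoannihilator_eq Wd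
  rw [h1, Module.finrank_fin_fun] at h2
  have h3 : Submodule.span ℂ (range u) ≤ Wd.dualCoannihilator := by
    rw [Submodule.span_le]
    rintro _ ⟨i, rfl⟩
    simp only [SetLike.mem_coe, Submodule.mem_dualCoannihilator]
    intro φ hφ
    induction hφ using Submodule.span_induction with
    | mem x hx => obtain ⟨j, rfl⟩ := hx; exact h0 i j
    | zero => simp
    | add x y _ _ h1 h2 => simp [h1, h2]
    | smul a x _ h => simp [h]
  have h4 : Module.finrank ℂ (Submodule.span ℂ (range u)) = p := by
    rw [finrank_span_eq_card hu, Fintype.card_fin]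
  have h5 := Submodule.eq_of_le_of_finrank_le h3 (by omega)
  rw [h5, Submodule.mem_dualCoannihilator]
  intro φ hφ
  induction hφ using Submodule.span_induction with
  | mem x hx => obtain ⟨j, rfl⟩ := hx; exact hd j
  | zero => simp
  | add x y _ _ h1 h2 => simp [h1, h2]
  | smul a x _ h => simp [h]

theorem exists_lin {ι V V' : Type*} [AddCommGroup V] [Module ℂ V] [AddCommGroup V'] [Module ℂ V']
    (u : ι → V) (hu : LinearIndependent ℂ u) (t : ι → V') : ∃ T : V →ₗ[ℂ] V', ∀ i, T (u i) = t i := by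
  obtain ⟨g, hg⟩ := LinearMap.exists_extend ((Module.Basis.span hu).constr ℂ t)
  refine ⟨g, fun i => ?_⟩
  have := LinearMap.congr_fun hg (Module.Basis.span hu i)
  rw [Module.Basis.constr_basis] at this
  simpa [Module.Basis.span_apply] using this

/-- `N` is a left inverse of the weights. -/
def IsLI (w : Fin p → Fin m → ℤ) (N : Fin m → Fin p → ℂ) : Prop := ∀ i, ∑ l, (w i l : ℂ) • N l = sg i

theorem IsLI_of (w : Fin p → Fin m → ℤ) (T : Ev m →ₗ[ℂ] (Fin p → ℂ)) (hT : ∀ i, T (wt w i) = sg i) :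
    IsLI w fun l => T (Pi.single l 1) := by
  intro i
  rw [← hT i]
  have : wt w i = ∑ l, (w i l : ℂ) • (Pi.single l 1 : Ev m) := by
    ext k
    simp [wt, Finset.sum_apply, Pi.single_apply]
  conv_rhs => rw [this, map_sum]
  simp

theorem exists_LI {w : Fin p → Fin m → ℤ} (hw : LinearIndependent ℂ (wt w)) : ∃ N, IsLI w N := by
  obtain ⟨T, hT⟩ := exists_lin _ hw sg
  exact ⟨_, IsLI_of w T hT⟩

theorem exists_LI_k {w : Fin p → Fin m → ℤ} (hw : LinearIndependent ℂ (wt w)) (k : Fin m)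
    (hk : (Pi.single k 1 : Ev m) ∉ Submodule.span ℂ (range (wt w))) : ∃ N, IsLI w N ∧ N k = 0 := by
  have h1 : LinearIndependent ℂ (Fin.cons (Pi.single k 1 : Ev m) (wt w) : Fin (p+1) → Ev m) :=
    linearIndependent_finCons.2 ⟨hw, hk⟩
  obtain ⟨T, hT⟩ := exists_lin _ h1 (Fin.cons 0 sg : Fin (p+1) → Fin p → ℂ)
  refine ⟨_, IsLI_of w T fun i => ?_, ?_⟩
  · simpa using hT i.succ
  · simpa using hT 0

theorem LI_sum {w : Fin p → Fin m → ℤ} {N : Fin m → Fin p → ℂ} (hN : IsLI w N) (c : Fin p → ℂ) :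
    ∑ l, (∑ i, c i * (w i l : ℂ)) • N l = c := by
  simp_rw [Finset.sum_smul]
  rw [Finset.sum_comm]
  simp_rw [mul_smul, ← Finset.smul_sum]
  have : ∀ i, c i • ∑ l, (w i l : ℂ) • N l = c i • sg i := fun i => by rw [hN i]
  simp_rw [this]
  ext k
  simp [Finset.sum_apply, Pi.single_apply]

end

end Rig

end

section
open scoped BigOperators
open MeasureTheory Set Filter Topology Metric Asymptotics

namespace Rig

noncomputable section
variable {m p n q : ℕ}

structure Sys (w : Fin p → Fin m → ℤ) (R : Fin p → Ev m × Pm n → Ev m) (f : Fin q → Ev m × Pm n → ℂ)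
    (e0 : ℝ) (v0 : Ev m) : Prop where
  e0pos : 0 < e0
  hm : m = p + q
  hw : LinearIndependent ℂ (wt w)
  hR : ∀ j, AnalyticOnNhd ℂ (R j) (Dom m n 4 e0)
  hcomm : ∀ x ∈ Dom m n 4 e0, ∀ i j, fderiv ℂ (Yf w R j) x (Yf w R i x, 0) =
    fderiv ℂ (Yf w R i) x (Yf w R j x, 0)
  hf : ∀ j, AnalyticOnNhd ℂ (f j) (Dom m n 4 e0)
  hfi : ∀ j i, ∀ x ∈ Dom m n 4 e0, fderiv ℂ (f j) x (Yf w R i x, 0) = 0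
  hv0 : ∀ l, 1/2 < ‖v0 l‖ ∧ ‖v0 l‖ < 3/2
  hgen : LinearIndependent ℂ fun j => (fderiv ℂ (f j) (v0, 0)).comp (ContinuousLinearMap.inl ℂ (Ev m) (Pm n))

theorem Sys.mem {w : Fin p → Fin m → ℤ} {R : Fin p → Ev m × Pm n → Ev m} {f : Fin q → Ev m × Pm n → ℂ}
    {e0 : ℝ} {v0 : Ev m} (h : Sys w R f e0 v0) (S : Set (Fin m)) {e : ℝ} (he : 0 < e) :
    ((v0, 0) : Ev m × Pm n) ∈ Reg m n S e :=
  Reg_mk (fun l => (h.hv0 l).2) (fun l _ => (h.hv0 l).1) (mem_ball_self he)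

theorem Sys.ne {w : Fin p → Fin m → ℤ} {R : Fin p → Ev m × Pm n → Ev m} {f : Fin q → Ev m × Pm n → ℂ}
    {e0 : ℝ} {v0 : Ev m} (h : Sys w R f e0 v0) (l : Fin m) : v0 l ≠ 0 := by
  intro h0; have := (h.hv0 l).1; rw [h0, norm_zero] at this; linarith

theorem Sys.Y0 {w : Fin p → Fin m → ℤ} {R : Fin p → Ev m × Pm n → Ev m} (i : Fin p) (v0 : Ev m) :
    Yf w R i (v0, 0) = wt w i * v0 := by simp [Yf]

theorem Sys.Yind {w : Fin p → Fin m → ℤ} {R : Fin p → Ev m × Pm n → Ev m} {f : Fin q → Ev m × Pm n → ℂ}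
    {e0 : ℝ} {v0 : Ev m} (h : Sys w R f e0 v0) : LinearIndependent ℂ (fun i => Yf w R i (v0, 0)) := by
  have h1 := h.hw
  rw [Fintype.linearIndependent_iff] at h1 ⊢
  intro c hc
  apply h1
  ext l
  have := congrFun hc l
  simp only [Sys.Y0, Finset.sum_apply, Pi.smul_apply, Pi.mul_apply, smul_eq_mul, ← mul_assoc,
    ← Finset.sum_mul] at this
  simpa [h.ne l, Finset.sum_apply] using this

def muf (v0 : Ev m) (N : Fin m → Fin p → ℂ) (v : Ev m) : Fin p → ℂ :=
  ∑ l, Complex.log (v l / v0 l) • N l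

theorem Sys.inj {w : Fin p → Fin m → ℤ} {R : Fin p → Ev m × Pm n → Ev m} {f : Fin q → Ev m × Pm n → ℂ}
    {e0 : ℝ} {v0 : Ev m} (h : Sys w R f e0 v0) {N : Fin m → Fin p → ℂ} (hN : IsLI w N) :
    ∃ U ∈ 𝓝 ((v0, 0) : Ev m × Pm n), ∀ x ∈ U, ∀ y ∈ U, x.2 = y.2 → muf v0 N x.1 = muf v0 N y.1 →
      (∀ j, f j x = f j y) → x = y := by
  have hx0 : ((v0, 0) : Ev m × Pm n) ∈ Dom m n 4 e0 := by
    have := Reg_Dom le_rfl (h.mem univ h.e0pos)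
    exact ⟨ball_subset_ball (by norm_num) this.1, this.2⟩
  let M' : Ev m →L[ℂ] (Fin p → ℂ) :=
    ∑ l, ((v0 l)⁻¹ • ContinuousLinearMap.proj (R := ℂ) (φ := fun _ : Fin m => ℂ) l).smulRight (N l)
  have hM : HasStrictFDerivAt (fun x : Ev m × Pm n => muf v0 N x.1)
      (M'.comp (ContinuousLinearMap.fst ℂ (Ev m) (Pm n))) (v0, 0) := by
    have h1 : HasStrictFDerivAt (muf v0 N) M' v0 := by
      unfold muf
      refine HasStrictFDerivAt.fun_sum fun l _ => ?_
      refine HasStrictFDerivAt.smul_const ?_ _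
      have h2 : HasStrictFDerivAt (fun v : Ev m => v l / v0 l) ((v0 l)⁻¹ • ContinuousLinearMap.proj (R := ℂ)
          (φ := fun _ : Fin m => ℂ) l) v0 := by
        have := (ContinuousLinearMap.proj (R := ℂ) (φ := fun _ : Fin m => ℂ) l).hasStrictFDerivAt (x := v0)
        have := this.const_smul (v0 l)⁻¹
        have h9 : (fun v : Ev m => v l / v0 l) = (v0 l)⁻¹ • (fun v : Ev m => v l) := by
          ext v
          simp [div_eq_inv_mul]
        rw [h9]
        exact this
      have h3 := HasStrictFDerivAt.clog h2 (by simp [div_self (h.ne l)])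
      have h4 : v0 l / v0 l = 1 := div_self (h.ne l)
      rw [h4, inv_one, one_smul] at h3
      exact h3
    exact h1.comp (v0, 0) (hasStrictFDerivAt_fst)
  have hf : HasStrictFDerivAt (fun x j => f j x) (ContinuousLinearMap.pi fun j => fderiv ℂ (f j) (v0, 0)) (v0, 0) :=
    hasStrictFDerivAt_pi.2 fun j => (h.hf j _ hx0).hasStrictFDerivAt
  have hT := hM.prodMk (hf.prodMk (hasStrictFDerivAt_snd (𝕜 := ℂ) (E := Ev m) (F := Pm n) (p := (v0, 0))))
  obtain ⟨U, hU, hU'⟩ := strict_inj hT (by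
    rintro ⟨d, d2⟩ hd
    simp only [ContinuousLinearMap.prod_apply, Prod.mk_eq_zero, ContinuousLinearMap.comp_apply,
      ContinuousLinearMap.coe_fst', ContinuousLinearMap.coe_snd'] at hd
    obtain ⟨hd1, hd2, rfl⟩ := hd
    have hs := ker_span h.hm _ h.hgen _ h.Yind (fun i j => by simpa using h.hfi j i _ hx0) d
      (fun j => by simpa using congrFun hd2 j)
    obtain ⟨c, hc⟩ := (Submodule.mem_span_range_iff_exists_fun ℂ).1 hs
    have h5 : M' d = c := by
      conv_rhs => rw [← LI_sum hN c]
      simp only [M', ContinuousLinearMap.sum_apply, ContinuousLinearMap.smulRight_apply,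
        ContinuousLinearMap.smul_apply, ContinuousLinearMap.proj_apply]
      refine Finset.sum_congr rfl fun l _ => ?_
      congr 1
      rw [← hc]
      simp only [Sys.Y0, Finset.sum_apply, Pi.smul_apply, Pi.mul_apply, smul_eq_mul, ← mul_assoc,
        ← Finset.sum_mul]
      rw [mul_comm, ← mul_assoc, mul_inv_cancel₀ (h.ne l), one_mul]
      rfl
    have h6 : c = 0 := by rw [← h5, hd1]
    simp [← hc, h6])
  refine ⟨U, hU, fun x hx y hy h1 h2 h3 => hU' hx hy ?_⟩
  simp [h1, h2, funext h3]

end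

end Rig

end

section
open scoped BigOperators
open MeasureTheory Set Filter Topology Metric Asymptotics

namespace Rig

noncomputable section
variable {m p n q : ℕ}

theorem ex_sg (w : Fin p → Fin m → ℤ) (j : Fin p) : ex w (sg j) = 1 := by
  ext l
  simp only [ex, Pi.one_apply]
  have : ∑ i, sg j i * (w i l : ℂ) = (w j l : ℂ) := by
    simp [Pi.single_apply]
  rw [this, mul_comm, tpi, Complex.exp_int_mul_two_pi_mul_I]

theorem ex_shift (w : Fin p → Fin m → ℤ) (j : Fin p) (t : Fin p → ℂ) : ex w t = ex w (t - sg j) := by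
  conv_lhs => rw [← sub_add_cancel t (sg j), ex_add, ex_sg, mul_one]

theorem Psi_eq (w : Fin p → Fin m → ℤ) (t : Fin p → ℂ) (y : Ev m) : y = ex w t * (ex w (-t) * y) := by
  rw [← mul_assoc, mul_comm (ex w t), ex_neg_mul, one_mul]

theorem Psi_s0 {w : Fin p → Fin m → ℤ} {R : Fin p → Ev m × Pm n → Ev m} {κ e C : ℝ}
    {Ψ : Tot p m n → Ev m} (hF : IsFlow w R κ e C Ψ) {τ : Fin p → ℂ} {x : Ev m × Pm n}
    (hm : (τ, x) ∈ Om p m n κ e) (hs : x.2.1 = 0) : ex w (-τ) * Ψ (τ, x) = x.1 := by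
  have := hF.cl τ x hm
  rw [hs, norm_zero, zero_mul, norm_le_zero_iff, sub_eq_zero] at this
  exact this

theorem Hf_zero {w : Fin p → Fin m → ℤ} {R : Fin p → Ev m × Pm n → Ev m} {κ e C : ℝ}
    {Ψ : Tot p m n → Ev m} (hF : IsFlow w R κ e C Ψ) (N : Fin m → Fin p → ℂ) {τ : Fin p → ℂ} {x : Ev m × Pm n}
    (hm : (τ, x) ∈ Om p m n κ e) (hs : x.2.1 = 0) : Hf w Ψ N (τ, x) = 0 := by
  simp only [Hf]
  rw [Psi_s0 hF hm hs]
  have : ∀ l, Complex.log (x.1 l / x.1 l) = 0 := by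
    intro l
    by_cases h : x.1 l = 0
    · simp [h]
    · simp [div_self h]
  simp [this]

theorem sgn_mem {ρ : ℝ} (hρ : 0 < ρ) {j : Fin p} {t : Fin p → ℂ} (h : ‖t - sg j‖ ≤ ρ / 4) :
    t ∈ ball (sg j) (2 * ρ) := by
  rw [mem_ball, dist_eq_norm]; linarith

/-- smallness condition on the radius -/
def Small (w : Fin p → Fin m → ℤ) (ρ : ℝ) : Prop :=
  ∀ (d : Fin p → ℂ) (l : Fin m), ‖d‖ ≤ ρ / 4 → ‖tpi * ∑ i, d i * (w i l : ℂ)‖ ≤ 1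

theorem exists_small (w : Fin p → Fin m → ℤ) {κ : ℝ} (hκ : 0 < κ) :
    ∃ ρ > 0, 2 * ρ ≤ 1 ∧ 2 * ρ ≤ κ ∧ Small w ρ := by
  set K : ℝ := ∑ l, ∑ i, ‖(w i l : ℂ)‖ + 1 with hK
  have hKpos : 0 < K := by positivity
  refine ⟨min (min 2⁻¹ (κ / 2)) (4 / (‖tpi‖ * K)), ?_, ?_, ?_, ?_⟩
  · have : 0 < ‖tpi‖ := norm_pos_iff.2 tpi_ne
    positivity
  · have : min (min 2⁻¹ (κ / 2)) (4 / (‖tpi‖ * K)) ≤ 2⁻¹ := (min_le_left _ _).trans (min_le_left _ _)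
    linarith
  · have : min (min 2⁻¹ (κ / 2)) (4 / (‖tpi‖ * K)) ≤ κ / 2 := (min_le_left _ _).trans (min_le_right _ _)
    linarith
  · intro d l hd
    have h0 : 0 < ‖tpi‖ := norm_pos_iff.2 tpi_ne
    have h1 : ‖d‖ ≤ 1 / (‖tpi‖ * K) := by
      have : min (min 2⁻¹ (κ / 2)) (4 / (‖tpi‖ * K)) ≤ 4 / (‖tpi‖ * K) := min_le_right _ _
      calc ‖d‖ ≤ 4 / (‖tpi‖ * K) / 4 := hd.trans (by gcongr)
        _ = _ := by ring
    rw [norm_mul]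
    have h2 : ‖∑ i, d i * (w i l : ℂ)‖ ≤ ‖d‖ * K := by
      calc _ ≤ ∑ i, ‖d‖ * ‖(w i l : ℂ)‖ := norm_sum_le_of_le _ fun i _ => by
            rw [norm_mul]; gcongr; exact norm_le_pi_norm d i
        _ = ‖d‖ * ∑ i, ‖(w i l : ℂ)‖ := by rw [Finset.mul_sum]
        _ ≤ ‖d‖ * K := by
            gcongr
            have := Finset.single_le_sum (f := fun l => ∑ i, ‖(w i l : ℂ)‖) (fun l _ => by positivity)
              (Finset.mem_univ l)
            linarith
    rw [le_div_iff₀ (by positivity)] at h1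
    calc ‖tpi‖ * ‖∑ i, d i * (w i l : ℂ)‖ ≤ ‖tpi‖ * (‖d‖ * K) := by gcongr
      _ = ‖d‖ * (‖tpi‖ * K) := by ring
      _ ≤ 1 := h1

theorem log3 {a b c : ℂ} (ha : ‖a‖ ≤ 1) (hb : ‖b‖ ≤ 1) (hc : ‖c‖ ≤ 1) :
    Complex.log (Complex.exp (a + b + c)) = a + b + c := by
  have h1 : |(a + b + c).im| ≤ 3 := by
    refine (Complex.abs_im_le_norm _).trans ?_
    have := norm_add₃_le (a := a) (b := b) (c := c)
    linarith
  rw [abs_le] at h1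
  have := Real.pi_gt_three
  exact Complex.log_exp (by linarith) (by linarith)

theorem Sys.period {w : Fin p → Fin m → ℤ} {R : Fin p → Ev m × Pm n → Ev m} {f : Fin q → Ev m × Pm n → ℂ}
    {e0 : ℝ} {v0 : Ev m} (h : Sys w R f e0 v0) {κ e C : ℝ}
    {Ψ : Tot p m n → Ev m} (hF : IsFlow w R κ e C Ψ) (hee : e ≤ e0) {N : Fin m → Fin p → ℂ} (hN : IsLI w N)
    (j : Fin p) {ρ : ℝ} (hρ : 0 < ρ) (hρ1 : 2 * ρ ≤ 1) (hρκ : 2 * ρ ≤ κ) (hsm : Small w ρ)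
    {e' : ℝ} (he' : 0 < e') (he'e : e' ≤ e)
    (hlog : ∀ τ ∈ ball (sg j) (2 * ρ), ∀ x ∈ Reg m n ∅ e', ∀ l,
        ‖Complex.log ((ex w (-τ) * Ψ (τ, x)) l / x.1 l)‖ ≤ 1 ∧ (ex w (-τ) * Ψ (τ, x)) l ≠ 0)
    {a : Ev m × Pm n → Fin p → ℂ} (ha : AnalyticOnNhd ℂ a (Reg m n ∅ e'))
    (han : ∀ x ∈ Reg m n ∅ e', ‖a x - sg j‖ ≤ ρ / 4)
    (hae : ∀ x ∈ Reg m n ∅ e', a x = sg j + Hf w Ψ N (a x, x)) :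
    ∀ x ∈ Reg m n ∅ e', Ψ (a x, x) = x.1 := by
  have hOm : ∀ x ∈ Reg m n ∅ e', (a x, x) ∈ Om p m n κ e := fun x hx =>
    ⟨sg_ball hρ1 hρκ j (sgn_mem hρ (han x hx)), Reg_Dom he'e hx⟩
  have hx0 : ((v0, 0) : Ev m × Pm n) ∈ Reg m n ∅ e' := h.mem _ he'
  have hΨan : AnalyticOnNhd ℂ (fun x => Ψ (a x, x)) (Reg m n ∅ e') := by
    refine analytic_of_diff (isOpen_Reg _ _) fun x hx => DifferentiableAt.differentiableWithinAt ?_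
    exact DifferentiableAt.comp (g := Ψ) (f := fun x => (a x, x)) x (hF.an _ (hOm x hx)).differentiableAt
      ((ha x hx).differentiableAt.prodMk differentiableAt_id)
  have hy0 : Ψ (a (v0, 0), (v0, 0)) = v0 := by
    have h1 : a (v0, 0) = sg j := by
      rw [hae _ hx0, Hf_zero hF N (hOm _ hx0) rfl, add_zero]
    have h2 := Psi_s0 hF (hOm _ hx0) rfl
    rw [Psi_eq w (a (v0, 0)) (Ψ (a (v0, 0), (v0, 0))), h2, h1, ex_sg, one_mul]
  obtain ⟨U, hU, hinj⟩ := h.inj hN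
  have hc : ContinuousAt (fun x : Ev m × Pm n => (Ψ (a x, x), x.2)) (v0, 0) :=
    (hΨan _ hx0).continuousAt.prodMk continuousAt_snd
  have hev1 : ∀ᶠ x in 𝓝 ((v0, 0) : Ev m × Pm n), (Ψ (a x, x), x.2) ∈ U := by
    apply hc
    simpa [hy0] using hU
  have hev2 : ∀ᶠ x in 𝓝 ((v0, 0) : Ev m × Pm n), ∀ l, ‖Complex.log (x.1 l / v0 l)‖ ≤ 1 := by
    rw [eventually_all]
    intro l
    have h1 : ContinuousAt (fun x : Ev m × Pm n => ‖Complex.log (x.1 l / v0 l)‖) (v0, 0) := by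
      refine ContinuousAt.norm (ContinuousAt.clog (by fun_prop) ?_)
      simp [div_self (h.ne l)]
    have h2 := Filter.Tendsto.eventually_lt_const (u := (1:ℝ)) (by simp [div_self (h.ne l)]) h1
    exact h2.mono fun x hx => le_of_lt hx
  have key : (fun x => Ψ (a x, x)) =ᶠ[𝓝 ((v0, 0) : Ev m × Pm n)] fun x => x.1 := by
    filter_upwards [hev1, hev2, hU, (isOpen_Reg _ _).mem_nhds hx0] with x h1 h2 h3 hx
    have := hinj _ h1 _ h3 rfl ?_ ?_
    · exact congrArg Prod.fst this
    · simp only [muf]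
      have h5 : ∀ l, Complex.log (Ψ (a x, x) l / v0 l) = tpi * ∑ i, (a x - sg j) i * (w i l : ℂ) +
          Complex.log ((ex w (-(a x)) * Ψ (a x, x)) l / x.1 l) + Complex.log (x.1 l / v0 l) := by
        intro l
        have h6 := hlog (a x) (sgn_mem hρ (han x hx)) x hx l
        have hxl : x.1 l ≠ 0 := by
          have := Reg_gt hx (l := l) (by simp)
          intro h0; rw [h0, norm_zero] at this; linarith
        rw [← log3 (hsm _ l (han x hx)) h6.1 (h2 l), Complex.exp_add, Complex.exp_add,
          Complex.exp_log (div_ne_zero h6.2 hxl), Complex.exp_log (div_ne_zero hxl (h.ne l))]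
        congr 1
        conv_lhs => rw [Psi_eq w (a x) (Ψ (a x, x)), ex_shift w j, Pi.mul_apply]
        simp only [ex]
        field_simp
      simp_rw [h5, add_smul, Finset.sum_add_distrib, mul_smul tpi]
      rw [← Finset.smul_sum, LI_sum hN]
      have h7 := hae x hx
      rw [Hf, ← sub_eq_iff_eq_add'] at h7
      rw [h7]
      rw [smul_neg, smul_smul, mul_inv_cancel₀ tpi_ne, one_smul, neg_add_cancel, zero_add]
    · intro i
      refine inv_flow hF (Ω := Dom m n 4 e0) (fun x hx => (h.hf i x hx).differentiableAt)
        (fun x hx l => h.hfi i l x hx) (hOm x hx) ?_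
      intro t ht
      refine ⟨?_, ball_subset_ball (he'e.trans hee) (Reg_e (x := x) hx)⟩
      have h8 : ((t:ℂ) • a x, x) ∈ Om p m n κ e :=
        ⟨Tset_smul (hOm x hx).1 (by rw [abs_le]; constructor <;> linarith [ht.1, ht.2]), (hOm x hx).2⟩
      rw [mem_ball_zero_iff]
      have := hF.bd _ h8
      linarith
  exact hΨan.eqOn_of_preconnected_of_eventuallyEq (fun x _ => analyticAt_fst) (preconn_Reg _ _) hx0 key

/-- A full period satisfies every reduced equation. -/
theorem full_reduced {w : Fin p → Fin m → ℤ} {Ψ : Tot p m n → Ev m} {N : Fin m → Fin p → ℂ} (hN : IsLI w N)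
    (j : Fin p) {ρ : ℝ} (hsm : Small w ρ) {t : Fin p → ℂ} (ht : ‖t - sg j‖ ≤ ρ / 4)
    {x : Ev m × Pm n} (hx : ∀ l, x.1 l ≠ 0) (hper : Ψ (t, x) = x.1) : t = sg j + Hf w Ψ N (t, x) := by
  simp only [Hf]
  have h5 : ∀ l, Complex.log ((ex w (-t) * Ψ (t, x)) l / x.1 l) = -(tpi * ∑ i, (t - sg j) i * (w i l : ℂ)) := by
    intro l
    have h6 := log3 (a := -(tpi * ∑ i, (t - sg j) i * (w i l : ℂ))) (b := 0) (c := 0)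
      (by rw [norm_neg]; exact hsm _ l ht) (by simp) (by simp)
    rw [add_zero, add_zero] at h6
    rw [← h6, hper, Pi.mul_apply, mul_div_assoc, div_self (hx l), mul_one]
    have h7 : ex w (-t) = ex w (-(t - sg j)) := by
      rw [neg_sub, sub_eq_add_neg, ex_add, ex_sg, one_mul]
    rw [h7]
    simp only [ex, Pi.neg_apply, neg_mul, Finset.sum_neg_distrib, mul_neg]
  simp_rw [h5, neg_smul, Finset.sum_neg_distrib, mul_smul tpi]
  rw [← Finset.smul_sum, LI_sum hN, smul_neg, neg_neg, smul_smul, inv_mul_cancel₀ tpi_ne, one_smul]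
  abel

end

end Rig

end

section
open scoped BigOperators
open MeasureTheory Set Filter Topology Metric Asymptotics

namespace Rig

noncomputable section
variable {m p n q : ℕ}

theorem period_inv {w : Fin p → Fin m → ℤ} {R : Fin p → Ev m × Pm n → Ev m} {κ e C : ℝ}
    {Ψ : Tot p m n → Ev m} (hF : IsFlow w R κ e C Ψ) {a : Ev m × Pm n → Fin p → ℂ}
    {x : Ev m × Pm n} (ha : DifferentiableAt ℂ a x) (hOm : (a x, x) ∈ Om p m n κ e)
    (hper : (fun x => Ψ (a x, x)) =ᶠ[𝓝 x] fun x => x.1) 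
    (hli : LinearIndependent ℂ fun i => Yf w R i x) (i : Fin p) :
    fderiv ℂ a x (Yf w R i x, 0) = 0 := by
  have hΨ : DifferentiableAt ℂ Ψ (a x, x) := (hF.an _ hOm).differentiableAt
  have h1 : HasFDerivAt (fun x => Ψ (a x, x)) ((fderiv ℂ Ψ (a x, x)).comp ((fderiv ℂ a x).prod
      (ContinuousLinearMap.id ℂ _))) x :=
    HasFDerivAt.comp (g := Ψ) (f := fun x => (a x, x)) x hΨ.hasFDerivAt
      (ha.hasFDerivAt.prodMk (hasFDerivAt_id x))
  have h2 := (hasFDerivAt_fst (𝕜 := ℂ) (E := Ev m) (F := Pm n) (p := x)).congr_of_eventuallyEq hper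
  have h3 := congrArg (fun T : Ev m × Pm n →L[ℂ] Ev m => T (Yf w R i x, 0)) (h1.unique h2)
  simp only [ContinuousLinearMap.comp_apply, ContinuousLinearMap.prod_apply, ContinuousLinearMap.id_apply,
    ContinuousLinearMap.coe_fst'] at h3
  have h4 : ((fderiv ℂ a x (Yf w R i x, 0), (Yf w R i x, 0)) : Tot p m n) =
    (fderiv ℂ a x (Yf w R i x, 0), 0) + (0, (Yf w R i x, 0)) := by simp
  have h5 : Ψ (a x, x) = x.1 := hper.eq_of_nhds
  rw [h4, map_add, hF.dt _ _ hOm, hF.dx _ _ hOm, h5, add_eq_right, smul_eq_zero] at h3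
  have h6 := h3.resolve_left tpi_ne
  rw [Fintype.linearIndependent_iff] at hli
  ext l
  exact hli _ h6 l

theorem Yder_an {w : Fin p → Fin m → ℤ} {R : Fin p → Ev m × Pm n → Ev m} {Ω : Set (Ev m × Pm n)} (hΩ : IsOpen Ω)
    (hR : ∀ j, AnalyticOnNhd ℂ (R j) Ω) {F : Type*} [NormedAddCommGroup F] [NormedSpace ℂ F] [CompleteSpace F]
    {a : Ev m × Pm n → F} (ha : AnalyticOnNhd ℂ a Ω) (i : Fin p) :
    AnalyticOnNhd ℂ (fun x => fderiv ℂ a x (Yf w R i x, 0)) Ω := by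
  refine analytic_of_diff hΩ fun x hx => DifferentiableAt.differentiableWithinAt ?_
  have h1 := (ha.fderiv x hx).differentiableAt
  have h2 : DifferentiableAt ℂ (fun x => (Yf w R i x, (0 : Pm n))) x :=
    (Yf_an w hΩ hR i x hx).differentiableAt.prodMk (differentiableAt_const _)
  exact h1.clm_apply h2

theorem Sys.periods {w : Fin p → Fin m → ℤ} {R : Fin p → Ev m × Pm n → Ev m} {f : Fin q → Ev m × Pm n → ℂ}
    {e0 : ℝ} {v0 : Ev m} (h : Sys w R f e0 v0) {κ e C : ℝ}
    {Ψ : Tot p m n → Ev m} (hF : IsFlow w R κ e C Ψ) (hee : e ≤ e0) (j : Fin p) :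
    ∃ e' > 0, e' ≤ e ∧ ∃ a : Ev m × Pm n → Fin p → ℂ, AnalyticOnNhd ℂ a (Reg m n ∅ e') ∧
      (∀ x ∈ Reg m n ∅ e', (a x, x) ∈ Om p m n κ e) ∧
      (∀ x ∈ Reg m n ∅ e', Ψ (a x, x) = x.1) ∧
      (∀ x ∈ Reg m n ∅ e', x.2.1 = 0 → a x = sg j) ∧
      (∀ x ∈ Reg m n ∅ e', ∀ i, fderiv ℂ a x (Yf w R i x, 0) = 0) ∧
      ∀ k : Fin m, (Pi.single k 1 : Ev m) ∉ Submodule.span ℂ (range (wt w)) →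
        ∃ b : Ev m × Pm n → Fin p → ℂ, AnalyticOnNhd ℂ b (Reg m n {k} e') ∧
          EqOn a b (Reg m n ∅ e') := by
  obtain ⟨ρ, hρ, hρ1, hρκ, hsm⟩ := exists_small w hF.kpos
  obtain ⟨N, hN⟩ := exists_LI h.hw
  obtain ⟨e1, he1, he1e, hlog, a, ha, han, hae, -⟩ := period_solve hF N ∅ (by simp) j hρ hρ1 hρκ
  have hper := h.period hF hee hN j hρ hρ1 hρκ hsm he1 he1e (fun τ hτ x hx l => hlog τ hτ x hx l (by simp)) ha han hae
  have hk : ∀ k : Fin m, ∃ e2 > 0, (Pi.single k 1 : Ev m) ∉ Submodule.span ℂ (range (wt w)) →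
      ∃ b : Ev m × Pm n → Fin p → ℂ, AnalyticOnNhd ℂ b (Reg m n {k} e2) ∧
        ∀ x ∈ Reg m n {k} e2, ∀ t, ‖t - sg j‖ ≤ ρ / 4 → 
          (∀ N', IsLI w N' → t = sg j + Hf w Ψ N' (t, x)) → t = b x := by
    intro k
    by_cases hk : (Pi.single k 1 : Ev m) ∈ Submodule.span ℂ (range (wt w))
    · exact ⟨1, one_pos, fun h => absurd hk h⟩
    · obtain ⟨N', hN', hN'k⟩ := exists_LI_k h.hw k hk
      obtain ⟨e2, he2, -, -, b, hb, -, -, hbu⟩ := period_solve hF N' {k} (by simpa using hN'k) j hρ hρ1 hρκ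
      exact ⟨e2, he2, fun _ => ⟨b, hb, fun x hx t ht h => hbu x hx t ht (h N' hN')⟩⟩
  choose e2 he2 hb using hk
  obtain ⟨e3, he3, he3'⟩ : ∃ e3 > 0, ∀ k, e3 ≤ e2 k := by
    rcases isEmpty_or_nonempty (Fin m) with hE | hE
    · exact ⟨1, one_pos, fun k => hE.elim k⟩
    · obtain ⟨k0, hk0⟩ := Finite.exists_min e2
      exact ⟨e2 k0, he2 k0, hk0⟩
  have hsub : Reg m n ∅ (min e1 e3) ⊆ Reg m n ∅ e1 := Reg_mono le_rfl (min_le_left _ _)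
  have hOm : ∀ x ∈ Reg m n ∅ e1, (a x, x) ∈ Om p m n κ e := fun x hx =>
    ⟨sg_ball hρ1 hρκ j (sgn_mem hρ (han x hx)), Reg_Dom he1e hx⟩
  have hne : ∀ x ∈ Reg m n ∅ e1, ∀ l, x.1 l ≠ 0 := by
    intro x hx l
    have := Reg_gt hx (l := l) (by simp)
    intro h0; rw [h0, norm_zero] at this; linarith
  have hRR : ∀ j, AnalyticOnNhd ℂ (R j) (Reg m n ∅ e1) := fun j =>
    (h.hR j).mono fun x hx => ⟨ball_subset_ball (by norm_num) (Reg_Dom (he1e.trans hee) hx).1,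
      (Reg_Dom (he1e.trans hee) hx).2⟩
  have hinv : ∀ i, ∀ x ∈ Reg m n ∅ e1, fderiv ℂ a x (Yf w R i x, 0) = 0 := by
    intro i
    have hx0 : ((v0, 0) : Ev m × Pm n) ∈ Reg m n ∅ e1 := h.mem _ he1
    refine (Yder_an (isOpen_Reg _ _) hRR ha i).eqOn_zero_of_preconnected_of_eventuallyEq_zero (preconn_Reg _ _) hx0 ?_
    have hc : ContinuousAt (fun x i => Yf w R i x) (v0, 0) :=
      continuousAt_pi.2 fun i => (Yf_an w (isOpen_Reg _ _) hRR i _ hx0).continuousAt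
    have h1 := hc.eventually (isOpen_setOf_linearIndependent.mem_nhds h.Yind)
    filter_upwards [h1, (isOpen_Reg _ _).mem_nhds hx0] with x hli hx
    exact period_inv hF (ha x hx).differentiableAt (hOm x hx)
      (Filter.eventuallyEq_of_mem ((isOpen_Reg _ _).mem_nhds hx) hper) hli i
  refine ⟨min e1 e3, lt_min he1 he3, (min_le_left _ _).trans he1e, a, ha.mono hsub, fun x hx => hOm x (hsub hx),
    fun x hx => hper x (hsub hx), fun x hx hs => ?_, fun x hx i => hinv i x (hsub hx), fun k hk => ?_⟩
  · rw [hae _ (hsub hx), Hf_zero hF N (hOm _ (hsub hx)) hs, add_zero]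
  · obtain ⟨b, hb1, hb2⟩ := hb k hk
    refine ⟨b, hb1.mono (Reg_mono le_rfl ((min_le_right _ _).trans (he3' k))), fun x hx => ?_⟩
    exact hb2 x (Reg_mono (empty_subset _) ((min_le_right _ _).trans (he3' k)) hx) _ (han x (hsub hx))
      fun N' hN' => full_reduced hN' j hsm (han x (hsub hx)) (hne x (hsub hx)) (hper x (hsub hx))

end

end Rig

end

section
open scoped BigOperators
open MeasureTheory Set Filter Topology Metric Asymptotics

namespace Rig

noncomputable section
variable {m p n q : ℕ}

section circ
variable {E F : Type*} [NormedAddCommGroup E] [NormedSpace ℂ E] [FiniteDimensional ℂ E]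
  [NormedAddCommGroup F] [NormedSpace ℂ F] [CompleteSpace F]

/-- circle point -/
def cpt (r : ℝ) (u : ℂ) : ℂ := r * Complex.exp (tpi * u)

theorem cpt_diff (r : ℝ) : Differentiable ℂ (cpt r) := by unfold cpt; fun_prop

theorem cpt_mem {r : ℝ} (hr : 0 ≤ r) (u : ℝ) : cpt r u ∈ sphere (0:ℂ) r := by
  have h1 : tpi * (u : ℂ) = ((2 * Real.pi * u : ℝ) : ℂ) * Complex.I := by simp [tpi]; ring
  rw [mem_sphere_zero_iff_norm, cpt, norm_mul, h1, Complex.norm_exp_ofReal_mul_I]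
  simp [abs_of_nonneg hr]

theorem circ_eq (r : ℝ) (f : ℂ → F) :
    (∮ z in C(0, r), f z) = ∫ u in (0:ℝ)..1, (tpi * cpt r u) • f (cpt r u) := by
  rw [circleIntegral]
  have h1 := intervalIntegral.smul_integral_comp_mul_right (a := 0) (b := 1)
    (fun θ : ℝ => deriv (circleMap 0 r) θ • f (circleMap 0 r θ)) (2 * Real.pi)
  simp only [zero_mul, one_mul] at h1
  rw [← h1, ← intervalIntegral.integral_smul]
  refine intervalIntegral.integral_congr fun u _ => ?_
  have h2 : circleMap 0 r (u * (2 * Real.pi)) = cpt r u := by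
    simp only [circleMap, cpt, zero_add, tpi]
    push_cast
    ring_nf
  simp only [deriv_circleMap, h2]
  have h3 : circleMap 0 r (u * (2 * Real.pi)) = cpt r u := h2
  rw [RCLike.real_smul_eq_coe_smul (K := ℂ), smul_smul]
  congr 1
  simp only [tpi]
  push_cast
  simp
  ring

theorem circ_param {r : ℝ} (hr : 0 ≤ r) {Ω : Set (ℂ × E)} (hΩ : IsOpen Ω) {K : ℂ × E → F} (hK : AnalyticOnNhd ℂ K Ω)
    {V : Set E} (hV : IsOpen V) (hVΩ : ∀ x ∈ V, ∀ z ∈ sphere (0:ℂ) r, (z, x) ∈ Ω) :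
    AnalyticOnNhd ℂ (fun x => ∮ z in C(0, r), K (z, x)) V ∧
    ∀ x ∈ V, ∀ d, fderiv ℂ (fun x => ∮ z in C(0, r), K (z, x)) x d =
      ∮ z in C(0, r), fderiv ℂ K (z, x) (0, d) := by
  have := FiniteDimensional.complete ℂ E
  let Ω' : Set (ℂ × E) := {y | (cpt r y.1, y.2) ∈ Ω}
  have hcd : Differentiable ℂ (fun y : ℂ × E => cpt r y.1) := (cpt_diff r).comp differentiable_fst
  have hcdd : Differentiable ℂ (fun y : ℂ × E => (cpt r y.1, y.2)) := hcd.prodMk differentiable_snd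
  have hΩ' : IsOpen Ω' := hΩ.preimage hcdd.continuous
  let K' : ℂ × E → F := fun y => (tpi * cpt r y.1) • K (cpt r y.1, y.2)
  have hKc : ∀ y ∈ Ω', DifferentiableAt ℂ (fun y : ℂ × E => K (cpt r y.1, y.2)) y := fun y hy =>
    DifferentiableAt.comp (g := K) (f := fun y : ℂ × E => (cpt r y.1, y.2)) y (hK _ hy).differentiableAt (hcdd y)
  have hK' : AnalyticOnNhd ℂ K' Ω' := by
    refine analytic_of_diff hΩ' fun y hy => DifferentiableAt.differentiableWithinAt ?_
    exact ((hcd y).const_mul tpi).smul (hKc y hy)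
  have htube : V ⊆ tube Ω' := fun x hx u _ => hVΩ x hx _ (cpt_mem hr u)
  have heq : (fun x => ∮ z in C(0, r), K (z, x)) = fun x => ∫ u in (0:ℝ)..1, K' ((u:ℂ), x) := by
    ext x; rw [circ_eq]
  refine ⟨?_, fun x hx d => ?_⟩
  · rw [heq]; exact (paramInt_analytic hΩ' hK').mono htube
  · rw [heq, paramInt_fderiv hΩ' hK' (htube hx), circ_eq]
    refine intervalIntegral.integral_congr fun u hu => ?_
    have hy : ((u:ℂ), x) ∈ Ω' := hVΩ x hx _ (cpt_mem hr u)
    -- restrict to slice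
    have h1 : HasFDerivAt (fun y : E => K' ((u:ℂ), y)) ((fderiv ℂ K' ((u:ℂ), x)).comp
        (ContinuousLinearMap.inr ℂ ℂ E)) x := by
      have h0 : HasFDerivAt (fun y : E => ((u:ℂ), y)) (ContinuousLinearMap.inr ℂ ℂ E) x := hasFDerivAt_prodMk_right _ _
      exact ((hK' _ hy).differentiableAt.hasFDerivAt).comp x h0
    have h2 : HasFDerivAt (fun y : E => K' ((u:ℂ), y)) ((tpi * cpt r u) • ((fderiv ℂ K (cpt r u, x)).comp
        (ContinuousLinearMap.inr ℂ ℂ E))) x := by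
      have h0 : HasFDerivAt (fun y : E => (cpt r (u:ℂ), y)) (ContinuousLinearMap.inr ℂ ℂ E) x := hasFDerivAt_prodMk_right _ _
      have h3 : HasFDerivAt (fun y : E => K (cpt r (u:ℂ), y)) _ x :=
        ((hK _ hy).differentiableAt.hasFDerivAt).comp x h0
      exact h3.const_smul (tpi * cpt r u)
    have := congrArg (fun T : E →L[ℂ] F => T d) (h1.unique h2)
    simpa using this

/-- Cauchy formula on an annulus, when the inner integral vanishes. -/
theorem cauchy_annulus {g : ℂ → F} {r R : ℝ} {A : Set ℂ} (hA : IsOpen A) (hr : 0 < r)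
    (hAs : closedBall 0 R \ ball 0 r ⊆ A) (hg : DifferentiableOn ℂ g A) {z : ℂ} (hz1 : r < ‖z‖) (hz2 : ‖z‖ < R)
    (h0 : (∮ t in C(0, r), (t - z)⁻¹ • g t) = 0) :
    (∮ t in C(0, R), (t - z)⁻¹ • g t) = tpi • g z := by
  have hzA : z ∈ A := hAs ⟨by simpa using hz2.le, by simpa using hz1.le⟩
  have hd : DifferentiableOn ℂ (dslope g z) A := (Complex.differentiableOn_dslope (hA.mem_nhds hzA)).2 hg
  have h1 := Complex.circleIntegral_eq_of_differentiable_on_annulus_off_countable hr (hz1.trans hz2).le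
    countable_empty (hd.continuousOn.mono hAs) (fun x hx => (hd.differentiableAt (hA.mem_nhds (hAs
      ⟨ball_subset_closedBall hx.1.1, fun h => hx.1.2 (ball_subset_closedBall h)⟩))))
  have hz : ∀ R' ∈ Icc r R, R' ≠ ‖z‖ → (∮ t in C(0, R'), dslope g z t) =
      (∮ t in C(0, R'), (t - z)⁻¹ • g t) - (∮ t in C(0, R'), (t - z)⁻¹) • g z := by
    intro R' hR' hne
    have hR0 : 0 ≤ R' := hr.le.trans hR'.1
    have hsA : sphere (0:ℂ) R' ⊆ A := fun t ht => hAs (by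
      rw [mem_sphere_zero_iff_norm] at ht
      constructor
      · simp [ht, hR'.2]
      · simp [ht, hR'.1])
    have hnz : ∀ t ∈ sphere (0:ℂ) R', t - z ≠ 0 := by
      intro t ht h
      rw [sub_eq_zero] at h
      rw [mem_sphere_zero_iff_norm, h] at ht
      exact hne ht.symm
    have hci : ContinuousOn (fun t : ℂ => (t - z)⁻¹) (sphere 0 R') :=
      ContinuousOn.inv₀ (by fun_prop) hnz
    rw [← circleIntegral.integral_smul_const, ← circleIntegral.integral_sub]
    · refine circleIntegral.integral_congr hR0 fun t ht => ?_
      rw [dslope_of_ne _ (sub_ne_zero.1 (hnz t ht)), slope_def_module, smul_sub]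
    · exact (hci.smul (hg.continuousOn.mono hsA)).circleIntegrable hR0
    · exact (hci.smul continuousOn_const).circleIntegrable hR0
  have hrR := (hz1.trans hz2).le
  rw [hz R ⟨hrR, le_rfl⟩ hz2.ne', hz r ⟨le_rfl, hrR⟩ hz1.ne, h0,
    circleIntegral.integral_sub_inv_of_mem_ball (by simpa using hz2)] at h1
  have h2 : (∮ t in C(0, r), (t - z)⁻¹) = 0 := by
    have hd : DifferentiableOn ℂ (fun t : ℂ => (t - z)⁻¹) {t | t ≠ z} := by
      intro t ht
      have h7 : DifferentiableAt ℂ (fun t : ℂ => t - z) t := by fun_prop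
      exact (h7.inv (sub_ne_zero.2 ht)).differentiableWithinAt
    have hsub : closedBall (0:ℂ) r ⊆ {t | t ≠ z} := by
      rintro t ht rfl
      rw [mem_closedBall_zero_iff] at ht
      linarith
    exact Complex.circleIntegral_eq_zero_of_differentiable_on_off_countable hr.le countable_empty
      (hd.continuousOn.mono hsub) fun t ht => hd.differentiableAt (isOpen_ne.mem_nhds
        (hsub (ball_subset_closedBall ht.1)))
  rw [h2, zero_smul, sub_zero, sub_eq_zero] at h1
  exact h1

end circ

/-- replace coordinate `k` -/
def upd (k : Fin m) (z : ℂ × (Ev m × Pm n)) : Ev m × Pm n := (Function.update z.2.1 k z.1, z.2.2)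

def kil (k : Fin m) (d : Ev m × Pm n) : Ev m × Pm n := (Function.update d.1 k 0, d.2)

def updL (k : Fin m) : ℂ × (Ev m × Pm n) →L[ℂ] Ev m × Pm n :=
  LinearMap.toContinuousLinearMap
    { toFun := upd k
      map_add' := by
        rintro ⟨z, v, e⟩ ⟨z', v', e'⟩
        simp only [upd, Prod.mk_add_mk, Prod.mk.injEq]
        refine ⟨?_, trivial⟩
        ext l
        by_cases h : l = k
        · subst h; simp
        · simp [h]
      map_smul' := by
        rintro c ⟨z, v, e⟩
        simp only [upd, Prod.smul_mk, RingHom.id_apply, Prod.mk.injEq]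
        refine ⟨?_, trivial⟩
        ext l
        by_cases h : l = k
        · subst h; simp
        · simp [h] }

theorem updL_apply (k : Fin m) (z : ℂ × (Ev m × Pm n)) : updL k z = upd k z := rfl

theorem upd_hasFDerivAt (k : Fin m) (z : ℂ × (Ev m × Pm n)) : HasFDerivAt (upd k) (updL k) z :=
  (updL k).hasFDerivAt

theorem upd_diff (k : Fin m) : Differentiable ℂ (upd k : ℂ × (Ev m × Pm n) → _) :=
  fun z => (upd_hasFDerivAt k z).differentiableAt

theorem upd_k (k : Fin m) (z : ℂ) (x : Ev m × Pm n) : (upd k (z, x)).1 k = z := by simp [upd]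
theorem upd_ne {k l : Fin m} (h : l ≠ k) (z : ℂ) (x : Ev m × Pm n) : (upd k (z, x)).1 l = x.1 l := by
  simp [upd, h]
theorem upd_snd (k : Fin m) (z : ℂ) (x : Ev m × Pm n) : (upd k (z, x)).2 = x.2 := rfl
theorem upd_self (k : Fin m) (x : Ev m × Pm n) : upd k (x.1 k, x) = x := by simp [upd]

theorem upd_Reg {k : Fin m} {S : Set (Fin m)} {e : ℝ} {x : Ev m × Pm n} (h : x ∈ Reg m n (insert k S) e)
    {z : ℂ} (h1 : 1/2 < ‖z‖) (h2 : ‖z‖ < 3/2) : upd k (z, x) ∈ Reg m n S e := by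
  refine Reg_mk (fun l => ?_) (fun l hl => ?_) (Reg_e (x := x) h)
  · by_cases hk : l = k
    · subst hk; rwa [upd_k]
    · rw [upd_ne hk]; exact Reg_lt h l
  · by_cases hk : l = k
    · subst hk; rwa [upd_k]
    · rw [upd_ne hk]; exact Reg_gt h (by simp [hk, hl])

end

end Rig

end

section
open scoped BigOperators
open MeasureTheory Set Filter Topology Metric Asymptotics

namespace Rig

noncomputable section
variable {m p n q : ℕ} {F : Type*} [NormedAddCommGroup F] [NormedSpace ℂ F] [CompleteSpace F]

theorem one_mem_Reg (S : Set (Fin m)) {e : ℝ} (he : 0 < e) : ((1, 0) : Ev m × Pm n) ∈ Reg m n S e :=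
  Reg_mk (by simp; norm_num) (by simp; intros; norm_num) (mem_ball_self he)

theorem upd_an {S : Set (Fin m)} {e : ℝ} (k : Fin m) {g : Ev m × Pm n → F} (hg : AnalyticOnNhd ℂ g (Reg m n S e))
    {y : ℂ × (Ev m × Pm n)} (hy : upd k y ∈ Reg m n S e) : DifferentiableAt ℂ (fun y => g (upd k y)) y :=
  DifferentiableAt.comp (g := g) (f := upd k) y (hg _ hy).differentiableAt (upd_diff k y)

theorem ext_step {S : Set (Fin m)} {k : Fin m} {e : ℝ} (he : 0 < e) {g : Ev m × Pm n → F}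
    (hg : AnalyticOnNhd ℂ g (Reg m n S e))
    (hk : ∀ x ∈ Reg m n ∅ e, ∀ z : ℂ, 3/4 < ‖z‖ → (∮ t in C(0, 3/4), (t - z)⁻¹ • g (upd k (t, x))) = 0) :
    ∃ g' : Ev m × Pm n → F, AnalyticOnNhd ℂ g' (Reg m n (insert k S) e) ∧ EqOn g' g (Reg m n S e) := by
  classical
  set T := insert k S
  have hST : Reg m n S e ⊆ Reg m n T e := Reg_mono (subset_insert _ _) le_rfl
  have hk' : ∀ z : ℂ, 3/4 < ‖z‖ → ∀ x ∈ Reg m n T e, (∮ t in C(0, 3/4), (t - z)⁻¹ • g (upd k (t, x))) = 0 := by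
    intro z hz
    have hΩ : IsOpen {y : ℂ × (Ev m × Pm n) | y.1 ≠ z ∧ upd k y ∈ Reg m n S e} :=
      (isOpen_ne_fun continuous_fst continuous_const).inter ((isOpen_Reg S e).preimage (upd_diff k).continuous)
    have h1 := (circ_param (r := 3/4) (by norm_num) hΩ (K := fun y => (y.1 - z)⁻¹ • g (upd k y))
      (analytic_of_diff hΩ fun y hy => by
        refine DifferentiableAt.differentiableWithinAt ?_
        have h7 : DifferentiableAt ℂ (fun y : ℂ × (Ev m × Pm n) => y.1 - z) y := by fun_prop
        exact (h7.inv (sub_ne_zero.2 hy.1)).smul (upd_an k hg hy.2)) (isOpen_Reg T e) (by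
        intro x hx t ht
        rw [mem_sphere_zero_iff_norm] at ht
        refine ⟨?_, upd_Reg hx (by linarith) (by linarith)⟩
        rintro rfl
        linarith)).1
    refine h1.eqOn_zero_of_preconnected_of_eventuallyEq_zero (preconn_Reg T e) (one_mem_Reg T he) ?_
    filter_upwards [(isOpen_Reg ∅ e).mem_nhds (one_mem_Reg ∅ he)] with x hx
    exact hk x hx z hz
  set V : Set (Ev m × Pm n) := Reg m n T e ∩ {x | ‖x.1 k‖ < 1} with hV
  have hVo : IsOpen V := (isOpen_Reg T e).inter (isOpen_lt (by fun_prop) continuous_const)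
  set C1 : Ev m × Pm n → F := fun x => ∮ t in C(0, 1), (t - x.1 k)⁻¹ • g (upd k (t, x)) with hC1
  have hC1an : AnalyticOnNhd ℂ C1 V := by
    have hΩ : IsOpen {y : ℂ × (Ev m × Pm n) | y.1 ≠ y.2.1 k ∧ upd k y ∈ Reg m n S e} :=
      (isOpen_ne_fun continuous_fst (by fun_prop)).inter ((isOpen_Reg S e).preimage (upd_diff k).continuous)
    refine (circ_param (r := 1) (by norm_num) hΩ (K := fun y => (y.1 - y.2.1 k)⁻¹ • g (upd k y))
      (analytic_of_diff hΩ fun y hy => ?_) hVo ?_).1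
    · refine DifferentiableAt.differentiableWithinAt ?_
      have h7 : DifferentiableAt ℂ (fun y : ℂ × (Ev m × Pm n) => y.1 - y.2.1 k) y := by fun_prop
      exact (h7.inv (sub_ne_zero.2 hy.1)).smul (upd_an k hg hy.2)
    · intro x hx t ht
      rw [mem_sphere_zero_iff_norm] at ht
      refine ⟨?_, upd_Reg hx.1 (by linarith) (by linarith)⟩
      intro h
      have h2 : ‖x.1 k‖ < 1 := hx.2
      simp only at h
      rw [← h, ht] at h2
      linarith
  have hagree : ∀ x ∈ Reg m n T e, 3/4 < ‖x.1 k‖ → ‖x.1 k‖ < 1 → tpi⁻¹ • C1 x = g x := by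
    intro x hx h1 h2
    have h3 := cauchy_annulus (g := fun t => g (upd k (t, x))) (r := 3/4) (R := 1)
      (A := {t | upd k (t, x) ∈ Reg m n S e})
      ((isOpen_Reg S e).preimage ((upd_diff k).continuous.comp (by fun_prop : Continuous fun t : ℂ => (t, x))))
      (by norm_num) (fun t ht => ?_) (fun t ht => ?_) h1 h2 (hk' _ h1 x hx)
    · simp only [hC1]
      rw [h3, upd_self, smul_smul, inv_mul_cancel₀ tpi_ne, one_smul]
    · have h4 := ht.1
      have h5 := ht.2
      rw [mem_closedBall_zero_iff] at h4
      rw [mem_ball_zero_iff, not_lt] at h5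
      exact upd_Reg hx (by linarith) (by linarith)
    · refine DifferentiableAt.differentiableWithinAt ?_
      exact DifferentiableAt.comp (g := fun y => g (upd k y)) (f := fun t : ℂ => (t, x)) t (upd_an k hg ht)
        (by fun_prop)
  set g' : Ev m × Pm n → F := fun x => if ‖x.1 k‖ < 1 then tpi⁻¹ • C1 x else g x with hg'
  have hRS : ∀ x ∈ Reg m n T e, 3/4 < ‖x.1 k‖ → x ∈ Reg m n S e := by
    intro x hx h1
    rw [← upd_self k x]
    exact upd_Reg hx (by linarith) (Reg_lt hx k)
  have hout : ∀ x ∈ Reg m n T e, 3/4 < ‖x.1 k‖ → g' x = g x := by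
    intro x hx h1
    simp only [hg']
    split_ifs with h
    · exact hagree x hx h1 h
    · rfl
  have hg'an : AnalyticOnNhd ℂ g' (Reg m n T e) := by
    intro x hx
    by_cases h : ‖x.1 k‖ < 1
    · have h1 : AnalyticAt ℂ (fun x => tpi⁻¹ • C1 x) x := (hC1an x ⟨hx, h⟩).const_smul
      refine h1.congr (Filter.eventuallyEq_of_mem (hVo.mem_nhds ⟨hx, h⟩) fun y hy => ?_)
      have : ‖y.1 k‖ < 1 := hy.2
      simp only [hg']
      rw [if_pos this]
    · have h2 : 3/4 < ‖x.1 k‖ := by linarith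
      have hO : IsOpen (Reg m n T e ∩ {x | 3/4 < ‖x.1 k‖}) :=
        (isOpen_Reg T e).inter (isOpen_lt continuous_const (by fun_prop))
      exact (hg x (hRS x hx h2)).congr (Filter.eventuallyEq_of_mem (hO.mem_nhds ⟨hx, h2⟩) fun y hy =>
        (hout y hy.1 hy.2).symm)
  refine ⟨g', hg'an, ?_⟩
  refine (hg'an.mono hST).eqOn_of_preconnected_of_eventuallyEq hg (preconn_Reg S e) (one_mem_Reg S he) ?_
  have hO : IsOpen (Reg m n S e ∩ {x | 3/4 < ‖x.1 k‖}) :=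
    (isOpen_Reg S e).inter (isOpen_lt continuous_const (by fun_prop))
  refine Filter.eventuallyEq_of_mem (hO.mem_nhds ⟨one_mem_Reg S he, ?_⟩) fun y hy => hout y (hST hy.1) hy.2
  simp
  norm_num

theorem ext_all {e : ℝ} (he : 0 < e) {a : Ev m × Pm n → F}
    (ha : AnalyticOnNhd ℂ a (Reg m n ∅ e))
    (hk : ∀ k, ∀ x ∈ Reg m n ∅ e, ∀ z : ℂ, 3/4 < ‖z‖ → (∮ t in C(0, 3/4), (t - z)⁻¹ • a (upd k (t, x))) = 0) :
    ∃ g : Ev m × Pm n → F, AnalyticOnNhd ℂ g (Reg m n univ e) ∧ EqOn g a (Reg m n ∅ e) := by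
  classical
  have key : ∀ S : Finset (Fin m), ∃ g : Ev m × Pm n → F, AnalyticOnNhd ℂ g (Reg m n (S : Set (Fin m)) e) ∧
      EqOn g a (Reg m n ∅ e) := by
    intro S
    induction S using Finset.induction_on with
    | empty => exact ⟨a, by simpa using ha, fun _ _ => rfl⟩
    | insert k S _ ih =>
      obtain ⟨g, hg, hga⟩ := ih
      obtain ⟨g', hg', hgg⟩ := ext_step (k := k) he hg (fun x hx z hz => by
        rw [← hk k x hx z hz]
        refine circleIntegral.integral_congr (by norm_num) fun t ht => ?_
        rw [mem_sphere_zero_iff_norm] at ht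
        rw [hga (upd_Reg (Reg_mono (empty_subset _) le_rfl hx) (by linarith) (by linarith))])
      refine ⟨g', by simpa using hg', fun x hx => ?_⟩
      rw [hgg (Reg_mono (empty_subset _) le_rfl hx), hga hx]
  simpa using key Finset.univ

end

end Rig

end

section
open scoped BigOperators
open MeasureTheory Set Filter Topology Metric Asymptotics

namespace Rig

noncomputable section
variable {m p n q : ℕ} {F : Type*} [NormedAddCommGroup F] [NormedSpace ℂ F] [CompleteSpace F]

def ek (k : Fin m) : Ev m × Pm n := (Pi.single k 1, 0)

def Ic (k : Fin m) (g : Ev m × Pm n → F) (x : Ev m × Pm n) : F := ∮ t in C(0, 3/4), g (upd k (t, x))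

theorem upd_line (k : Fin m) (x : Ev m × Pm n) (t : ℂ) :
    HasDerivAt (fun t : ℂ => upd k (t, x)) (ek k) t := by
  have h1 : HasFDerivAt (fun t : ℂ => upd k (t, x)) ((updL k).comp (ContinuousLinearMap.inl ℂ ℂ (Ev m × Pm n))) t :=
    HasFDerivAt.comp (g := upd k) (f := fun t : ℂ => (t, x)) t (upd_hasFDerivAt k (t, x)) (hasFDerivAt_prodMk_left t x)
  have h2 := h1.hasDerivAt
  convert h2 using 1
  rw [ContinuousLinearMap.comp_apply, ContinuousLinearMap.inl_apply, updL_apply]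
  rfl

theorem Ic_int {k : Fin m} {A : Set (Ev m × Pm n)} {g : Ev m × Pm n → F} (hg : ContinuousOn g A)
    {x : Ev m × Pm n} (hx : ∀ t ∈ sphere (0:ℂ) (3/4), upd k (t, x) ∈ A) :
    CircleIntegrable (fun t => g (upd k (t, x))) 0 (3/4) := by
  refine ContinuousOn.circleIntegrable (by norm_num) (hg.comp ?_ hx)
  exact ((upd_diff k).continuous.comp (by fun_prop : Continuous fun t : ℂ => (t, x))).continuousOn

theorem Ic_congr {k : Fin m} {A : Set (Ev m × Pm n)} {g h : Ev m × Pm n → F} (hg : EqOn g h A)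
    {x : Ev m × Pm n} (hx : ∀ t ∈ sphere (0:ℂ) (3/4), upd k (t, x) ∈ A) : Ic k g x = Ic k h x :=
  circleIntegral.integral_congr (by norm_num) fun t ht => hg (hx t ht)

theorem Ic_ek {k : Fin m} {A : Set (Ev m × Pm n)} {g : Ev m × Pm n → F} (hg : AnalyticOnNhd ℂ g A)
    {x : Ev m × Pm n} (hx : ∀ t ∈ sphere (0:ℂ) (3/4), upd k (t, x) ∈ A) :
    Ic k (fun y => fderiv ℂ g y (ek k)) x = 0 := by
  refine circleIntegral.integral_eq_zero_of_hasDerivWithinAt (f := fun t => g (upd k (t, x))) (by norm_num)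
    fun t ht => HasDerivAt.hasDerivWithinAt ?_
  exact HasFDerivAt.comp_hasDerivAt (f := fun t : ℂ => upd k (t, x)) t (hg _ (hx t ht)).differentiableAt.hasFDerivAt (upd_line k x t)

theorem Ic_an {k : Fin m} {A B : Set (Ev m × Pm n)} (hA : IsOpen A) (hB : IsOpen B)
    (hAB : ∀ x ∈ B, ∀ t ∈ sphere (0:ℂ) (3/4), upd k (t, x) ∈ A)
    {g : Ev m × Pm n → F} (hg : AnalyticOnNhd ℂ g A) :
    AnalyticOnNhd ℂ (Ic k g) B ∧ ∀ x ∈ B, ∀ d, fderiv ℂ (Ic k g) x d = Ic k (fun y => fderiv ℂ g y d) x := by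
  have hΩ : IsOpen (upd k ⁻¹' A : Set (ℂ × (Ev m × Pm n))) := hA.preimage (upd_diff k).continuous
  have hK : ∀ y : ℂ × (Ev m × Pm n), upd k y ∈ A → HasFDerivAt (fun y => g (upd k y))
      ((fderiv ℂ g (upd k y)).comp (updL k)) y := fun y hy =>
    HasFDerivAt.comp (g := g) (f := upd k) y (hg _ hy).differentiableAt.hasFDerivAt (upd_hasFDerivAt k y)
  obtain ⟨h1, h2⟩ := circ_param (r := 3/4) (by norm_num) hΩ (K := fun y => g (upd k y))
    (analytic_of_diff hΩ fun y hy => (hK y hy).differentiableAt.differentiableWithinAt) hB hAB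
  refine ⟨h1, fun x hx d => ?_⟩
  have h3 : fderiv ℂ (Ic k g) x d = Ic k (fun y => fderiv ℂ g y (kil k d)) x := by
    refine (h2 x hx d).trans ?_
    refine circleIntegral.integral_congr (by norm_num) fun t ht => ?_
    show fderiv ℂ (fun y => g (upd k y)) (t, x) (0, d) = _
    rw [(hK (t, x) (hAB x hx t ht)).fderiv]
    rfl
  have h4 : ∀ y, fderiv ℂ g y d = fderiv ℂ g y (kil k d) + (d.1 k) • fderiv ℂ g y (ek k) := by
    intro y
    rw [← map_smul, ← map_add]
    congr 1
    refine Prod.ext ?_ (by simp [kil, ek])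
    ext l
    by_cases h : l = k
    · subst h; simp [kil, ek]
    · simp [kil, ek, h]
  have hc : ∀ d, ContinuousOn (fun y => fderiv ℂ g y d) A := fun d y hy =>
    (((hg.fderiv y hy).continuousAt).clm_apply continuousAt_const).continuousWithinAt
  rw [h3]
  have h5 : Ic k (fun y => fderiv ℂ g y d) x = Ic k (fun y => fderiv ℂ g y (kil k d)) x +
      (d.1 k) • Ic k (fun y => fderiv ℂ g y (ek k)) x := by
    unfold Ic
    rw [← circleIntegral.integral_smul, ← circleIntegral.integral_add (Ic_int (hc _) (hAB x hx))
      (Ic_int (g := fun y => (d.1 k) • fderiv ℂ g y (ek k)) ((hc _).const_smul _) (hAB x hx))]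
    simp only [h4]
  rw [h5, Ic_ek hg (hAB x hx), smul_zero, add_zero]

/-- primitive in the k-th direction -/
theorem prim {k : Fin m} {D : Set (Ev m × Pm n)} (hD : IsOpen D)
    (hst : ∀ x ∈ D, ∀ u ∈ Icc (0:ℝ) 1, upd k ((u:ℂ) * x.1 k, x) ∈ D) {h : Ev m × Pm n → ℂ} (hh : AnalyticOnNhd ℂ h D) :
    ∃ g : Ev m × Pm n → ℂ, AnalyticOnNhd ℂ g D ∧ ∀ x ∈ D, g x + x.1 k * fderiv ℂ g x (ek k) = h x := by
  set c : ℂ × (Ev m × Pm n) → Ev m × Pm n := fun y => upd k (y.1 * y.2.1 k, y.2) with hc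
  have hcd : Differentiable ℂ c := fun y =>
    DifferentiableAt.comp (g := upd k) (f := fun y : ℂ × (Ev m × Pm n) => (y.1 * y.2.1 k, y.2)) y (upd_diff k _) (by fun_prop)
  have hΩ : IsOpen (c ⁻¹' D) := hD.preimage hcd.continuous
  have hKd : ∀ y ∈ c ⁻¹' D, DifferentiableAt ℂ (fun y => h (c y)) y := fun y hy =>
    DifferentiableAt.comp (g := h) (f := c) y (hh _ hy).differentiableAt (hcd y)
  have hK : AnalyticOnNhd ℂ (fun y => h (c y)) (c ⁻¹' D) := analytic_of_diff hΩ fun y hy =>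
    (hKd y hy).differentiableWithinAt
  have hDt : D ⊆ tube (c ⁻¹' D) := fun x hx u hu => hst x hx u hu
  refine ⟨fun x => ∫ u in (0:ℝ)..1, h (c ((u:ℂ), x)), (paramInt_analytic hΩ hK).mono hDt, fun x hx => ?_⟩
  rw [paramInt_fderiv hΩ hK (hDt hx)]
  have e1 : ∀ u ∈ Icc (0:ℝ) 1, fderiv ℂ (fun y => h (c y)) ((u:ℂ), x) (0, ek k) =
      (u:ℂ) * fderiv ℂ h (c ((u:ℂ), x)) (ek k) := by
    intro u hu
    have h1 : HasDerivAt (fun t : ℂ => ((u:ℂ), x + t • ek k)) ((0, ek k) : ℂ × (Ev m × Pm n)) 0 := by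
      refine HasDerivAt.prodMk (hasDerivAt_const _ _) ?_
      simpa using ((hasDerivAt_id (0:ℂ)).smul_const (ek k : Ev m × Pm n)).const_add x
    have h2 : HasDerivAt (fun t : ℂ => h (c ((u:ℂ), x + t • ek k)))
        (fderiv ℂ (fun y => h (c y)) ((u:ℂ), x) (0, ek k)) 0 := by
      refine HasFDerivAt.comp_hasDerivAt_of_eq (l := fun y => h (c y)) (f := fun t : ℂ => ((u:ℂ), x + t • ek k)) 0
        (hKd ((u:ℂ), x) (hst x hx u hu)).hasFDerivAt h1 (by simp)
    have h3 : ∀ t : ℂ, c ((u:ℂ), x + t • ek k) = upd k ((u:ℂ) * (x.1 k + t), x) := by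
      intro t
      refine Prod.ext ?_ (by simp [hc, upd, ek])
      ext l
      by_cases h : l = k
      · subst h; simp [hc, upd, ek]
      · simp [hc, upd, ek, h]
    have h4 : HasDerivAt (fun t : ℂ => h (c ((u:ℂ), x + t • ek k))) ((u:ℂ) • fderiv ℂ h (c ((u:ℂ), x)) (ek k)) 0 := by
      simp only [h3]
      rw [← map_smul]
      refine HasFDerivAt.comp_hasDerivAt_of_eq (f := fun t : ℂ => upd k ((u:ℂ) * (x.1 k + t), x)) 0
        (hh _ (hst x hx u hu)).differentiableAt.hasFDerivAt ?_ (by simp)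
      have h5 : HasDerivAt (fun t : ℂ => (u:ℂ) * (x.1 k + t)) (u:ℂ) 0 := by
        simpa using ((hasDerivAt_id (0:ℂ)).const_add (x.1 k)).const_mul (u:ℂ)
      exact HasDerivAt.scomp (h := fun t : ℂ => (u:ℂ) * (x.1 k + t)) 0 (upd_line k x _) h5
    exact h2.unique h4
  have hd : ∀ u ∈ Icc (0:ℝ) 1, HasDerivAt (fun u : ℝ => (u:ℂ) * h (c ((u:ℂ), x)))
      (h (c ((u:ℂ), x)) + x.1 k * ((u:ℂ) * fderiv ℂ h (c ((u:ℂ), x)) (ek k))) u := by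
    intro u hu
    have h6 : HasDerivAt (fun t : ℂ => h (c (t, x))) (x.1 k • fderiv ℂ h (c ((u:ℂ), x)) (ek k)) (u:ℂ) := by
      rw [← map_smul]
      refine HasFDerivAt.comp_hasDerivAt (f := fun t : ℂ => c (t, x)) (u:ℂ)
        (hh _ (hst x hx u hu)).differentiableAt.hasFDerivAt ?_
      have h5 : HasDerivAt (fun t : ℂ => t * x.1 k) (x.1 k) (u:ℂ) := by
        simpa using (hasDerivAt_id (u:ℂ)).mul_const (x.1 k)
      exact HasDerivAt.scomp (h := fun t : ℂ => t * x.1 k) (u:ℂ) (upd_line k x _) h5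
    have h7 := ((hasDerivAt_id (u:ℂ)).mul h6).comp_ofReal
    refine HasDerivAt.congr_deriv h7 ?_
    simp only [smul_eq_mul, id_eq]; ring
  have hcont1 : ContinuousOn (fun u : ℝ => h (c ((u:ℂ), x))) (Icc 0 1) := by
    intro u hu
    have : ContinuousAt (fun y => h (c y)) ((u:ℂ), x) := (hKd _ (hst x hx u hu)).continuousAt
    exact (ContinuousAt.comp (f := fun u : ℝ => ((u:ℂ), x)) this (by fun_prop)).continuousWithinAt
  have hcont2 : ContinuousOn (fun u : ℝ => (u:ℂ) * fderiv ℂ h (c ((u:ℂ), x)) (ek k)) (Icc 0 1) := by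
    intro u hu
    have h8 : ContinuousAt (fun y => fderiv ℂ h y (ek k)) (c ((u:ℂ), x)) :=
      ((hh.fderiv _ (hst x hx u hu)).continuousAt).clm_apply continuousAt_const
    have h9 : ContinuousAt (fun u : ℝ => c ((u:ℂ), x)) u :=
      (hcd.continuous.comp (by fun_prop : Continuous fun u : ℝ => ((u:ℂ), x))).continuousAt
    exact ((Complex.continuous_ofReal.continuousAt).mul (ContinuousAt.comp (f := fun u : ℝ => c ((u:ℂ), x)) h8 h9)).continuousWithinAt
  have i1 : IntervalIntegrable (fun u : ℝ => h (c ((u:ℂ), x))) volume 0 1 :=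
    ContinuousOn.intervalIntegrable (by rwa [uIcc_of_le zero_le_one])
  have i2 : IntervalIntegrable (fun u : ℝ => (u:ℂ) * fderiv ℂ h (c ((u:ℂ), x)) (ek k)) volume 0 1 :=
    ContinuousOn.intervalIntegrable (by rwa [uIcc_of_le zero_le_one])
  have h10 := intervalIntegral.integral_eq_sub_of_hasDerivAt (a := 0) (b := 1)
    (f := fun u : ℝ => (u:ℂ) * h (c ((u:ℂ), x))) (by rw [uIcc_of_le zero_le_one]; exact hd) (i1.add (i2.const_mul _))
  rw [intervalIntegral.integral_add i1 (i2.const_mul _), intervalIntegral.integral_const_mul] at h10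
  have h11 : (∫ u in (0:ℝ)..1, fderiv ℂ (fun y => h (c y)) ((u:ℂ), x) (0, ek k)) =
      ∫ u in (0:ℝ)..1, (u:ℂ) * fderiv ℂ h (c ((u:ℂ), x)) (ek k) :=
    intervalIntegral.integral_congr fun u hu => by rw [uIcc_of_le zero_le_one] at hu; exact e1 u hu
  rw [h11]
  refine h10.trans ?_
  simp [hc, upd_self]

end

end Rig

end

section
open scoped BigOperators
open MeasureTheory Set Filter Topology Metric Asymptotics

namespace Rig

noncomputable section
variable {m p n q : ℕ} {F : Type*} [NormedAddCommGroup F] [NormedSpace ℂ F] [CompleteSpace F]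

theorem ck_step {k : Fin m} {A B D : Set (Ev m × Pm n)} (hA : IsOpen A) (hB : IsOpen B) (hD : IsOpen D) (hAD : A ⊆ D)
    (hAB : ∀ x ∈ B, ∀ t ∈ sphere (0:ℂ) (3/4), upd k (t, x) ∈ A)
    (hst : ∀ x ∈ D, ∀ u ∈ Icc (0:ℝ) 1, upd k ((u:ℂ) * x.1 k, x) ∈ D)
    {a : Ev m × Pm n → F} (ha : AnalyticOnNhd ℂ a A) {R : Ev m × Pm n → Ev m} (hR : AnalyticOnNhd ℂ R D)
    (hu : ∀ x ∈ A, fderiv ℂ a x (x.1 k • Pi.single k 1 + x.2.1 • R x, 0) = 0) (N : ℕ) :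
    ∀ h : Ev m × Pm n → ℂ, AnalyticOnNhd ℂ h D → ∃ c : Ev m × Pm n → F, AnalyticOnNhd ℂ c B ∧
      ∀ x ∈ B, Ic k (fun y => h y • a y) x = x.2.1 ^ N • c x := by
  induction N with
  | zero =>
    intro h hh
    refine ⟨_, (Ic_an hA hB hAB (g := fun y => h y • a y) ((hh.mono hAD).smul ha)).1, by simp⟩
  | succ N ih =>
    intro h hh
    obtain ⟨g, hg, hgh⟩ := prim hD hst hh
    have hRl : ∀ l, AnalyticOnNhd ℂ (fun y => R y l) D := fun l =>
      analytic_of_diff hD fun y hy => by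
        have := (hR y hy).differentiableAt
        exact DifferentiableAt.differentiableWithinAt (by fun_prop)
    have hgR : ∀ l, AnalyticOnNhd ℂ (fun y => g y * R y l) D := fun l => hg.mul (hRl l)
    have hgR' : ∀ l, AnalyticOnNhd ℂ (fun y => fderiv ℂ (fun y => g y * R y l) y (ek l)) D := fun l =>
      analytic_of_diff hD fun y hy => by
        have := ((hgR l).fderiv y hy).differentiableAt
        exact DifferentiableAt.differentiableWithinAt (this.clm_apply (by fun_prop))
    choose c1 hc1 hc1e using fun l => ih _ (hgR l)
    choose c2 hc2 hc2e using fun l => ih _ (hgR' l)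
    have hxg : AnalyticOnNhd ℂ (fun y : Ev m × Pm n => y.1 k * g y) D := analytic_of_diff hD fun y hy => by
      have := (hg y hy).differentiableAt
      exact DifferentiableAt.differentiableWithinAt (by fun_prop)
    have hpt : ∀ y ∈ A, h y • a y = fderiv ℂ (fun y => (y.1 k * g y) • a y) y (ek k) +
        y.2.1 • ∑ l, (fderiv ℂ (fun y => (g y * R y l) • a y) y (ek l) -
          fderiv ℂ (fun y => g y * R y l) y (ek l) • a y) := by
      intro y hy
      have hy' := hAD hy
      have e0 := hu y hy
      have e1 : ((y.1 k • Pi.single k 1 + y.2.1 • R y, 0) : Ev m × Pm n) = y.1 k • ek k + y.2.1 • ∑ l, R y l • ek l := by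
        refine Prod.ext ?_ ?_
        · ext i
          simp [ek, Prod.fst_sum, Finset.sum_apply, Pi.single_apply]
        · simp [ek, Prod.snd_sum]
      rw [e1, map_add, map_smul, map_smul, map_sum] at e0
      simp only [map_smul] at e0
      have had := (ha y hy).differentiableAt
      have e2 : fderiv ℂ (fun y => (y.1 k * g y) • a y) y (ek k) = h y • a y + (y.1 k * g y) • fderiv ℂ a y (ek k) := by
        rw [fderiv_fun_smul (hxg y hy').differentiableAt had]
        have e3 : fderiv ℂ (fun y : Ev m × Pm n => y.1 k * g y) y (ek k) = h y := by
          rw [← hgh y hy', fderiv_fun_mul (by fun_prop) (hg y hy').differentiableAt]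
          have e4 : HasFDerivAt (fun y : Ev m × Pm n => y.1 k)
            ((ContinuousLinearMap.proj k).comp (ContinuousLinearMap.fst ℂ (Ev m) (Pm n))) y :=
            ((ContinuousLinearMap.proj (R := ℂ) (φ := fun _ : Fin m => ℂ) k).comp (ContinuousLinearMap.fst ℂ (Ev m) (Pm n))).hasFDerivAt
          rw [e4.fderiv]
          simp [ek]
          ring
        simp [e3]
        abel
      have e5 : ∀ l, fderiv ℂ (fun y => (g y * R y l) • a y) y (ek l) -
          fderiv ℂ (fun y => g y * R y l) y (ek l) • a y = g y • R y l • fderiv ℂ a y (ek l) := by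
        intro l
        rw [fderiv_fun_smul (hgR l y hy').differentiableAt had]
        simp [smul_smul]
      rw [e2]
      simp only [e5]
      rw [← Finset.smul_sum, add_assoc, mul_comm, ← smul_smul, smul_comm (y.2.1) (g y), ← smul_add, e0]
      simp
    refine ⟨fun x => ∑ l, (fderiv ℂ (c1 l) x (ek l) - c2 l x), analytic_of_diff hB fun x hx => ?_, fun x hx => ?_⟩
    · refine DifferentiableAt.differentiableWithinAt ?_
      refine DifferentiableAt.fun_sum fun l _ => DifferentiableAt.sub ?_ (hc2 l x hx).differentiableAt
      exact (((hc1 l).fderiv x hx).differentiableAt).clm_apply (by fun_prop)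
    · have hcA : ∀ l, AnalyticOnNhd ℂ (fun y => (g y * R y l) • a y) A := fun l => ((hgR l).mono hAD).smul ha
      have hcd : ∀ {f : Ev m × Pm n → F}, AnalyticOnNhd ℂ f A → ∀ d, ContinuousOn (fun y => fderiv ℂ f y d) A :=
        fun hf d y hy => (((hf.fderiv y hy).continuousAt).clm_apply continuousAt_const).continuousWithinAt
      have i1 : ∀ l, CircleIntegrable (fun t => (fun y => fderiv ℂ (fun y => (g y * R y l) • a y) y (ek l)) (upd k (t, x))) 0 (3/4) :=
        fun l => Ic_int (hcd (hcA l) _) (hAB x hx)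
      have i2 : ∀ l, CircleIntegrable (fun t => (fun y => fderiv ℂ (fun y => g y * R y l) y (ek l) • a y) (upd k (t, x))) 0 (3/4) :=
        fun l => Ic_int (((hgR' l).mono hAD).smul ha).continuousOn (hAB x hx)
      have hxa : AnalyticOnNhd ℂ (fun y : Ev m × Pm n => (y.1 k * g y) • a y) A := (hxg.mono hAD).smul ha
      have f1 : Ic k (fun y => h y • a y) x = Ic k (fun y => fderiv ℂ (fun y => (y.1 k * g y) • a y) y (ek k)) x +
          x.2.1 • ∑ l, (Ic k (fun y => fderiv ℂ (fun y => (g y * R y l) • a y) y (ek l)) x -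
            Ic k (fun y => fderiv ℂ (fun y => g y * R y l) y (ek l) • a y) x) := by
        have f2 : ∀ l, (Ic k (fun y => fderiv ℂ (fun y => (g y * R y l) • a y) y (ek l)) x -
            Ic k (fun y => fderiv ℂ (fun y => g y * R y l) y (ek l) • a y) x) =
            ∮ t in C(0, 3/4), (fun y => fderiv ℂ (fun y => (g y * R y l) • a y) y (ek l) -
              fderiv ℂ (fun y => g y * R y l) y (ek l) • a y) (upd k (t, x)) := by
          intro l
          unfold Ic
          rw [← circleIntegral.integral_sub (i1 l) (i2 l)]
        simp only [f2]
        have i3 : ∀ l, CircleIntegrable (fun t => (fun y => fderiv ℂ (fun y => (g y * R y l) • a y) y (ek l) -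
              fderiv ℂ (fun y => g y * R y l) y (ek l) • a y) (upd k (t, x))) 0 (3/4) := fun l => (i1 l).sub (i2 l)
        rw [← circleIntegral.integral_fun_sum (fun l _ => i3 l), ← circleIntegral.integral_smul]
        unfold Ic
        rw [← circleIntegral.integral_add]
        · refine circleIntegral.integral_congr (by norm_num) fun t ht => ?_
          exact hpt _ (hAB x hx t ht)
        · exact Ic_int (hcd hxa _) (hAB x hx)
        · refine Ic_int (g := fun y => x.2.1 • ∑ l, (fderiv ℂ (fun y => (g y * R y l) • a y) y (ek l) -
            fderiv ℂ (fun y => g y * R y l) y (ek l) • a y)) (A := A) ?_ (hAB x hx)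
          refine ContinuousOn.const_smul (continuousOn_finsetSum _ fun l _ => ?_) _
          exact (hcd (hcA l) _).sub (((hgR' l).mono hAD).smul ha).continuousOn
      rw [f1, Ic_ek hxa (hAB x hx), zero_add, pow_succ', mul_smul, Finset.smul_sum (r := x.2.1 ^ N)]
      congr 1
      refine Finset.sum_congr rfl fun l _ => ?_
      rw [smul_sub, ← hc2e l x hx, ← (Ic_an hA hB hAB (hcA l)).2 x hx]
      congr 1
      have f3 : Ic k (fun y => (g y * R y l) • a y) =ᶠ[𝓝 x] fun x => x.2.1 ^ N • c1 l x :=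
        Filter.eventuallyEq_of_mem (hB.mem_nhds hx) (hc1e l)
      rw [f3.fderiv_eq, fderiv_fun_smul (by fun_prop) (hc1 l x hx).differentiableAt]
      have f4 : HasFDerivAt (fun y : Ev m × Pm n => y.2.1)
            ((ContinuousLinearMap.fst ℂ ℂ (Fin n → ℂ)).comp (ContinuousLinearMap.snd ℂ (Ev m) (Pm n))) x :=
            ((ContinuousLinearMap.fst ℂ ℂ (Fin n → ℂ)).comp (ContinuousLinearMap.snd ℂ (Ev m) (Pm n))).hasFDerivAt
      have f5 := (f4.pow N).fderiv
      simp only [ContinuousLinearMap.add_apply, ContinuousLinearMap.smul_apply, ContinuousLinearMap.smulRight_apply]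
      have f6 : fderiv ℂ (fun y : Ev m × Pm n => y.2.1 ^ N) x (ek l) = 0 := by
        rw [f5]
        simp [ek]
      rw [f6]
      simp

theorem flat_zero {e : ℝ} {f : ℂ → F} (hf : AnalyticOnNhd ℂ f (ball 0 e))
    (h : ∀ N : ℕ, ∃ c : ℂ → F, AnalyticOnNhd ℂ c (ball 0 e) ∧ ∀ x ∈ ball (0:ℂ) e, f x = x ^ N • c x) :
    ∀ x ∈ ball (0:ℂ) e, f x = 0 := by
  intro x hx
  have he : 0 < e := pos_of_mem_ball hx
  refine hf.eqOn_zero_of_preconnected_of_eventuallyEq_zero (convex_ball 0 e).isPreconnected (mem_ball_self he) ?_ hx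
  by_contra hne
  obtain ⟨N, g, hg, hg0, hfg⟩ := (hf 0 (mem_ball_self he)).exists_eventuallyEq_pow_smul_nonzero_iff.2 hne
  obtain ⟨c, hc, hfc⟩ := h (N+1)
  apply hg0
  have h1 : g =ᶠ[𝓝[≠] 0] fun z => z • c z := by
    have h2 : ∀ᶠ z in 𝓝[≠] (0:ℂ), z ∈ ball (0:ℂ) e := mem_nhdsWithin_of_mem_nhds (isOpen_ball.mem_nhds (mem_ball_self he))
    filter_upwards [hfg.filter_mono nhdsWithin_le_nhds, h2, self_mem_nhdsWithin] with z h3 h4 h5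
    rw [hfc z h4, sub_zero, pow_succ, mul_smul] at h3
    exact (smul_right_injective F (pow_ne_zero N h5) h3).symm
  have h3 : Tendsto g (𝓝[≠] 0) (𝓝 (g 0)) := hg.continuousAt.tendsto.mono_left nhdsWithin_le_nhds
  have h4 : Tendsto (fun z : ℂ => z • c z) (𝓝[≠] 0) (𝓝 ((0:ℂ) • c 0)) :=
    (continuousAt_id.smul (hc 0 (mem_ball_self he)).continuousAt).tendsto.mono_left nhdsWithin_le_nhds
  rw [zero_smul] at h4
  exact tendsto_nhds_unique (h3.congr' h1) h4

theorem ck_main {k : Fin m} {e : ℝ} {a : Ev m × Pm n → F} (ha : AnalyticOnNhd ℂ a (Reg m n ∅ e))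
    {R : Ev m × Pm n → Ev m} (hR : AnalyticOnNhd ℂ R (Reg m n {k} e))
    (hu : ∀ x ∈ Reg m n ∅ e, fderiv ℂ a x (x.1 k • Pi.single k 1 + x.2.1 • R x, 0) = 0) {x : Ev m × Pm n}
    (hx : x ∈ Reg m n ∅ e) {z : ℂ} (hz : 3/4 < ‖z‖) :
    (∮ t in C(0, 3/4), (t - z)⁻¹ • a (upd k (t, x))) = 0 := by
  set P : Set (Ev m × Pm n) := {y | ‖y.1 k‖ < ‖z‖} with hP
  have hPo : IsOpen P := isOpen_lt (by fun_prop) continuous_const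
  have hx' : x ∈ Reg m n {k} e := Reg_mono (empty_subset _) le_rfl hx
  have hh : AnalyticOnNhd ℂ (fun y : Ev m × Pm n => (y.1 k - z)⁻¹) (Reg m n {k} e ∩ P) :=
    analytic_of_diff ((isOpen_Reg _ _).inter hPo) fun y hy => by
      have h7 : DifferentiableAt ℂ (fun y : Ev m × Pm n => y.1 k - z) y := by fun_prop
      refine (h7.inv (sub_ne_zero.2 ?_)).differentiableWithinAt
      intro h
      have h8 : ‖y.1 k‖ < ‖z‖ := hy.2
      rw [h] at h8
      exact lt_irrefl _ h8
  have hA : IsOpen (Reg m n ∅ e ∩ P) := (isOpen_Reg ∅ e).inter hPo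
  have hAB : ∀ x ∈ Reg m n {k} e, ∀ t ∈ sphere (0:ℂ) (3/4), upd k (t, x) ∈ Reg m n ∅ e ∩ P := by
    intro x hx t ht
    rw [mem_sphere_zero_iff_norm] at ht
    refine ⟨upd_Reg (by simpa using hx) (by linarith) (by linarith), ?_⟩
    show ‖(upd k (t, x)).1 k‖ < ‖z‖
    rw [upd_k, ht]; exact hz
  have hAD : Reg m n ∅ e ∩ P ⊆ Reg m n {k} e ∩ P := inter_subset_inter_left _ (Reg_mono (empty_subset _) le_rfl)
  have key := ck_step (B := Reg m n {k} e) hA (isOpen_Reg _ _) ((isOpen_Reg {k} e).inter hPo) hAD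
    hAB (by
      intro y hy u hu
      have h1 : ‖(u:ℂ) * y.1 k‖ ≤ ‖y.1 k‖ := by
        rw [norm_mul, Complex.norm_real, Real.norm_eq_abs, abs_of_nonneg hu.1]
        exact mul_le_of_le_one_left (norm_nonneg _) hu.2
      refine ⟨Reg_mk (fun l => ?_) (fun l hl => ?_) (Reg_e (x := y) hy.1), ?_⟩
      · by_cases h : l = k
        · subst h; rw [upd_k]; exact h1.trans_lt (Reg_lt hy.1 _)
        · rw [upd_ne h]; exact Reg_lt hy.1 _
      · rw [upd_ne (by simpa using hl)]; exact Reg_gt hy.1 hl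
      · show ‖(upd k _).1 k‖ < ‖z‖
        rw [upd_k]; exact h1.trans_lt hy.2)
    (ha.mono inter_subset_left) (hR.mono inter_subset_left) (fun y hy => hu y hy.1)
  have hI := (Ic_an hA (isOpen_Reg {k} e) hAB (g := fun y => (y.1 k - z)⁻¹ • a y)
    ((hh.mono hAD).smul (ha.mono inter_subset_left))).1
  have hxe : ‖x.2‖ < e := by simpa using Reg_e (x := x) hx
  have hmem : ∀ s ∈ ball (0:ℂ) e, (x.1, (s, x.2.2)) ∈ Reg m n {k} e := by
    intro s hs
    refine Reg_mk (fun l => Reg_lt (x := x) hx' l) (fun l hl => Reg_gt (x := x) hx' hl) ?_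
    rw [mem_ball_zero_iff] at hs ⊢
    exact max_lt hs ((le_max_right _ _).trans_lt hxe)
  have hcomp : ∀ {f : Ev m × Pm n → F}, AnalyticOnNhd ℂ f (Reg m n {k} e) →
      AnalyticOnNhd ℂ (fun s : ℂ => f (x.1, (s, x.2.2))) (ball 0 e) := fun {f} hf =>
    analytic_of_diff isOpen_ball fun s hs => (DifferentiableAt.comp (g := f) (f := fun s : ℂ => (x.1, (s, x.2.2))) s
      (hf _ (hmem s hs)).differentiableAt (by fun_prop)).differentiableWithinAt
  have h0 := flat_zero (hcomp hI) (fun N => by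
    obtain ⟨c, hc, hce⟩ := key N _ hh
    exact ⟨_, hcomp hc, fun s hs => hce _ (hmem s hs)⟩) x.2.1
    (by rw [mem_ball_zero_iff]; exact (le_max_left _ _).trans_lt hxe)
  refine Eq.trans ?_ h0
  show _ = ∮ t in C(0, 3/4), ((upd k (t, x)).1 k - z)⁻¹ • a (upd k (t, x))
  simp only [upd_k]

end

end Rig

end

section
open scoped BigOperators
open MeasureTheory Set Filter Topology Metric Asymptotics

namespace Rig

noncomputable section
variable {m p n q : ℕ}

theorem Sys.ck {w : Fin p → Fin m → ℤ} {R : Fin p → Ev m × Pm n → Ev m} {f : Fin q → Ev m × Pm n → ℂ}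
    {e0 : ℝ} {v0 : Ev m} (h : Sys w R f e0 v0) {e : ℝ} (hee : e ≤ e0) {a : Ev m × Pm n → Fin p → ℂ}
    (ha : AnalyticOnNhd ℂ a (Reg m n ∅ e))
    (hai : ∀ x ∈ Reg m n ∅ e, ∀ i, fderiv ℂ a x (Yf w R i x, 0) = 0)
    (hb : ∀ k : Fin m, (Pi.single k 1 : Ev m) ∉ Submodule.span ℂ (range (wt w)) →
        ∃ b : Ev m × Pm n → Fin p → ℂ, AnalyticOnNhd ℂ b (Reg m n {k} e) ∧ EqOn a b (Reg m n ∅ e)) (k : Fin m)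
    {x : Ev m × Pm n} (hx : x ∈ Reg m n ∅ e) {z : ℂ} (hz : 3/4 < ‖z‖) :
    (∮ t in C(0, 3/4), (t - z)⁻¹ • a (upd k (t, x))) = 0 := by
  have hx' : x ∈ Reg m n {k} e := Reg_mono (empty_subset _) le_rfl hx
  by_cases hk : (Pi.single k 1 : Ev m) ∈ Submodule.span ℂ (range (wt w))
  · rw [Submodule.mem_span_range_iff_exists_fun] at hk
    obtain ⟨c, hc⟩ := hk
    have hRD : Reg m n {k} e ⊆ Dom m n 4 e0 := (Reg_Dom hee).trans (prod_mono (ball_subset_ball (by norm_num)) le_rfl)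
    refine ck_main (R := fun y => ∑ i, c i • R i y) ha (analytic_of_diff (isOpen_Reg _ _) fun y hy => ?_) ?_ hx hz
    · refine DifferentiableAt.differentiableWithinAt ?_
      exact DifferentiableAt.fun_sum fun i _ => ((h.hR i) y (hRD hy)).differentiableAt.fun_const_smul _
    · intro y hy
      have h1 : ((y.1 k • Pi.single k 1 + y.2.1 • ∑ i, c i • R i y, 0) : Ev m × Pm n) = ∑ i, c i • (Yf w R i y, 0) := by
        refine Prod.ext ?_ (by simp [Prod.snd_sum])
        have h2 : y.1 k • (Pi.single k 1 : Ev m) = (Pi.single k 1 : Ev m) * y.1 := by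
          ext l
          by_cases hl : l = k
          · subst hl; simp
          · simp [hl]
        simp only [Prod.fst_sum, Prod.smul_fst]
        rw [h2, ← hc, Finset.sum_mul, Finset.smul_sum, ← Finset.sum_add_distrib]
        refine Finset.sum_congr rfl fun i _ => ?_
        simp only [Yf]
        rw [smul_add, smul_mul_assoc, smul_comm]
      rw [h1, map_sum]
      exact Finset.sum_eq_zero fun i _ => by rw [map_smul, hai y hy i, smul_zero]
  · obtain ⟨b, hban, hab⟩ := hb k hk
    have h1 : (∮ t in C(0, 3/4), (t - z)⁻¹ • a (upd k (t, x))) = ∮ t in C(0, 3/4), (t - z)⁻¹ • b (upd k (t, x)) := by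
      refine circleIntegral.integral_congr (by norm_num) fun t ht => ?_
      rw [mem_sphere_zero_iff_norm] at ht
      show (t - z)⁻¹ • a (upd k (t, x)) = _
      rw [hab (upd_Reg (by simpa using hx') (by linarith) (by linarith))]
    rw [h1]
    have hd : ∀ t ∈ closedBall (0:ℂ) (3/4), DifferentiableAt ℂ (fun t => (t - z)⁻¹ • b (upd k (t, x))) t := by
      intro t ht
      rw [mem_closedBall_zero_iff] at ht
      have h7 : DifferentiableAt ℂ (fun t => t - z) t := by fun_prop
      have h8 : t ≠ z := by rintro rfl; linarith
      refine (h7.inv (sub_ne_zero.2 h8)).smul ?_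
      have h9 : upd k (t, x) ∈ Reg m n {k} e := by
        refine Reg_mk (fun l => ?_) (fun l hl => ?_) (Reg_e (x := x) hx)
        · by_cases h : l = k
          · subst h; rw [upd_k]; linarith
          · rw [upd_ne h]; exact Reg_lt hx _
        · rw [upd_ne (by simpa using hl)]; exact Reg_gt hx' hl
      exact DifferentiableAt.comp (g := b) (f := fun t : ℂ => upd k (t, x)) t (hban _ h9).differentiableAt
        (upd_line k x t).differentiableAt
    exact Complex.circleIntegral_eq_zero_of_differentiable_on_off_countable (by norm_num) countable_empty
      (fun t ht => (hd t ht).continuousAt.continuousWithinAt) (fun t ht => hd t (ball_subset_closedBall ht.1))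

theorem Sys.gext {w : Fin p → Fin m → ℤ} {R : Fin p → Ev m × Pm n → Ev m} {f : Fin q → Ev m × Pm n → ℂ}
    {e0 : ℝ} {v0 : Ev m} (h : Sys w R f e0 v0) {κ e C : ℝ}
    {Ψ : Tot p m n → Ev m} (hF : IsFlow w R κ e C Ψ) (hee : e ≤ e0) (j : Fin p) :
    ∃ e' > 0, e' ≤ e ∧ ∃ a : Ev m × Pm n → Fin p → ℂ, AnalyticOnNhd ℂ a (Dom m n 1 e') ∧
      (∀ x ∈ Dom m n 1 e', (a x, x) ∈ Om p m n κ e) ∧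
      (∀ x ∈ Dom m n 1 e', Ψ (a x, x) = x.1) ∧
      (∀ x ∈ Dom m n 1 e', x.2.1 = 0 → a x = sg j) ∧
      (∀ x ∈ Dom m n 1 e', ∀ i, fderiv ℂ a x (Yf w R i x, 0) = 0) := by
  obtain ⟨e1, he1, he1e, a, haan, ham, hap, has, hai, hab⟩ := h.periods hF hee j
  obtain ⟨g, hg, hga⟩ := ext_all he1 haan (fun k x hx z hz => h.ck (he1e.trans hee) haan hai hab k hx hz)
  have hRD : Reg m n univ e1 ⊆ Dom m n 4 e0 :=
    (Reg_Dom (he1e.trans hee)).trans (prod_mono (ball_subset_ball (by norm_num)) le_rfl)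
  have hsub : Reg m n ∅ e1 ⊆ Reg m n univ e1 := Reg_mono (empty_subset _) le_rfl
  have hgi : ∀ x ∈ Reg m n univ e1, ∀ i, fderiv ℂ g x (Yf w R i x, 0) = 0 := by
    intro x hx i
    refine (Yder_an (isOpen_Reg univ e1) (fun j => (h.hR j).mono hRD) hg i).eqOn_zero_of_preconnected_of_eventuallyEq_zero
      (preconn_Reg univ e1) (one_mem_Reg univ he1) ?_ hx
    filter_upwards [(isOpen_Reg ∅ e1).mem_nhds (one_mem_Reg ∅ he1)] with y hy
    have h1 : g =ᶠ[𝓝 y] a := Filter.eventuallyEq_of_mem ((isOpen_Reg ∅ e1).mem_nhds hy) hga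
    rw [h1.fderiv_eq, hai y hy i]
    rfl
  have hmemU : ∀ {v : Ev m} {ε : Pm n}, v ∈ ball (0 : Ev m) (3/2) → ε ∈ ball (0 : Pm n) e1 → (v, ε) ∈ Reg m n univ e1 := by
    intro v ε hv hε
    refine Reg_mk (fun l => ?_) (fun l hl => absurd (mem_univ l) hl) hε
    rw [mem_ball_zero_iff] at hv
    exact (norm_le_pi_norm v l).trans_lt hv
  have hgs : ∀ x ∈ Dom m n 1 e1, x.2.1 = 0 → g x = sg j := by
    rintro ⟨v, ε⟩ ⟨hv, hε⟩ hs
    have h2 : AnalyticOnNhd ℂ (fun v : Ev m => g (v, ε)) (ball 0 (3/2)) := analytic_of_diff isOpen_ball fun v hv =>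
      (DifferentiableAt.comp (g := g) (f := fun v : Ev m => (v, ε)) v (hg _ (hmemU hv hε)).differentiableAt
        (by fun_prop)).differentiableWithinAt
    have h3 : AnalyticOnNhd ℂ (fun v : Ev m => sg j) (ball 0 (3/2)) := analyticOnNhd_const
    have h4 : ((1 : Ev m), ε) ∈ Reg m n ∅ e1 := Reg_mk (by simp; norm_num) (by simp; intros; norm_num) hε
    have h5 : (1 : Ev m) ∈ ball (0 : Ev m) (3/2) := by
      rw [mem_ball_zero_iff, pi_norm_lt_iff (by norm_num)]
      simp; norm_num
    refine h2.eqOn_of_preconnected_of_eventuallyEq h3 (convex_ball _ _).isPreconnected h5 ?_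
      (ball_subset_ball (by norm_num) hv)
    have h6 : ∀ᶠ v in 𝓝 (1 : Ev m), (v, ε) ∈ Reg m n ∅ e1 :=
      ((isOpen_Reg ∅ e1).preimage (by fun_prop : Continuous fun v : Ev m => (v, ε))).mem_nhds h4
    filter_upwards [h6] with v hv
    rw [hga hv, has _ hv hs]
  have hO : IsOpen (Reg m n univ e1 ∩ g ⁻¹' Tset p κ) :=
    hg.continuousOn.isOpen_inter_preimage (isOpen_Reg univ e1) (isOpen_Tset κ)
  have hsgT : sg j ∈ Tset p κ := by
    have hk := hF.kpos
    refine sg_ball (ρ := min 1 κ / 2) ?_ ?_ j (mem_ball_self ?_)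
    · linarith [min_le_left 1 κ]
    · linarith [min_le_right 1 κ]
    · have : 0 < min 1 κ := lt_min one_pos hk
      linarith
  have hsgO : ∀ v ∈ closedBall (0 : Ev m) 1, (v, (0 : Pm n)) ∈ Reg m n univ e1 ∩ g ⁻¹' Tset p κ := by
    intro v hv
    have h7 : (v, (0 : Pm n)) ∈ Reg m n univ e1 := hmemU (closedBall_subset_ball (by norm_num) hv) (mem_ball_self he1)
    refine ⟨h7, ?_⟩
    have hcl : ∀ v ∈ closedBall (0 : Ev m) 1, g (v, (0 : Pm n)) = sg j := by
      intro v hv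
      have h2 : ContinuousOn (fun v : Ev m => g (v, (0 : Pm n))) (closedBall 0 1) := fun v hv =>
        (ContinuousAt.comp (g := g) (f := fun v : Ev m => (v, (0 : Pm n)))
          (hg _ (hmemU (closedBall_subset_ball (by norm_num) hv) (mem_ball_self he1))).continuousAt
          (by fun_prop)).continuousWithinAt
      rw [← closure_ball (0 : Ev m) one_ne_zero] at h2 hv
      exact Set.EqOn.of_subset_closure (f := fun v : Ev m => g (v, (0 : Pm n))) (g := fun _ => sg j) (s := ball (0 : Ev m) 1)
        (fun v hv => hgs _ ⟨hv, mem_ball_self he1⟩ rfl) h2 continuousOn_const subset_closure le_rfl hv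
    show g (v, 0) ∈ Tset p κ
    rw [hcl v hv]
    exact hsgT
  obtain ⟨A, B, hA, hB, hsA, h0B, hAB⟩ := generalized_tube_lemma (s := closedBall (0 : Ev m) 1) (isCompact_closedBall _ _)
    (t := {(0 : Pm n)}) isCompact_singleton hO (by rintro ⟨v, y⟩ ⟨hv, rfl⟩; exact hsgO v hv)
  obtain ⟨r, hr, hrB⟩ := Metric.isOpen_iff.1 hB 0 (h0B rfl)
  refine ⟨min r e1, lt_min hr he1, (min_le_right _ _).trans he1e, g, ?_⟩
  have hin : ∀ x ∈ Dom m n 1 (min r e1), x ∈ Reg m n univ e1 ∧ g x ∈ Tset p κ := fun x hx =>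
    @hAB x ⟨hsA (ball_subset_closedBall hx.1), hrB (ball_subset_ball (min_le_left _ _) hx.2)⟩
  have hOm : ∀ x ∈ Dom m n 1 (min r e1), (g x, x) ∈ Om p m n κ e := fun x hx =>
    ⟨(hin x hx).2, ball_subset_ball (by norm_num) hx.1, ball_subset_ball ((min_le_right _ _).trans he1e) hx.2⟩
  have hgD : AnalyticOnNhd ℂ g (Dom m n 1 (min r e1)) := fun x hx => hg x (hin x hx).1
  refine ⟨hgD, hOm, ?_, fun x hx => hgs x ⟨hx.1, ball_subset_ball (min_le_right _ _) hx.2⟩,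
    fun x hx i => hgi x (hin x hx).1 i⟩
  have h8 : AnalyticOnNhd ℂ (fun x => Ψ (g x, x)) (Dom m n 1 (min r e1)) :=
    analytic_of_diff (isOpen_Dom _ _) fun x hx => (DifferentiableAt.comp (g := Ψ) (f := fun x => (g x, x)) x
      (hF.an _ (hOm x hx)).differentiableAt ((hgD x hx).differentiableAt.prodMk differentiableAt_id)).differentiableWithinAt
  have h9 : AnalyticOnNhd ℂ (fun x : Ev m × Pm n => x.1) (Dom m n 1 (min r e1)) :=
    analytic_of_diff (isOpen_Dom _ _) fun x _ => by fun_prop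
  have hpt : (((fun _ => 3/4 : Ev m), 0) : Ev m × Pm n) ∈ Reg m n ∅ e1 ∩ Dom m n 1 (min r e1) := by
    refine ⟨Reg_mk (fun l => by norm_num) (fun l _ => by norm_num) (mem_ball_self he1), ?_, mem_ball_self (lt_min hr he1)⟩
    rw [mem_ball_zero_iff, pi_norm_lt_iff (by norm_num)]
    intro l; norm_num
  refine h8.eqOn_of_preconnected_of_eventuallyEq h9
    ((convex_ball _ _).prod (convex_ball _ _)).isPreconnected hpt.2 ?_
  filter_upwards [((isOpen_Reg ∅ e1).inter (isOpen_Dom _ _)).mem_nhds hpt] with y hy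
  rw [hga hy.1, hap y hy.1]

end

end Rig

end

section
open scoped BigOperators
open MeasureTheory Set Filter Topology Metric Asymptotics

namespace Rig

noncomputable section
variable {m p n q : ℕ}

structure IsPer (w : Fin p → Fin m → ℤ) (R : Fin p → Ev m × Pm n → Ev m) (κ e : ℝ)
    (Ψ : Tot p m n → Ev m) (e1 : ℝ) (a : Fin p → Ev m × Pm n → Fin p → ℂ) : Prop where
  pos : 0 < e1
  le : e1 ≤ e
  an : ∀ j, AnalyticOnNhd ℂ (a j) (Dom m n 1 e1)
  mem : ∀ j, ∀ x ∈ Dom m n 1 e1, (a j x, x) ∈ Om p m n κ e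
  per : ∀ j, ∀ x ∈ Dom m n 1 e1, Ψ (a j x, x) = x.1
  s0 : ∀ j, ∀ x ∈ Dom m n 1 e1, x.2.1 = 0 → a j x = sg j
  inv : ∀ j, ∀ x ∈ Dom m n 1 e1, ∀ i, fderiv ℂ (a j) x (Yf w R i x, 0) = 0

theorem Dom_mono {r r' e e' : ℝ} (hr : r ≤ r') (he : e ≤ e') : Dom m n r e ⊆ Dom m n r' e' :=
  prod_mono (ball_subset_ball hr) (ball_subset_ball he)

theorem Sys.per {w : Fin p → Fin m → ℤ} {R : Fin p → Ev m × Pm n → Ev m} {f : Fin q → Ev m × Pm n → ℂ}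
    {e0 : ℝ} {v0 : Ev m} (h : Sys w R f e0 v0) {κ e C : ℝ}
    {Ψ : Tot p m n → Ev m} (hF : IsFlow w R κ e C Ψ) (hee : e ≤ e0) : ∃ e1 a, IsPer w R κ e Ψ e1 a := by
  choose e' he' hle a h1 h2 h3 h4 h5 using fun j => h.gext hF hee j
  obtain ⟨e1, he1, hmin⟩ : ∃ e1, (0 < e1 ∧ e1 ≤ e) ∧ ∀ j, e1 ≤ e' j := by
    by_cases hp : Nonempty (Fin p)
    · obtain ⟨j0, hj0⟩ := Finite.exists_min e'
      exact ⟨e' j0, ⟨he' j0, hle j0⟩, hj0⟩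
    · exact ⟨e, ⟨hF.epos, le_rfl⟩, fun j => absurd ⟨j⟩ hp⟩
  have hs := fun j => Dom_mono (m := m) (n := n) (le_refl (1:ℝ)) (hmin j)
  exact ⟨e1, a, he1.1, he1.2, fun j => (h1 j).mono (hs j), fun j x hx => h2 j x (hs j hx), fun j x hx => h3 j x (hs j hx),
    fun j x hx => h4 j x (hs j hx), fun j x hx => h5 j x (hs j hx)⟩

def Zf (w : Fin p → Fin m → ℤ) (R : Fin p → Ev m × Pm n → Ev m) (a : Fin p → Ev m × Pm n → Fin p → ℂ) (i : Fin p)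
    (x : Ev m × Pm n) : Ev m := ∑ l, a i x l • Yf w R l x

theorem avg_step {w : Fin p → Fin m → ℤ} {R : Fin p → Ev m × Pm n → Ev m} {κ e C e1 : ℝ}
    {Ψ : Tot p m n → Ev m} {a : Fin p → Ev m × Pm n → Fin p → ℂ} (hF : IsFlow w R κ e C Ψ) (hP : IsPer w R κ e Ψ e1 a)
    {r e2 : ℝ} (hr : 0 < r) (hr1 : r ≤ 1) (he2 : 0 < e2) (he21 : e2 ≤ e1) {φ : Ev m × Pm n → Ev m}
    (hφ : AnalyticOnNhd ℂ φ (Dom m n r e2)) {J : Set (Fin p)}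
    (hJ : ∀ i ∈ J, ∀ x ∈ Dom m n r e2, fderiv ℂ φ x (Zf w R a i x, 0) = wt w i * φ x)
    (h0 : ∀ x ∈ Dom m n r e2, x.2.1 = 0 → φ x = x.1) (j : Fin p) :
    ∃ r' > 0, r' ≤ r ∧ ∃ e3 > 0, e3 ≤ e2 ∧ ∃ φ' : Ev m × Pm n → Ev m, AnalyticOnNhd ℂ φ' (Dom m n r' e3) ∧
      (∀ i ∈ insert j J, ∀ x ∈ Dom m n r' e3, fderiv ℂ φ' x (Zf w R a i x, 0) = wt w i * φ' x) ∧
      (∀ x ∈ Dom m n r' e3, x.2.1 = 0 → φ' x = x.1) := by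
  have hC := hF.Cpos
  have he3 : 0 < min e2 (r / (12 * C)) := lt_min he2 (by positivity)
  set e3 := min e2 (r / (12 * C)) with he3d
  have hsub : Dom m n (r/2) e3 ⊆ Dom m n r e2 := Dom_mono (by linarith) (min_le_left _ _)
  have hsub1 : Dom m n r e2 ⊆ Dom m n 1 e1 := Dom_mono hr1 he21
  set N : ℂ × (Ev m × Pm n) → Ev m × Pm n := fun y => (Ψ (y.1 • a j y.2, y.2), y.2.2) with hN
  have hNm : ∀ x ∈ Dom m n (r/2) e3, ∀ u ∈ Icc (0:ℝ) 1, ((u:ℂ) • a j x, x) ∈ Om p m n κ e ∧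
      N ((u:ℂ), x) ∈ Dom m n r e2 := by
    intro x hx u hu
    have h1 : ((u:ℂ) • a j x, x) ∈ Om p m n κ e := Om_tube (hP.mem j x (hsub1 (hsub hx))) u hu
    refine ⟨h1, ?_, (hsub hx).2⟩
    have h2 := hF.cl _ _ h1
    have h3 := hF.exb _ h1.1
    have h4 : ‖x.2.1‖ * C ≤ r / 12 := by
      have h5 : ‖x.2.1‖ ≤ r / (12 * C) :=
        (norm_fst_le x.2).trans ((mem_ball_zero_iff.1 hx.2).le.trans (min_le_right _ _))
      calc ‖x.2.1‖ * C ≤ r / (12 * C) * C := by gcongr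
        _ = r / 12 := by field_simp
    have h6 : ‖x.1‖ < r/2 := mem_ball_zero_iff.1 hx.1
    have h7 : ‖ex w (-((u:ℂ) • a j x)) * Ψ ((u:ℂ) • a j x, x)‖ ≤ r/12 + r/2 := by
      have := norm_le_norm_add_norm_sub' (ex w (-((u:ℂ) • a j x)) * Ψ ((u:ℂ) • a j x, x)) x.1
      linarith
    rw [mem_ball_zero_iff]
    show ‖Ψ ((u:ℂ) • a j x, x)‖ < r
    rw [Psi_eq w ((u:ℂ) • a j x) (Ψ ((u:ℂ) • a j x, x))]
    calc _ ≤ _ := norm_mul_le _ _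
      _ ≤ 3/2 * (r/12 + r/2) := by gcongr
      _ < r := by linarith
  have hinv : ∀ x ∈ Dom m n (r/2) e3, ∀ u ∈ Icc (0:ℝ) 1, ∀ i, a i (N ((u:ℂ), x)) = a i x := by
    intro x hx u hu i
    refine inv_flow hF (h := a i) (Ω := Dom m n r e2) (fun y hy => (hP.an i y (hsub1 hy)).differentiableAt)
      (fun y hy l => hP.inv i y (hsub1 hy) l) (hNm x hx u hu).1 fun t ht => ?_
    have := (hNm x hx (t * u) ⟨mul_nonneg ht.1 hu.1, mul_le_one₀ ht.2 hu.1 hu.2⟩).2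
    show (Ψ ((t:ℂ) • (u:ℂ) • a j x, x), x.2) ∈ _
    rw [smul_smul, ← Complex.ofReal_mul]
    exact this
  have hΩ1 : IsOpen {y : ℂ × (Ev m × Pm n) | y.2 ∈ Dom m n 1 e1 ∧ (y.1 • a j y.2, y.2) ∈ Om p m n κ e} := by
    refine ContinuousOn.isOpen_inter_preimage (s := {y : ℂ × (Ev m × Pm n) | y.2 ∈ Dom m n 1 e1})
      (f := fun y : ℂ × (Ev m × Pm n) => (y.1 • a j y.2, y.2)) ?_ ((isOpen_Dom _ _).preimage continuous_snd) (isOpen_Om κ e)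
    intro y hy
    have h1 : ContinuousAt (fun y : ℂ × (Ev m × Pm n) => a j y.2) y :=
      ContinuousAt.comp (g := a j) (f := fun y : ℂ × (Ev m × Pm n) => y.2) (hP.an j _ hy).continuousAt continuousAt_snd
    exact ((continuousAt_fst.smul h1).prodMk continuousAt_snd).continuousWithinAt
  set Ω1 := {y : ℂ × (Ev m × Pm n) | y.2 ∈ Dom m n 1 e1 ∧ (y.1 • a j y.2, y.2) ∈ Om p m n κ e} with hΩ1d
  have hNd : ∀ y ∈ Ω1, DifferentiableAt ℂ N y := by
    intro y hy
    have h1 : DifferentiableAt ℂ (fun y : ℂ × (Ev m × Pm n) => a j y.2) y :=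
      DifferentiableAt.comp (g := a j) (f := fun y : ℂ × (Ev m × Pm n) => y.2) y (hP.an j _ hy.1).differentiableAt (by fun_prop)
    have h2 : DifferentiableAt ℂ (fun y : ℂ × (Ev m × Pm n) => (y.1 • a j y.2, y.2)) y :=
      (differentiableAt_fst.smul h1).prodMk differentiableAt_snd
    exact (DifferentiableAt.comp (g := Ψ) (f := fun y : ℂ × (Ev m × Pm n) => (y.1 • a j y.2, y.2)) y
      (hF.an _ hy.2).differentiableAt h2).prodMk (by fun_prop)
  have hΩ : IsOpen (Ω1 ∩ N ⁻¹' Dom m n r e2) :=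
    ContinuousOn.isOpen_inter_preimage (fun y hy => (hNd y hy).continuousAt.continuousWithinAt) hΩ1 (isOpen_Dom _ _)
  have hGd : ∀ y ∈ Ω1 ∩ N ⁻¹' Dom m n r e2, DifferentiableAt ℂ (fun y => φ (N y)) y := fun y hy =>
    DifferentiableAt.comp (g := φ) (f := N) y (hφ _ hy.2).differentiableAt (hNd y hy.1)
  have hKd : ∀ y ∈ Ω1 ∩ N ⁻¹' Dom m n r e2, DifferentiableAt ℂ (fun y => ex w (y.1 • (-sg j)) * φ (N y)) y := fun y hy =>
    (DifferentiableAt.comp (g := ex w) (f := fun y : ℂ × (Ev m × Pm n) => y.1 • (-sg j)) y (ex_diff w _) (by fun_prop)).mul (hGd y hy)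
  have hK := analytic_of_diff hΩ fun y hy => (hKd y hy).differentiableWithinAt
  have hDt : Dom m n (r/2) e3 ⊆ tube (Ω1 ∩ N ⁻¹' Dom m n r e2) := fun x hx u hu =>
    ⟨⟨hsub1 (hsub hx), (hNm x hx u hu).1⟩, (hNm x hx u hu).2⟩
  refine ⟨r/2, by positivity, by linarith, e3, he3, min_le_left _ _,
    fun x => ∫ u in (0:ℝ)..1, ex w ((u:ℂ) • (-sg j)) * φ (N ((u:ℂ), x)), (paramInt_analytic hΩ hK).mono hDt, ?_, ?_⟩
  · intro i hi x hx
    rw [paramInt_fderiv hΩ hK (hDt hx)]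
    have hx1 := hsub1 (hsub hx)
    have hcont : ContinuousOn (fun u : ℝ => ex w ((u:ℂ) • (-sg j)) * φ (N ((u:ℂ), x))) (Icc 0 1) := by
      intro u hu
      have : ContinuousAt (fun y : ℂ × (Ev m × Pm n) => ex w (y.1 • (-sg j)) * φ (N y)) ((u:ℂ), x) :=
        (hKd _ (hDt hx u hu)).continuousAt
      exact (ContinuousAt.comp (f := fun u : ℝ => ((u:ℂ), x)) this (by fun_prop)).continuousWithinAt
    have hii : IntervalIntegrable (fun u : ℝ => ex w ((u:ℂ) • (-sg j)) * φ (N ((u:ℂ), x))) volume 0 1 :=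
      ContinuousOn.intervalIntegrable (by rwa [uIcc_of_le zero_le_one])
    have haz : fderiv ℂ (a j) x (Zf w R a i x, 0) = 0 := by
      have : ((Zf w R a i x, 0) : Ev m × Pm n) = ∑ l, a i x l • (Yf w R l x, 0) := by
        refine Prod.ext (by simp [Zf, Prod.fst_sum]) (by simp [Prod.snd_sum])
      rw [this, map_sum]
      exact Finset.sum_eq_zero fun l _ => by rw [map_smul, hP.inv j x hx1 l, smul_zero]
    have key : ∀ u ∈ Icc (0:ℝ) 1, fderiv ℂ (fun y => ex w (y.1 • (-sg j)) * φ (N y)) ((u:ℂ), x) (0, (Zf w R a i x, 0)) =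
        ex w ((u:ℂ) • (-sg j)) * fderiv ℂ φ (N ((u:ℂ), x)) (Zf w R a i (N ((u:ℂ), x)), 0) := by
      intro u hu
      have hu' := hNm x hx u hu
      have k1 : HasFDerivAt (fun x => ex w ((u:ℂ) • (-sg j)) * φ (N ((u:ℂ), x)))
          ((fderiv ℂ (fun y => ex w (y.1 • (-sg j)) * φ (N y)) ((u:ℂ), x)).comp (ContinuousLinearMap.inr ℂ ℂ (Ev m × Pm n))) x :=
        HasFDerivAt.comp (g := fun y => ex w (y.1 • (-sg j)) * φ (N y)) (f := fun x => ((u:ℂ), x)) x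
          (hKd _ (hDt hx u hu)).hasFDerivAt (hasFDerivAt_prodMk_right (u:ℂ) x)
      have k2 : HasFDerivAt (fun x => ((u:ℂ) • a j x, x)) (((u:ℂ) • fderiv ℂ (a j) x).prod (ContinuousLinearMap.id ℂ _)) x :=
        ((hP.an j x hx1).differentiableAt.hasFDerivAt.const_smul (u:ℂ)).prodMk (hasFDerivAt_id x)
      have k3 : HasFDerivAt (fun x => Ψ ((u:ℂ) • a j x, x)) ((fderiv ℂ Ψ ((u:ℂ) • a j x, x)).comp
          (((u:ℂ) • fderiv ℂ (a j) x).prod (ContinuousLinearMap.id ℂ _))) x :=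
        HasFDerivAt.comp (g := Ψ) (f := fun x => ((u:ℂ) • a j x, x)) x (hF.an _ hu'.1).differentiableAt.hasFDerivAt k2
      have k4 : HasFDerivAt (fun x => N ((u:ℂ), x)) (((fderiv ℂ Ψ ((u:ℂ) • a j x, x)).comp
          (((u:ℂ) • fderiv ℂ (a j) x).prod (ContinuousLinearMap.id ℂ _))).prod (ContinuousLinearMap.snd ℂ (Ev m) (Pm n))) x :=
        k3.prodMk hasFDerivAt_snd
      have k5 : HasFDerivAt (fun x => φ (N ((u:ℂ), x))) _ x :=
        HasFDerivAt.comp (g := φ) (f := fun x => N ((u:ℂ), x)) x (hφ _ hu'.2).differentiableAt.hasFDerivAt k4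
      have k6 := k5.const_mul (ex w ((u:ℂ) • (-sg j)))
      have k7 := congrArg (fun L => L (Zf w R a i x, 0)) (k1.unique k6)
      have k9 : fderiv ℂ Ψ ((u:ℂ) • a j x, x) (0, (Zf w R a i x, 0)) = Zf w R a i (N ((u:ℂ), x)) := by
        have : ((0, (Zf w R a i x, 0)) : Tot p m n) = ∑ l, a i x l • (0, (Yf w R l x, 0)) := by
          refine Prod.ext (by simp [Prod.fst_sum]) (Prod.ext ?_ ?_)
          · simp [Zf, Prod.fst_sum, Prod.snd_sum]
          · simp [Prod.snd_sum]
        rw [this, map_sum]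
        unfold Zf
        rw [hinv x hx u hu i]
        refine Finset.sum_congr rfl fun l _ => ?_
        rw [map_smul, hF.dx _ _ hu'.1 l]
      have k8 : (((u:ℂ) • fderiv ℂ (a j) x).prod (ContinuousLinearMap.id ℂ _)) (Zf w R a i x, 0) = (0, (Zf w R a i x, 0)) := by
        simp [haz]
      have k10 : (((fderiv ℂ Ψ ((u:ℂ) • a j x, x)).comp
          (((u:ℂ) • fderiv ℂ (a j) x).prod (ContinuousLinearMap.id ℂ _))).prod (ContinuousLinearMap.snd ℂ (Ev m) (Pm n)))
          (Zf w R a i x, 0) = (Zf w R a i (N ((u:ℂ), x)), 0) := by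
        rw [ContinuousLinearMap.prod_apply, ContinuousLinearMap.comp_apply, k8, k9]
        rfl
      rw [← k10]
      exact k7
    have hitg : (∫ u in (0:ℝ)..1, fderiv ℂ (fun y => ex w (y.1 • (-sg j)) * φ (N y)) ((u:ℂ), x) (0, (Zf w R a i x, 0))) =
        ∫ u in (0:ℝ)..1, ex w ((u:ℂ) • (-sg j)) * fderiv ℂ φ (N ((u:ℂ), x)) (Zf w R a i (N ((u:ℂ), x)), 0) :=
      intervalIntegral.integral_congr fun u hu => by rw [uIcc_of_le zero_le_one] at hu; exact key u hu
    rw [hitg]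
    have hmulc : wt w i * (∫ u in (0:ℝ)..1, ex w ((u:ℂ) • (-sg j)) * φ (N ((u:ℂ), x))) =
        ∫ u in (0:ℝ)..1, wt w i * (ex w ((u:ℂ) • (-sg j)) * φ (N ((u:ℂ), x))) :=
      ((ContinuousLinearMap.mul ℂ (Ev m) (wt w i)).intervalIntegral_comp_comm hii).symm
    rw [hmulc]
    rcases hi with rfl | hi
    · -- i = j
      have hder : ∀ u ∈ Icc (0:ℝ) 1, HasDerivAt (fun u : ℝ => ex w ((u:ℂ) • (-sg i)) * φ (N ((u:ℂ), x)))
          (tpi • (ex w ((u:ℂ) • (-sg i)) * fderiv ℂ φ (N ((u:ℂ), x)) (Zf w R a i (N ((u:ℂ), x)), 0) -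
            wt w i * (ex w ((u:ℂ) • (-sg i)) * φ (N ((u:ℂ), x))))) u := by
        intro u hu
        have hu' := hNm x hx u hu
        have d1 := ex_line w (-sg i) u
        have d2 : HasDerivAt (fun t : ℂ => (t • a i x, x)) ((a i x, 0) : Tot p m n) (u:ℂ) := by
          have := (hasDerivAt_id (u:ℂ)).smul_const (a i x)
          rw [one_smul] at this
          exact this.prodMk (hasDerivAt_const _ _)
        have d3 : HasDerivAt (fun t : ℂ => Ψ (t • a i x, x)) (fderiv ℂ Ψ ((u:ℂ) • a i x, x) (a i x, 0)) (u:ℂ) :=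
          HasFDerivAt.comp_hasDerivAt (f := fun t : ℂ => (t • a i x, x)) (u:ℂ) (hF.an _ hu'.1).differentiableAt.hasFDerivAt d2
        have d4 : fderiv ℂ Ψ ((u:ℂ) • a i x, x) (a i x, 0) = tpi • Zf w R a i (N ((u:ℂ), x)) := by
          rw [hF.dt _ _ hu'.1]
          unfold Zf
          rw [hinv x hx u hu i]
        have d5 : HasDerivAt (fun t : ℂ => N (t, x)) (tpi • (Zf w R a i (N ((u:ℂ), x)), 0)) (u:ℂ) := by
          rw [d4] at d3
          have := d3.prodMk (hasDerivAt_const (u:ℂ) x.2)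
          simpa [hN] using this
        have d6 : HasDerivAt (fun t : ℂ => φ (N (t, x))) (fderiv ℂ φ (N ((u:ℂ), x)) (tpi • (Zf w R a i (N ((u:ℂ), x)), 0))) (u:ℂ) :=
          HasFDerivAt.comp_hasDerivAt (f := fun t : ℂ => N (t, x)) (u:ℂ) (hφ _ hu'.2).differentiableAt.hasFDerivAt d5
        rw [map_smul] at d6
        refine (d1.mul (hasDerivAt_ofReal d6)).congr_deriv ?_
        have d7 : ∑ l, (-sg i) l • wt w l = - wt w i := by
          rw [Finset.sum_eq_single i]
          · simp [sg]
          · intro b _ hb; simp [sg, hb]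
          · simp
        rw [d7]
        simp only [neg_mul, smul_neg, smul_sub, smul_mul_assoc, mul_smul_comm]
        rw [neg_add_eq_sub, mul_assoc]
      have hcont2 : ContinuousOn (fun u : ℝ => ex w ((u:ℂ) • (-sg i)) * fderiv ℂ φ (N ((u:ℂ), x)) (Zf w R a i (N ((u:ℂ), x)), 0)) (Icc 0 1) := by
        have c1 : ContinuousOn (fun u : ℝ => fderiv ℂ (fun y => ex w (y.1 • (-sg i)) * φ (N y)) ((u:ℂ), x) (0, (Zf w R a i x, 0))) (Icc 0 1) := by
          intro u hu
          have : ContinuousAt (fderiv ℂ (fun y => ex w (y.1 • (-sg i)) * φ (N y))) ((u:ℂ), x) :=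
            (hK.fderiv _ (hDt hx u hu)).continuousAt
          exact ((ContinuousAt.comp (f := fun u : ℝ => ((u:ℂ), x)) this (by fun_prop)).clm_apply continuousAt_const).continuousWithinAt
        exact c1.congr fun u hu => (key u hu).symm
      have i2 : IntervalIntegrable (fun u : ℝ => ex w ((u:ℂ) • (-sg i)) * fderiv ℂ φ (N ((u:ℂ), x)) (Zf w R a i (N ((u:ℂ), x)), 0)) volume 0 1 :=
        ContinuousOn.intervalIntegrable (by rwa [uIcc_of_le zero_le_one])
      have i3 : IntervalIntegrable (fun u : ℝ => wt w i * (ex w ((u:ℂ) • (-sg i)) * φ (N ((u:ℂ), x)))) volume 0 1 :=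
        ContinuousOn.intervalIntegrable (by rw [uIcc_of_le zero_le_one]; exact continuousOn_const.mul hcont)
      have hftc := intervalIntegral.integral_eq_sub_of_hasDerivAt (a := 0) (b := 1)
        (f := fun u : ℝ => ex w ((u:ℂ) • (-sg i)) * φ (N ((u:ℂ), x))) (by rw [uIcc_of_le zero_le_one]; exact hder)
        ((i2.sub i3).continuousOn_smul (f := fun _ => tpi) continuousOn_const)
      rw [intervalIntegral.integral_smul, intervalIntegral.integral_sub i2 i3] at hftc
      have hb : ex w (((1:ℝ):ℂ) • (-sg i)) * φ (N (((1:ℝ):ℂ), x)) - ex w (((0:ℝ):ℂ) • (-sg i)) * φ (N (((0:ℝ):ℂ), x)) = 0 := by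
        have b1 : ex w (-sg i) = 1 := by
          have := ex_neg_mul w (sg i)
          rwa [ex_sg, mul_one] at this
        have b2 : N (1, x) = x := by simp [hN, hP.per i x hx1]
        have b3 : N (0, x) = x := by
          have : x ∈ Dom m n 2 e := Dom_mono (by norm_num) hP.le hx1
          simp [hN, hF.zero x this]
        simp [b1, b2, b3, ex_zero]
      rw [hb, smul_eq_zero] at hftc
      exact sub_eq_zero.1 (hftc.resolve_left tpi_ne)
    · refine intervalIntegral.integral_congr fun u hu => ?_
      rw [uIcc_of_le zero_le_one] at hu
      show ex w ((u:ℂ) • (-sg j)) * fderiv ℂ φ (N ((u:ℂ), x)) (Zf w R a i (N ((u:ℂ), x)), 0) = _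
      rw [hJ i hi _ (hNm x hx u hu).2]
      ring
  · intro x hx hs
    have hx1 := hsub1 (hsub hx)
    have : ∀ u ∈ uIcc (0:ℝ) 1, ex w ((u:ℂ) • (-sg j)) * φ (N ((u:ℂ), x)) = x.1 := by
      intro u hu
      rw [uIcc_of_le zero_le_one] at hu
      have hu' := hNm x hx u hu
      rw [h0 _ hu'.2 hs]
      have h1 := Psi_s0 hF hu'.1 hs
      rw [hP.s0 j x hx1 hs] at h1
      show ex w ((u:ℂ) • (-sg j)) * Ψ ((u:ℂ) • a j x, x) = x.1
      rw [hP.s0 j x hx1 hs, smul_neg]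
      exact h1
    show ∫ u in (0:ℝ)..1, ex w ((u:ℂ) • (-sg j)) * φ (N ((u:ℂ), x)) = x.1
    rw [intervalIntegral.integral_congr this]
    simp

end

end Rig

end

section
open scoped BigOperators
open MeasureTheory Set Filter Topology Metric Asymptotics

namespace Rig

noncomputable section
variable {m p n q : ℕ}

theorem mem_Dom_zero {r e : ℝ} (hr : 0 < r) (he : 0 < e) : (0 : Ev m × Pm n) ∈ Dom m n r e :=
  ⟨mem_ball_self hr, mem_ball_self he⟩

theorem Dom_basis {u : Set (Ev m × Pm n)} (hu : u ∈ 𝓝 (0 : Ev m × Pm n)) : ∃ d > 0, Dom m n d d ⊆ u := by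
  obtain ⟨d, hd, h⟩ := Metric.mem_nhds_iff.1 hu
  refine ⟨d, hd, fun x hx => h ?_⟩
  rw [mem_ball_zero_iff, Prod.norm_def]
  exact max_lt (mem_ball_zero_iff.1 hx.1) (mem_ball_zero_iff.1 hx.2)

theorem avg_all {w : Fin p → Fin m → ℤ} {R : Fin p → Ev m × Pm n → Ev m} {κ e C e1 : ℝ}
    {Ψ : Tot p m n → Ev m} {a : Fin p → Ev m × Pm n → Fin p → ℂ} (hF : IsFlow w R κ e C Ψ) (hP : IsPer w R κ e Ψ e1 a)
    (J : Finset (Fin p)) : ∃ r > 0, r ≤ 1 ∧ ∃ e2 > 0, e2 ≤ e1 ∧ ∃ φ : Ev m × Pm n → Ev m,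
      AnalyticOnNhd ℂ φ (Dom m n r e2) ∧
      (∀ i ∈ J, ∀ x ∈ Dom m n r e2, fderiv ℂ φ x (Zf w R a i x, 0) = wt w i * φ x) ∧
      (∀ x ∈ Dom m n r e2, x.2.1 = 0 → φ x = x.1) := by
  classical
  induction J using Finset.induction_on with
  | empty =>
    refine ⟨1, one_pos, le_rfl, e1, hP.pos, le_rfl, fun x => x.1, analytic_of_diff (isOpen_Dom _ _) (by fun_prop), by simp, fun _ _ _ => rfl⟩
  | insert j J _ ih =>
    obtain ⟨r, hr, hr1, e2, he2, he21, φ, h1, h2, h3⟩ := ih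
    obtain ⟨r', hr', hr'r, e3, he3, he32, φ', k1, k2, k3⟩ := avg_step hF hP hr hr1 he2 he21 h1 (J := (J : Set (Fin p))) h2 h3 j
    refine ⟨r', hr', hr'r.trans hr1, e3, he3, he32.trans he21, φ', k1, fun i hi => k2 i (by simpa using hi), k3⟩

theorem Sys.main {w : Fin p → Fin m → ℤ} {R : Fin p → Ev m × Pm n → Ev m} {f : Fin q → Ev m × Pm n → ℂ}
    {e0 : ℝ} {v0 : Ev m} (h : Sys w R f e0 v0) :
    ∃ r > 0, r ≤ 1 ∧ r ≤ e0 ∧ ∃ φ : Ev m × Pm n → Ev m, ∃ a : Fin p → Ev m × Pm n → Fin p → ℂ,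
      AnalyticOnNhd ℂ φ (Dom m n r r) ∧ (∀ j, AnalyticOnNhd ℂ (a j) (Dom m n r r)) ∧
      (∀ i, ∀ x ∈ Dom m n r r, fderiv ℂ φ x (∑ l, a i x l • Yf w R l x, 0) = wt w i * φ x) ∧
      (∀ x ∈ Dom m n r r, x.2.1 = 0 → φ x = x.1) ∧
      (∀ x ∈ Dom m n r r, (Matrix.of fun i l => a i x l).det ≠ 0) ∧
      (∀ j l, ∀ x ∈ Dom m n r r, fderiv ℂ (a j) x (Yf w R l x, 0) = 0) := by
  obtain ⟨κ, e, C, hee, Ψ, hF⟩ := flow_exists w h.e0pos h.hR h.hcomm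
  have hee' : e ≤ e0 := by have := h.e0pos; linarith
  obtain ⟨e1, a, hP⟩ := h.per hF hee'
  obtain ⟨r, hr, hr1, e2, he2, he21, φ, h1, h2, h3⟩ := avg_all hF hP Finset.univ
  have hdet0 : (Matrix.of fun i l => a i (0 : Ev m × Pm n) l).det = 1 := by
    have : (Matrix.of fun i l => a i (0 : Ev m × Pm n) l) = 1 := by
      ext i l
      rw [Matrix.of_apply, hP.s0 i 0 (mem_Dom_zero one_pos hP.pos) rfl]
      simp [sg, Matrix.one_apply, Pi.single_apply, eq_comm]
    rw [this, Matrix.det_one]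
  have hcont : ContinuousAt (fun x : Ev m × Pm n => (Matrix.of fun i l => a i x l).det) 0 := by
    have hc : ∀ i, ContinuousAt (a i) 0 := fun i => (hP.an i 0 (mem_Dom_zero one_pos hP.pos)).continuousAt
    simp only [Matrix.det_apply, Matrix.of_apply]
    refine tendsto_finsetSum _ fun σ _ => ?_
    refine Tendsto.const_smul ?_ _
    exact tendsto_finsetProd _ fun i _ => (continuousAt_pi.1 (hc _) _)
  obtain ⟨d, hd, hdd⟩ := Dom_basis (hcont.eventually_ne (by rw [hdet0]; exact one_ne_zero))
  have hm1 : min (min r e2) d ≤ r := (min_le_left _ _).trans (min_le_left _ _)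
  have hm2 : min (min r e2) d ≤ e2 := (min_le_left _ _).trans (min_le_right _ _)
  have hs1 : Dom m n (min (min r e2) d) (min (min r e2) d) ⊆ Dom m n r e2 := Dom_mono hm1 hm2
  have hs2 : Dom m n (min (min r e2) d) (min (min r e2) d) ⊆ Dom m n 1 e1 := hs1.trans (Dom_mono hr1 he21)
  refine ⟨min (min r e2) d, lt_min (lt_min hr he2) hd, hm1.trans hr1, hm2.trans (he21.trans (hP.le.trans hee')), φ, a,
    h1.mono hs1, fun j => (hP.an j).mono hs2, fun i x hx => h2 i (Finset.mem_univ _) x (hs1 hx), fun x hx => h3 x (hs1 hx),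
    fun x hx => hdd (Dom_mono (min_le_right _ _) (min_le_right _ _) hx), fun j l x hx => hP.inv j x (hs2 hx) l⟩

end

end Rig

end

section
open scoped BigOperators
open MeasureTheory Set Filter Topology Metric Asymptotics

namespace Rig

noncomputable section
variable {m p n q : ℕ}

theorem det_diff {E : Type*} [NormedAddCommGroup E] [NormedSpace ℂ E] {M : E → Matrix (Fin p) (Fin p) ℂ} {x : E}
    (h : ∀ i j, DifferentiableAt ℂ (fun x => M x i j) x) : DifferentiableAt ℂ (fun x => (M x).det) x := by
  simp only [Matrix.det_apply]
  exact DifferentiableAt.fun_sum fun σ _ => DifferentiableAt.fun_const_smul (HasFDerivAt.finsetProd fun i _ => (h _ _).hasFDerivAt).differentiableAt _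

theorem inv_diff {N : Fin p → Fin p → ℂ} (h : (Matrix.of N).det ≠ 0) (i k : Fin p) :
    DifferentiableAt ℂ (fun N : Fin p → Fin p → ℂ => (Matrix.of N)⁻¹ i k) N := by
  have h0 : DifferentiableAt ℂ (fun N : Fin p → Fin p → ℂ => (Matrix.of N).det) N :=
    det_diff fun i j => by simp only [Matrix.of_apply]; fun_prop
  simp only [Matrix.inv_def, Matrix.smul_apply, Ring.inverse_eq_inv', smul_eq_mul]
  refine (h0.inv h).mul ?_
  simp only [Matrix.adjugate_apply]
  refine det_diff fun i' j' => ?_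
  simp only [Matrix.updateRow_apply, Matrix.of_apply]
  split_ifs
  · fun_prop
  · fun_prop

theorem mat_diff {E : Type*} [NormedAddCommGroup E] [NormedSpace ℂ E] {α β : E → Fin p → Fin p → ℂ} {x : E}
    (hα : DifferentiableAt ℂ α x) (hβ : DifferentiableAt ℂ β x) (hd : (Matrix.of (α x)).det ≠ 0) (i j : Fin p) :
    DifferentiableAt ℂ (fun x => ((Matrix.of (α x))⁻¹ * Matrix.of (β x)) i j) x ∧
    ∀ d : E, fderiv ℂ α x d = 0 → fderiv ℂ β x d = 0 → fderiv ℂ (fun x => ((Matrix.of (α x))⁻¹ * Matrix.of (β x)) i j) x d = 0 := by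
  have h1 : DifferentiableAt ℂ (fun N : (Fin p → Fin p → ℂ) × (Fin p → Fin p → ℂ) => ((Matrix.of N.1)⁻¹ * Matrix.of N.2) i j) (α x, β x) := by
    simp only [Matrix.mul_apply, Matrix.of_apply]
    refine DifferentiableAt.fun_sum fun k _ => ?_
    refine (DifferentiableAt.comp (g := fun N : Fin p → Fin p → ℂ => (Matrix.of N)⁻¹ i k)
      (f := fun N : (Fin p → Fin p → ℂ) × (Fin p → Fin p → ℂ) => N.1) _ (inv_diff hd i k) differentiableAt_fst).mul (by fun_prop)
  have h2 := HasFDerivAt.comp (g := fun N : (Fin p → Fin p → ℂ) × (Fin p → Fin p → ℂ) => ((Matrix.of N.1)⁻¹ * Matrix.of N.2) i j)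
    (f := fun x => (α x, β x)) x h1.hasFDerivAt (hα.hasFDerivAt.prodMk hβ.hasFDerivAt)
  refine ⟨h2.differentiableAt, fun d hd1 hd2 => ?_⟩
  have h3 : fderiv ℂ (fun x => ((Matrix.of (α x))⁻¹ * Matrix.of (β x)) i j) x = _ := h2.fderiv
  rw [h3, ContinuousLinearMap.comp_apply, ContinuousLinearMap.prod_apply, hd1, hd2]
  exact map_zero _

theorem loc_inv {r : ℝ} (hr : 0 < r) {φ : Ev m × Pm n → Ev m} (hφ : AnalyticOnNhd ℂ φ (Dom m n r r))
    (h0 : ∀ x ∈ Dom m n r r, x.2.1 = 0 → φ x = x.1) :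
    ∃ ρ1 > 0, ρ1 ≤ r ∧ ∃ ρ2 > 0, ρ2 ≤ ρ1 ∧ ∃ χ : Ev m × Pm n → Ev m, AnalyticOnNhd ℂ χ (Dom m n ρ2 ρ2) ∧
      (∀ y ∈ Dom m n ρ2 ρ2, χ y ∈ ball (0 : Ev m) ρ1) ∧ (∀ y ∈ Dom m n ρ2 ρ2, φ (χ y, y.2) = y.1) ∧
      ∀ x ∈ Dom m n ρ1 ρ1, χ (φ x, x.2) = x.1 := by
  have hz := mem_Dom_zero (m := m) (n := n) hr hr
  have hL : ∀ v : Ev m, fderiv ℂ φ 0 (v, 0) = v := by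
    intro v
    have h1 : HasFDerivAt (fun v : Ev m => φ (v, (0 : Pm n))) ((fderiv ℂ φ 0).comp (ContinuousLinearMap.inl ℂ (Ev m) (Pm n))) 0 :=
      HasFDerivAt.comp (g := φ) (f := fun v : Ev m => (v, (0 : Pm n))) 0 (hφ 0 hz).differentiableAt.hasFDerivAt
        (hasFDerivAt_prodMk_left (0 : Ev m) (0 : Pm n))
    have h2 : (fun v : Ev m => φ (v, (0 : Pm n))) =ᶠ[𝓝 0] fun v => v := by
      filter_upwards [ball_mem_nhds (0 : Ev m) hr] with v hv
      exact h0 (v, 0) ⟨hv, mem_ball_self hr⟩ rfl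
    have h3 := h1.unique ((hasFDerivAt_id (0 : Ev m)).congr_of_eventuallyEq h2)
    exact congrArg (fun T : Ev m →L[ℂ] Ev m => T v) h3
  set L := fderiv ℂ φ 0 with hLd
  have hLs : ∀ x : Ev m × Pm n, L x = x.1 + L (0, x.2) := by
    intro x
    conv_lhs => rw [show x = (x.1, 0) + (0, x.2) by simp]
    rw [map_add, hL]
  let f' : (Ev m × Pm n) ≃L[ℂ] (Ev m × Pm n) := ContinuousLinearEquiv.equivOfInverse
    (L.prod (ContinuousLinearMap.snd ℂ (Ev m) (Pm n)))
    ((ContinuousLinearMap.fst ℂ (Ev m) (Pm n) - L.comp ((ContinuousLinearMap.inr ℂ (Ev m) (Pm n)).comp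
      (ContinuousLinearMap.snd ℂ (Ev m) (Pm n)))).prod (ContinuousLinearMap.snd ℂ (Ev m) (Pm n)))
    (fun x => by
      refine Prod.ext ?_ rfl
      show L x - L (0, x.2) = x.1
      rw [hLs x]; simp)
    (fun x => by
      refine Prod.ext ?_ rfl
      show L (x.1 - L (0, x.2), x.2) = x.1
      rw [hLs]; simp)
  set Φ : Ev m × Pm n → Ev m × Pm n := fun x => (φ x, x.2) with hΦ
  have hΦd : HasFDerivAt Φ (f' : (Ev m × Pm n) →L[ℂ] (Ev m × Pm n)) 0 :=
    (hφ 0 hz).differentiableAt.hasFDerivAt.prodMk hasFDerivAt_snd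
  have hΦa : ContDiffAt ℂ ⊤ Φ 0 := (hφ 0 hz).contDiffAt.prodMk contDiffAt_snd
  have hΦ0 : Φ 0 = 0 := Prod.ext (h0 0 hz rfl) rfl
  have hst := hΦa.hasStrictFDerivAt' hΦd (by simp)
  have hGa := hΦa.to_localInverse hΦd (by simp)
  have e1 := hst.eventually_left_inverse
  have e2 := hst.eventually_right_inverse
  have hG0 := hΦa.localInverse_apply_image hΦd (by simp)
  change ContDiffAt ℂ ⊤ (hst.localInverse Φ f' 0) (Φ 0) at hGa
  change hst.localInverse Φ f' 0 (Φ 0) = 0 at hG0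
  set G := hst.localInverse Φ f' 0
  rw [hΦ0] at e2 hG0 hGa
  obtain ⟨d1, hd1, hD1⟩ := Dom_basis e1
  have hGan : AnalyticAt ℂ G 0 := by
    rw [← contDiffWithinAt_univ] at hGa
    exact (analyticWithinAt_univ.1 (contDiffWithinAt_omega_iff_analyticWithinAt.1 hGa))
  have hρ1 : 0 < min d1 r := lt_min hd1 hr
  set ρ1 := min d1 r
  have e3 : ∀ᶠ y in 𝓝 (0 : Ev m × Pm n), G y ∈ ball (0 : Ev m × Pm n) ρ1 :=
    hGan.continuousAt.eventually_mem (by rw [hG0]; exact ball_mem_nhds _ hρ1)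
  obtain ⟨d2, hd2, hD2⟩ := Dom_basis ((e2.and e3).and hGan.eventually_analyticAt)
  have hs : Dom m n (min d2 ρ1) (min d2 ρ1) ⊆ Dom m n d2 d2 := Dom_mono (min_le_left _ _) (min_le_left _ _)
  refine ⟨ρ1, hρ1, min_le_right _ _, min d2 ρ1, lt_min hd2 hρ1, min_le_right _ _, fun y => (G y).1, ?_, ?_, ?_, ?_⟩
  · intro y hy
    have := (hD2 (hs hy)).2
    exact (ContinuousLinearMap.fst ℂ (Ev m) (Pm n)).analyticAt _ |>.comp this
  · intro y hy
    have := (hD2 (hs hy)).1.2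
    rw [mem_ball_zero_iff] at this ⊢
    exact (norm_fst_le _).trans_lt this
  · intro y hy
    have h5 : Φ (G y) = y := (hD2 (hs hy)).1.1
    have h6 : (G y).2 = y.2 := by
      have h8 := congrArg Prod.snd h5
      exact h8
    have h7 : φ (G y) = y.1 := by
      have h8 := congrArg Prod.fst h5
      exact h8
    rw [← h7, ← h6]
  · intro x hx
    have h5 : G (Φ x) = x := hD1 (Dom_mono (min_le_left _ _) (min_le_left _ _) hx)
    have h8 := congrArg Prod.fst h5
    exact h8

end

end Rig

end

section
open scoped BigOperators
open MeasureTheory Set Filter Topology Metric Asymptotics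

namespace Rig

noncomputable section
variable {m p n q : ℕ}

structure Lin (w : Fin p → Fin m → ℤ) (R : Fin p → Ev m × Pm n → Ev m) (a : Fin p → Ev m × Pm n → Fin p → ℂ)
    (φ χ : Ev m × Pm n → Ev m) (ρ1 ρ2 : ℝ) : Prop where
  pos2 : 0 < ρ2
  le : ρ2 ≤ ρ1
  φan : AnalyticOnNhd ℂ φ (Dom m n ρ1 ρ1)
  aan : ∀ j, AnalyticOnNhd ℂ (a j) (Dom m n ρ1 ρ1)
  eig : ∀ i, ∀ x ∈ Dom m n ρ1 ρ1, fderiv ℂ φ x (Zf w R a i x, 0) = wt w i * φ x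
  det : ∀ x ∈ Dom m n ρ1 ρ1, (Matrix.of fun i l => a i x l).det ≠ 0
  inv : ∀ j l, ∀ x ∈ Dom m n ρ1 ρ1, fderiv ℂ (a j) x (Yf w R l x, 0) = 0
  χan : AnalyticOnNhd ℂ χ (Dom m n ρ2 ρ2)
  χm : ∀ y ∈ Dom m n ρ2 ρ2, χ y ∈ ball (0 : Ev m) ρ1
  rinv : ∀ y ∈ Dom m n ρ2 ρ2, φ (χ y, y.2) = y.1
  linv : ∀ x ∈ Dom m n ρ1 ρ1, χ (φ x, x.2) = x.1

theorem Sys.lin {w : Fin p → Fin m → ℤ} {R : Fin p → Ev m × Pm n → Ev m} {f : Fin q → Ev m × Pm n → ℂ}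
    {e0 : ℝ} {v0 : Ev m} (h : Sys w R f e0 v0) : ∃ a φ χ ρ1 ρ2, ρ1 ≤ 1 ∧ ρ1 ≤ e0 ∧ φ 0 = 0 ∧ Lin w R a φ χ ρ1 ρ2 := by
  obtain ⟨r, hr, hr1, hre, φ, a, h1, h2, h3, h4, h5, h6⟩ := h.main
  obtain ⟨ρ1, hρ1, hρr, ρ2, hρ2, hle, χ, k1, k2, k3, k4⟩ := loc_inv hr h1 h4
  have hs : Dom m n ρ1 ρ1 ⊆ Dom m n r r := Dom_mono hρr hρr
  exact ⟨a, φ, χ, ρ1, ρ2, hρr.trans hr1, hρr.trans hre, h4 0 (mem_Dom_zero hr hr) rfl, hρ2, hle, h1.mono hs, fun j => (h2 j).mono hs, fun i x hx => h3 i x (hs hx),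
    fun x hx => h5 x (hs hx), fun j l x hx => h6 j l x (hs hx), k1, k2, k3, k4⟩

def Vs (φ : Ev m × Pm n → Ev m) (ρ1 ρ2 : ℝ) (ε : Pm n) : Set (Ev m) :=
  ball (0 : Ev m) ρ1 ∩ (fun v => φ (v, ε)) ⁻¹' ball (0 : Ev m) ρ2

def Tm (φ χ : Ev m × Pm n → Ev m) (ε ε' : Pm n) (v : Ev m) : Ev m := χ (φ (v, ε), ε')

def Am (a : Fin p → Ev m × Pm n → Fin p → ℂ) (x : Ev m × Pm n) : Fin p → Fin p → ℂ := fun i => a i x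

variable {w : Fin p → Fin m → ℤ} {R : Fin p → Ev m × Pm n → Ev m} {a : Fin p → Ev m × Pm n → Fin p → ℂ}
    {φ χ : Ev m × Pm n → Ev m} {ρ1 ρ2 : ℝ}

theorem slice_fd {F : Type*} [NormedAddCommGroup F] [NormedSpace ℂ F] {g : Ev m × Pm n → F} {v : Ev m} {ε : Pm n}
    (hg : DifferentiableAt ℂ g (v, ε)) :
    HasFDerivAt (fun v => g (v, ε)) ((fderiv ℂ g (v, ε)).comp (ContinuousLinearMap.inl ℂ (Ev m) (Pm n))) v :=
  HasFDerivAt.comp (g := g) (f := fun v : Ev m => (v, ε)) v hg.hasFDerivAt (hasFDerivAt_prodMk_left v ε)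

theorem Lin.mem (H : Lin w R a φ χ ρ1 ρ2) {ε : Pm n} (hε : ε ∈ ball (0 : Pm n) ρ2) {v : Ev m} (hv : v ∈ ball (0 : Ev m) ρ1) :
    (v, ε) ∈ Dom m n ρ1 ρ1 := ⟨hv, ball_subset_ball H.le hε⟩

theorem Lin.open_Vs (H : Lin w R a φ χ ρ1 ρ2) {ε : Pm n} (hε : ε ∈ ball (0 : Pm n) ρ2) : IsOpen (Vs φ ρ1 ρ2 ε) := by
  refine ContinuousOn.isOpen_inter_preimage (fun v hv => ?_) isOpen_ball isOpen_ball
  exact (slice_fd (H.φan _ (H.mem hε hv)).differentiableAt).continuousAt.continuousWithinAt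

theorem Lin.mapsTo (H : Lin w R a φ χ ρ1 ρ2) {ε ε' : Pm n} (hε' : ε' ∈ ball (0 : Pm n) ρ2) :
    MapsTo (Tm φ χ ε ε') (Vs φ ρ1 ρ2 ε) (Vs φ ρ1 ρ2 ε') := by
  intro v hv
  refine ⟨H.χm (φ (v, ε), ε') ⟨hv.2, hε'⟩, ?_⟩
  show φ (χ (φ (v, ε), ε'), ε') ∈ ball (0 : Ev m) ρ2
  rw [H.rinv (φ (v, ε), ε') ⟨hv.2, hε'⟩]
  exact hv.2

theorem Lin.tm_inv (H : Lin w R a φ χ ρ1 ρ2) {ε ε' : Pm n} (hε : ε ∈ ball (0 : Pm n) ρ2) (hε' : ε' ∈ ball (0 : Pm n) ρ2) {v : Ev m}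
    (hv : v ∈ Vs φ ρ1 ρ2 ε) : Tm φ χ ε' ε (Tm φ χ ε ε' v) = v := by
  show χ (φ (χ (φ (v, ε), ε'), ε'), ε) = v
  rw [H.rinv (φ (v, ε), ε') ⟨hv.2, hε'⟩]
  exact H.linv (v, ε) (H.mem hε hv.1)

theorem Lin.tm_fd (H : Lin w R a φ χ ρ1 ρ2) {ε ε' : Pm n} (hε : ε ∈ ball (0 : Pm n) ρ2) (hε' : ε' ∈ ball (0 : Pm n) ρ2) {v : Ev m}
    (hv : v ∈ Vs φ ρ1 ρ2 ε) : HasFDerivAt (Tm φ χ ε ε') (((fderiv ℂ χ (φ (v, ε), ε')).comp (ContinuousLinearMap.inl ℂ (Ev m) (Pm n))).comp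
      ((fderiv ℂ φ (v, ε)).comp (ContinuousLinearMap.inl ℂ (Ev m) (Pm n)))) v :=
  HasFDerivAt.comp (g := fun y => χ (y, ε')) (f := fun v => φ (v, ε)) v
    (slice_fd (H.χan (φ (v, ε), ε') ⟨hv.2, hε'⟩).differentiableAt) (slice_fd (H.φan _ (H.mem hε hv.1)).differentiableAt)

theorem Lin.push (H : Lin w R a φ χ ρ1 ρ2) {ε : Pm n} (hε : ε ∈ ball (0 : Pm n) ρ2) {y : Ev m} (hy : y ∈ ball (0 : Ev m) ρ2) (i : Fin p) :
    fderiv ℂ χ (y, ε) (wt w i * y, 0) = Zf w R a i (χ (y, ε), ε) := by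
  have hv1 := H.χm (y, ε) ⟨hy, hε⟩
  have hr := H.rinv (y, ε) ⟨hy, hε⟩
  set v := χ (y, ε) with hvd
  change φ (v, ε) = y at hr
  have hv : v ∈ Vs φ ρ1 ρ2 ε := ⟨hv1, by show φ (v, ε) ∈ ball (0 : Ev m) ρ2; rwa [hr]⟩
  have h1 := H.tm_fd hε hε hv
  have h2 : Tm φ χ ε ε =ᶠ[𝓝 v] fun v => v := by
    filter_upwards [isOpen_ball.mem_nhds hv1] with u hu
    exact H.linv (u, ε) (H.mem hε hu)
  have h3 := h1.unique ((hasFDerivAt_id v).congr_of_eventuallyEq h2)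
  have h4 := congrArg (fun T : Ev m →L[ℂ] Ev m => T (Zf w R a i (v, ε))) h3
  have h5 : fderiv ℂ χ (φ (v, ε), ε) (fderiv ℂ φ (v, ε) (Zf w R a i (v, ε), 0), 0) = Zf w R a i (v, ε) := h4
  rw [H.eig i _ (H.mem hε hv1), hr] at h5
  exact h5

theorem Lin.tm_Z (H : Lin w R a φ χ ρ1 ρ2) {ε ε' : Pm n} (hε : ε ∈ ball (0 : Pm n) ρ2) (hε' : ε' ∈ ball (0 : Pm n) ρ2) {v : Ev m}
    (hv : v ∈ Vs φ ρ1 ρ2 ε) (i : Fin p) : fderiv ℂ (Tm φ χ ε ε') v (Zf w R a i (v, ε)) = Zf w R a i (Tm φ χ ε ε' v, ε') := by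
  rw [(H.tm_fd hε hε' hv).fderiv]
  show fderiv ℂ χ (φ (v, ε), ε') (fderiv ℂ φ (v, ε) (Zf w R a i (v, ε), 0), 0) = _
  rw [H.eig i _ (H.mem hε hv.1), H.push hε' hv.2]
  rfl

theorem Y_of_Z {x : Ev m × Pm n} (hd : (Matrix.of (Am a x)).det ≠ 0) (i : Fin p) :
    Yf w R i x = ∑ j, (Matrix.of (Am a x))⁻¹ i j • Zf w R a j x := by
  have h1 : ∀ l, ∑ j, (Matrix.of (Am a x))⁻¹ i j * Am a x j l = (1 : Matrix (Fin p) (Fin p) ℂ) i l := by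
    intro l
    rw [← Matrix.nonsing_inv_mul (Matrix.of (Am a x)) (isUnit_iff_ne_zero.2 hd), Matrix.mul_apply]
    rfl
  have h2 : ∀ j, Zf w R a j x = ∑ l, Am a x j l • Yf w R l x := fun j => rfl
  simp only [h2, Finset.smul_sum, smul_smul]
  rw [Finset.sum_comm]
  simp only [← Finset.sum_smul, h1, Matrix.one_apply, ite_smul, one_smul, zero_smul, Finset.sum_ite_eq, Finset.mem_univ, if_true]

theorem Lin.tm_Y (H : Lin w R a φ χ ρ1 ρ2) {ε ε' : Pm n} (hε : ε ∈ ball (0 : Pm n) ρ2) (hε' : ε' ∈ ball (0 : Pm n) ρ2) {v : Ev m}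
    (hv : v ∈ Vs φ ρ1 ρ2 ε) (i : Fin p) : fderiv ℂ (Tm φ χ ε ε') v (Yf w R i (v, ε)) =
      ∑ j, ((Matrix.of (Am a (v, ε)))⁻¹ * Matrix.of (Am a (Tm φ χ ε ε' v, ε'))) i j • Yf w R j (Tm φ χ ε ε' v, ε') := by
  rw [Y_of_Z (a := a) (H.det _ (H.mem hε hv.1)) i, map_sum]
  simp only [map_smul, H.tm_Z hε hε' hv, Matrix.mul_apply, Finset.sum_smul]
  rw [Finset.sum_comm]
  refine Finset.sum_congr rfl fun j _ => ?_
  have h2 : Zf w R a j (Tm φ χ ε ε' v, ε') = ∑ l, Am a (Tm φ χ ε ε' v, ε') j l • Yf w R l (Tm φ χ ε ε' v, ε') := rfl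
  rw [h2, Finset.smul_sum]
  refine Finset.sum_congr rfl fun l _ => ?_
  rw [smul_smul]; rfl

theorem Lin.am_fd (H : Lin w R a φ χ ρ1 ρ2) {ε : Pm n} (hε : ε ∈ ball (0 : Pm n) ρ2) {v : Ev m} (hv : v ∈ ball (0 : Ev m) ρ1) :
    DifferentiableAt ℂ (fun v => Am a (v, ε)) v ∧ ∀ l, fderiv ℂ (fun v => Am a (v, ε)) v (Yf w R l (v, ε)) = 0 := by
  have h1 : HasFDerivAt (fun v => Am a (v, ε)) (ContinuousLinearMap.pi fun i =>
      (fderiv ℂ (a i) (v, ε)).comp (ContinuousLinearMap.inl ℂ (Ev m) (Pm n))) v :=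
    hasFDerivAt_pi.2 fun i => slice_fd (H.aan i _ (H.mem hε hv)).differentiableAt
  refine ⟨h1.differentiableAt, fun l => ?_⟩
  rw [h1.fderiv]
  funext i
  exact H.inv i l _ (H.mem hε hv)

end

end Rig

end

section
open scoped BigOperators
open MeasureTheory Set Filter Topology Metric Asymptotics

namespace Rig

noncomputable section
variable {m p n q : ℕ}

theorem Sys.rigid {w : Fin p → Fin m → ℤ} {R : Fin p → Ev m × Pm n → Ev m} {f : Fin q → Ev m × Pm n → ℂ}
    {e0 : ℝ} {v0 : Ev m} (h : Sys w R f e0 v0) (hz : ∀ i (s : ℂ), ‖s‖ < e0 → Yf w R i (0, (s, 0)) = 0) :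
    ∃ s0 : ℂ, s0 ≠ 0 ∧ ‖s0‖ < e0 ∧ ∃ ρ > 0, ρ ≤ e0 ∧ ∃ ζ : (Fin n → ℂ) → Ev m, AnalyticOnNhd ℂ ζ (ball 0 ρ) ∧ ζ 0 = 0 ∧
      ∀ η ∈ ball (0 : Fin n → ℂ) ρ, (∀ i, Yf w R i (ζ η, (s0, η)) = 0) ∧
        ∃ V W : Set (Ev m), IsOpen V ∧ V ⊆ ball 0 1 ∧ ζ η ∈ V ∧ IsOpen W ∧ W ⊆ ball 0 1 ∧ (0 : Ev m) ∈ W ∧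
        ∃ T S : Ev m → Ev m, DifferentiableOn ℂ T V ∧ DifferentiableOn ℂ S W ∧ MapsTo T V W ∧ MapsTo S W V ∧
          (∀ x ∈ V, S (T x) = x) ∧ (∀ y ∈ W, T (S y) = y) ∧ T (ζ η) = 0 ∧
          ∃ g : Fin p → Fin p → Ev m → ℂ, (∀ i j, DifferentiableOn ℂ (g i j) W) ∧
            (∀ y ∈ W, (Matrix.of fun i j => g i j y).det ≠ 0) ∧
            (∀ i j l, ∀ y ∈ W, fderiv ℂ (g i j) y (Yf w R l (y, (s0, 0))) = 0) ∧
            (∀ i, ∀ x ∈ V, fderiv ℂ T x (Yf w R i (x, (s0, η))) = ∑ j, g i j (T x) • Yf w R j (T x, (s0, 0))) := by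
  obtain ⟨a, φ, χ, ρ1, ρ2, hρ1, hρe, hφ0, H⟩ := h.lin
  have hρ1p : 0 < ρ1 := H.pos2.trans_le H.le
  have hc : ContinuousAt (fun ε : Pm n => φ (0, ε)) 0 :=
    ContinuousAt.comp (g := φ) (f := fun ε : Pm n => ((0 : Ev m), ε)) (H.φan 0 (mem_Dom_zero hρ1p hρ1p)).continuousAt (by fun_prop)
  have hev : ∀ᶠ ε in 𝓝 (0 : Pm n), φ (0, ε) ∈ ball (0 : Ev m) ρ2 :=
    hc.eventually_mem (by show ball (0 : Ev m) ρ2 ∈ 𝓝 (φ 0); rw [hφ0]; exact ball_mem_nhds _ H.pos2)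
  obtain ⟨d, hd, hdd⟩ := Metric.mem_nhds_iff.1 hev
  have hρ : 0 < min d ρ2 := lt_min hd H.pos2
  set ρ := min d ρ2 with hρd
  have hρ2 : ρ ≤ ρ2 := min_le_right _ _
  have hρe0 : ρ ≤ e0 := hρ2.trans (H.le.trans hρe)
  have hs0n : ‖((ρ / 2 : ℝ) : ℂ)‖ = ρ / 2 := by
    rw [Complex.norm_real, Real.norm_of_nonneg (by positivity)]
  refine ⟨((ρ / 2 : ℝ) : ℂ), by simpa using hρ.ne', by rw [hs0n]; linarith, ρ, hρ, hρe0,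
    fun η => χ (φ (0, (((ρ / 2 : ℝ) : ℂ), 0)), (((ρ / 2 : ℝ) : ℂ), η)), ?_⟩
  set s0 : ℂ := ((ρ / 2 : ℝ) : ℂ) with hs0
  have hεm : ∀ η ∈ ball (0 : Fin n → ℂ) ρ, ((s0, η) : Pm n) ∈ ball (0 : Pm n) ρ := by
    intro η hη
    rw [mem_ball_zero_iff, Prod.norm_def]
    refine max_lt ?_ (mem_ball_zero_iff.1 hη)
    show ‖s0‖ < ρ
    rw [hs0n]; linarith
  have hεm2 : ∀ η ∈ ball (0 : Fin n → ℂ) ρ, ((s0, η) : Pm n) ∈ ball (0 : Pm n) ρ2 := fun η hη => ball_subset_ball hρ2 (hεm η hη)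
  have h00 : (0 : Fin n → ℂ) ∈ ball (0 : Fin n → ℂ) ρ := mem_ball_self hρ
  have hε0 := hεm2 0 h00
  have hy0 : φ (0, (s0, 0)) ∈ ball (0 : Ev m) ρ2 := hdd (ball_subset_ball (min_le_left _ _) (hεm 0 h00))
  have h0V : (0 : Ev m) ∈ Vs φ ρ1 ρ2 (s0, 0) := ⟨mem_ball_self hρ1p, hy0⟩
  refine ⟨analytic_of_diff isOpen_ball fun η hη => ?_, H.linv (0, (s0, 0)) (H.mem hε0 (mem_ball_self hρ1p)), fun η hη => ?_⟩
  · refine DifferentiableAt.differentiableWithinAt ?_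
    exact DifferentiableAt.comp (g := χ) (f := fun η => (φ (0, (s0, 0)), (s0, η))) η
      (H.χan (φ (0, (s0, 0)), (s0, η)) ⟨hy0, hεm2 η hη⟩).differentiableAt (by fun_prop)
  have hε := hεm2 η hη
  have hζV : χ (φ (0, (s0, 0)), (s0, η)) ∈ Vs φ ρ1 ρ2 (s0, η) := H.mapsTo (ε := (s0, 0)) hε h0V
  have hY0 : ∀ i, Yf w R i (0, (s0, 0)) = 0 := fun i => hz i s0 (by rw [hs0n]; linarith)
  have hZ0 : ∀ i, Zf w R a i (0, (s0, 0)) = 0 := fun i => Finset.sum_eq_zero fun l _ => by rw [hY0 l, smul_zero]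
  refine ⟨fun i => ?_, Vs φ ρ1 ρ2 (s0, η), Vs φ ρ1 ρ2 (s0, 0), H.open_Vs hε, fun v hv => ball_subset_ball hρ1 hv.1, hζV,
    H.open_Vs hε0, fun v hv => ball_subset_ball hρ1 hv.1, h0V, Tm φ χ (s0, η) (s0, 0), Tm φ χ (s0, 0) (s0, η),
    fun v hv => (H.tm_fd hε hε0 hv).differentiableAt.differentiableWithinAt,
    fun v hv => (H.tm_fd hε0 hε hv).differentiableAt.differentiableWithinAt, H.mapsTo hε0, H.mapsTo hε,
    fun x hx => H.tm_inv hε hε0 hx, fun x hx => H.tm_inv hε0 hε hx, H.tm_inv hε0 hε h0V,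
    fun i j y => ((Matrix.of (Am a (Tm φ χ (s0, 0) (s0, η) y, (s0, η))))⁻¹ * Matrix.of (Am a (y, (s0, 0)))) i j, ?_⟩
  · show Yf w R i (Tm φ χ (s0, 0) (s0, η) 0, (s0, η)) = 0
    change Tm φ χ (s0, 0) (s0, η) 0 ∈ _ at hζV
    rw [Y_of_Z (a := a) (H.det _ (H.mem hε hζV.1)) i]
    refine Finset.sum_eq_zero fun j _ => ?_
    rw [← H.tm_Z hε0 hε h0V j, hZ0 j, map_zero, smul_zero]
  have hcomp : ∀ y ∈ Vs φ ρ1 ρ2 (s0, 0), HasFDerivAt (fun y => Am a (Tm φ χ (s0, 0) (s0, η) y, (s0, η)))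
      ((fderiv ℂ (fun v => Am a (v, (s0, η))) (Tm φ χ (s0, 0) (s0, η) y)).comp (fderiv ℂ (Tm φ χ (s0, 0) (s0, η)) y)) y := by
    intro y hy
    exact HasFDerivAt.comp (g := fun v => Am a (v, (s0, η))) (f := Tm φ χ (s0, 0) (s0, η)) y
      (H.am_fd hε (H.mapsTo hε hy).1).1.hasFDerivAt (H.tm_fd hε0 hε hy).differentiableAt.hasFDerivAt
  have hmd := fun y (hy : y ∈ Vs φ ρ1 ρ2 (s0, 0)) i j => mat_diff (hcomp y hy).differentiableAt (H.am_fd hε0 hy.1).1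
    (H.det _ (H.mem hε (H.mapsTo hε hy).1)) i j
  refine ⟨fun i j y hy => (hmd y hy i j).1.differentiableWithinAt, fun y hy => ?_, fun i j l y hy => ?_, fun i x hx => ?_⟩
  · show (Matrix.det ((Matrix.of (Am a (Tm φ χ (s0, 0) (s0, η) y, (s0, η))))⁻¹ * Matrix.of (Am a (y, (s0, 0))))) ≠ 0
    rw [Matrix.det_mul]
    refine mul_ne_zero ?_ (H.det _ (H.mem hε0 hy.1))
    have := H.det _ (H.mem hε (H.mapsTo hε hy).1)
    rw [Matrix.det_nonsing_inv, Ring.inverse_eq_inv']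
    exact inv_ne_zero this
  · refine (hmd y hy i j).2 _ ?_ ((H.am_fd hε0 hy.1).2 l)
    rw [(hcomp y hy).fderiv, ContinuousLinearMap.comp_apply, H.tm_Y hε0 hε hy, map_sum]
    refine Finset.sum_eq_zero fun k _ => ?_
    rw [map_smul, (H.am_fd hε (H.mapsTo hε hy).1).2 k, smul_zero]
  · rw [H.tm_Y hε hε0 hx]
    refine Finset.sum_congr rfl fun j _ => ?_
    show _ = ((Matrix.of (Am a (Tm φ χ (s0, 0) (s0, η) (Tm φ χ (s0, η) (s0, 0) x), (s0, η))))⁻¹ * Matrix.of (Am a (Tm φ χ (s0, η) (s0, 0) x, (s0, 0)))) i j • _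
    rw [H.tm_inv hε hε0 hx]

end

end Rig

end

section
open scoped BigOperators
open MeasureTheory Set Filter Topology Metric Asymptotics

namespace Rig

noncomputable section
variable {m p n q : ℕ}

theorem lead {F : Type} [NormedAddCommGroup F] [NormedSpace ℂ F] [CompleteSpace F] {f : Ev m → F} {z : Ev m} (hf : AnalyticAt ℂ f z)
    {k : ℕ} (hlow : ∀ l < k, iteratedFDeriv ℂ l f z = 0) :
    (fun y => f (z + y) - ((k.factorial : ℂ)⁻¹ • iteratedFDeriv ℂ k f z (fun _ => y))) =O[𝓝 0] fun y => ‖y‖ ^ (k+1) := by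
  obtain ⟨P, hP⟩ := hf
  obtain ⟨r, hr⟩ := hP
  have h1 := HasFPowerSeriesAt.isBigO_sub_partialSum_pow ⟨r, hr⟩ (k+1)
  have h2 : ∀ l y, P l (fun _ => y) = ((l.factorial : ℂ)⁻¹ • iteratedFDeriv ℂ l f z (fun _ => y)) := by
    intro l y
    rw [← hr.factorial_smul y l, ← Nat.cast_smul_eq_nsmul ℂ, smul_smul, inv_mul_cancel₀ (by exact_mod_cast l.factorial_ne_zero), one_smul]
  refine h1.congr_left fun y => ?_
  congr 1
  rw [FormalMultilinearSeries.partialSum, Finset.sum_range_succ, h2 k, Finset.sum_eq_zero, zero_add]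
  intro l hl
  rw [h2 l, hlow l (Finset.mem_range.1 hl)]
  simp

def Qm (z : Ev m) (M : ℕ) (x : Ev m × Pm n) : Ev m × (Fin n → ℂ) := (z + x.2.1 • x.1, x.2.1 ^ M • x.2.2)

theorem Dom_star {r e : ℝ} : ∀ x ∈ Dom m n r e, ∀ u ∈ Icc (0:ℝ) 1, scl ((u:ℂ), x) ∈ Dom m n r e := by
  intro x hx u hu
  refine ⟨hx.1, ?_⟩
  have h1 : ‖x.2‖ < e := mem_ball_zero_iff.1 hx.2
  rw [mem_ball_zero_iff, Prod.norm_def]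
  rw [Prod.norm_def] at h1
  refine max_lt (lt_of_le_of_lt ?_ (max_lt_iff.1 h1).1) (max_lt_iff.1 h1).2
  show ‖(u:ℂ) * x.2.1‖ ≤ _
  rw [norm_mul, Complex.norm_real, Real.norm_of_nonneg hu.1]
  exact mul_le_of_le_one_left (norm_nonneg _) hu.2

theorem dense_ext {F : Type*} [NormedAddCommGroup F] {h : Ev m × Pm n → F} {r e : ℝ} (hc : ∀ x ∈ Dom m n r e, ContinuousAt h x)
    (h0 : ∀ x ∈ Dom m n r e, x.2.1 ≠ 0 → h x = 0) : ∀ x ∈ Dom m n r e, h x = 0 := by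
  intro x hx
  by_cases hs : x.2.1 = 0
  swap
  · exact h0 x hx hs
  obtain ⟨u, s, η⟩ := x
  change s = 0 at hs
  subst hs
  have h1 : ContinuousAt (fun t : ℂ => (u, (t, η))) (0 : ℂ) := by fun_prop
  have h2 : Tendsto (fun t : ℂ => h (u, (t, η))) (𝓝[≠] 0) (𝓝 (h (u, (0, η)))) :=
    (ContinuousAt.comp (g := h) (f := fun t : ℂ => (u, (t, η))) (hc _ hx) h1).tendsto.mono_left nhdsWithin_le_nhds
  have h3 : (fun t : ℂ => h (u, (t, η))) =ᶠ[𝓝[≠] 0] fun _ => 0 := by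
    filter_upwards [self_mem_nhdsWithin, nhdsWithin_le_nhds (h1.eventually_mem ((isOpen_Dom r e).mem_nhds hx))] with t ht ht2
    exact h0 _ ht2 ht
  exact tendsto_nhds_unique h2 (tendsto_const_nhds.congr' h3.symm)

theorem blow1 {F : Type} [NormedAddCommGroup F] [NormedSpace ℂ F] [CompleteSpace F] {U : Set (Ev m)} {Θ : Set (Fin n → ℂ)}
    {H : Ev m → (Fin n → ℂ) → F} (hH : AnalyticOnNhd ℂ (fun x : Ev m × (Fin n → ℂ) => H x.1 x.2) (U ×ˢ Θ))
    {z : Ev m} (hz : z ∈ U) (h0 : (0 : Fin n → ℂ) ∈ Θ) {k M : ℕ} (hM : k + 1 ≤ M)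
    (hlow : ∀ l < k, iteratedFDeriv ℂ l (fun y => H y 0) z = 0) {r e : ℝ}
    (hQ : ∀ x ∈ Dom m n r e, Qm z M x ∈ U ×ˢ Θ) :
    ∃ h : Ev m × Pm n → F, AnalyticOnNhd ℂ h (Dom m n r e) ∧
      (∀ x ∈ Dom m n r e, H (z + x.2.1 • x.1) (x.2.1 ^ M • x.2.2) = x.2.1 ^ k • h x) ∧
      (∀ x ∈ Dom m n r e, x.2.1 = 0 → h x = (k.factorial : ℂ)⁻¹ • iteratedFDeriv ℂ k (fun y => H y 0) z (fun _ => x.1)) ∧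
      (∀ x ∈ Dom m n r e, ∀ d, x.2.1 ^ k • fderiv ℂ h x (d, 0) =
        x.2.1 • fderiv ℂ (fun y => H y (x.2.1 ^ M • x.2.2)) (z + x.2.1 • x.1) d) := by
  set Hc : Ev m × (Fin n → ℂ) → F := fun x => H x.1 x.2 with hHc
  set G : Ev m → F := fun y => (k.factorial : ℂ)⁻¹ • iteratedFDeriv ℂ k (fun y => H y 0) z (fun _ => y) with hG
  have hQd : Differentiable ℂ (Qm z M : Ev m × Pm n → _) := by unfold Qm; fun_prop
  have han : AnalyticOnNhd ℂ (fun x => Hc (Qm z M x)) (Dom m n r e) := by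
    refine analytic_of_diff (isOpen_Dom r e) fun x hx => DifferentiableAt.differentiableWithinAt ?_
    exact DifferentiableAt.comp (g := Hc) (f := Qm z M) x (hH _ (hQ x hx)).differentiableAt (hQd x)
  have hHz : AnalyticAt ℂ (fun y => H y 0) z :=
    AnalyticAt.comp (g := Hc) (f := fun y => (y, (0 : Fin n → ℂ))) (hH (z, 0) ⟨hz, h0⟩) (anal (by fun_prop) z)
  have hld := lead hHz hlow
  have hGs : ∀ (c : ℂ) y, G (c • y) = c ^ k • G y := by
    intro c y
    have := (iteratedFDeriv ℂ k (fun y => H y 0) z).map_smul_univ (fun _ => c) (fun _ => y)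
    simp only [hG]
    rw [this, smul_comm]
    simp
  have key : ∀ (u : Ev m) (η : Fin n → ℂ), (fun s : ℂ => Hc (Qm z M (u, (s, η))) - s ^ k • G u) =O[𝓝 0] fun s : ℂ => s ^ (k+1) := by
    intro u η
    have t1 : Tendsto (fun s : ℂ => s • u) (𝓝 0) (𝓝 0) := by
      have : ContinuousAt (fun s : ℂ => s • u) 0 := by fun_prop
      simpa [ContinuousAt] using this
    have k1 : (fun s : ℂ => H (z + s • u) 0 - s ^ k • G u) =O[𝓝 0] fun s : ℂ => s ^ (k+1) := by
      have h1 := hld.comp_tendsto t1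
      have h2 : (fun s : ℂ => H (z + s • u) 0 - s ^ k • G u) =O[𝓝 0] fun s : ℂ => ‖s • u‖ ^ (k+1) := by
        refine h1.congr_left fun s => ?_
        show H (z + s • u) 0 - G (s • u) = _
        rw [hGs]
      refine h2.trans (IsBigO.of_bound (‖u‖ ^ (k+1)) (Eventually.of_forall fun s => ?_))
      rw [norm_pow, norm_norm, norm_smul, norm_pow, mul_pow, mul_comm]
    have k2 : (fun s : ℂ => Hc (Qm z M (u, (s, η))) - H (z + s • u) 0) =O[𝓝 0] fun s : ℂ => s ^ (k+1) := by
      have hst := (hH (z, 0) ⟨hz, h0⟩).hasStrictFDerivAt.isBigO_sub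
      have t2 : Tendsto (fun s : ℂ => (Qm z M (u, (s, η)), (z + s • u, (0 : Fin n → ℂ)))) (𝓝 0) (𝓝 ((z, 0), (z, 0))) := by
        have c1 : ContinuousAt (fun s : ℂ => (Qm z M (u, (s, η)), (z + s • u, (0 : Fin n → ℂ)))) 0 := by
          unfold Qm; fun_prop
        have c2 := c1.tendsto
        have hM0 : M ≠ 0 := by omega
        simpa [Qm, hM0] using c2
      have h1 := hst.comp_tendsto t2
      have h2 : (fun s : ℂ => Hc (Qm z M (u, (s, η))) - H (z + s • u) 0) =O[𝓝 0]
          fun s : ℂ => Qm z M (u, (s, η)) - (z + s • u, (0 : Fin n → ℂ)) := h1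
      refine h2.trans (IsBigO.of_bound ‖η‖ ?_)
      filter_upwards [ball_mem_nhds (0:ℂ) one_pos] with s hs
      have hs1 : ‖s‖ ≤ 1 := (mem_ball_zero_iff.1 hs).le
      have : Qm z M (u, (s, η)) - (z + s • u, (0 : Fin n → ℂ)) = (0, s ^ M • η) := by
        simp [Qm]
      rw [this, Prod.norm_def]
      simp only [norm_zero, norm_smul, norm_pow]
      rw [max_eq_right (by positivity), mul_comm]
      gcongr ‖η‖ * ?_
      exact pow_le_pow_of_le_one (norm_nonneg _) hs1 hM
    refine (k2.add k1).congr_left fun s => by abel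
  obtain ⟨h, hh, hhe⟩ := division_pow k (isOpen_Dom r e) Dom_star han (by
    intro u η _
    have h1 := key u η
    have h2 : (fun s : ℂ => s ^ (k+1)) =O[𝓝 0] fun s : ℂ => s ^ k := by
      refine IsBigO.of_bound 1 ?_
      filter_upwards [ball_mem_nhds (0:ℂ) one_pos] with s hs
      have hs1 : ‖s‖ ≤ 1 := (mem_ball_zero_iff.1 hs).le
      rw [one_mul, norm_pow, norm_pow]
      exact pow_le_pow_of_le_one (norm_nonneg _) hs1 (by omega)
    have h3 : (fun s : ℂ => s ^ k • G u) =O[𝓝 0] fun s : ℂ => s ^ k := by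
      refine IsBigO.of_bound ‖G u‖ (Eventually.of_forall fun s => ?_)
      rw [norm_smul, mul_comm]
    have h4 : (fun s : ℂ => Hc (Qm z M (u, (s, η)))) =O[𝓝 0] fun s : ℂ => s ^ k :=
      ((h1.trans h2).add h3).congr_left fun s => by abel
    exact h4.mono nhdsWithin_le_nhds)
  have hhe' : ∀ x ∈ Dom m n r e, H (z + x.2.1 • x.1) (x.2.1 ^ M • x.2.2) = x.2.1 ^ k • h x := hhe
  refine ⟨h, hh, hhe', ?_, ?_⟩
  · intro x hx hs
    obtain ⟨u, s, η⟩ := x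
    change s = 0 at hs
    subst hs
    have h1 : ContinuousAt (fun t : ℂ => (u, (t, η))) (0 : ℂ) := by fun_prop
    have h2 : Tendsto (fun t : ℂ => h (u, (t, η)) - G u) (𝓝[≠] 0) (𝓝 (h (u, (0, η)) - G u)) :=
      ((ContinuousAt.comp (g := h) (f := fun t : ℂ => (u, (t, η))) (hh _ hx).continuousAt h1).tendsto.sub_const _).mono_left nhdsWithin_le_nhds
    obtain ⟨C, hC⟩ := (key u η).bound
    have h3 : ∀ᶠ t in 𝓝[≠] (0:ℂ), ‖h (u, (t, η)) - G u‖ ≤ C * ‖t‖ := by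
      filter_upwards [self_mem_nhdsWithin, nhdsWithin_le_nhds hC,
        nhdsWithin_le_nhds (h1.eventually_mem ((isOpen_Dom r e).mem_nhds hx))] with t ht htC ht2
      have ht0 : t ≠ 0 := ht
      have h4 : Hc (Qm z M (u, (t, η))) = t ^ k • h (u, (t, η)) := hhe _ ht2
      rw [h4, ← smul_sub, norm_smul, norm_pow, norm_pow, pow_succ] at htC
      have h5 : 0 < ‖t‖ ^ k := pow_pos (norm_pos_iff.2 ht0) _
      refine le_of_mul_le_mul_left ?_ h5
      calc _ ≤ _ := htC
        _ = _ := by ring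
    have h4 : Tendsto (fun t : ℂ => C * ‖t‖) (𝓝[≠] 0) (𝓝 0) := by
      have : ContinuousAt (fun t : ℂ => C * ‖t‖) 0 := by fun_prop
      have h5 := this.tendsto.mono_left (nhdsWithin_le_nhds (s := {0}ᶜ))
      simpa using h5
    have h5 := squeeze_zero_norm' h3 h4
    exact sub_eq_zero.1 (tendsto_nhds_unique h2 h5)
  · intro x hx d
    have hx2 : Qm z M x ∈ U ×ˢ Θ := hQ x hx
    have hHd : DifferentiableAt ℂ (fun y => H y (x.2.1 ^ M • x.2.2)) (z + x.2.1 • x.1) :=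
      DifferentiableAt.comp (g := Hc) (f := fun y => (y, x.2.1 ^ M • x.2.2)) _ (hH _ hx2).differentiableAt (by fun_prop)
    have a1 : HasFDerivAt (fun v : Ev m => z + x.2.1 • v) (x.2.1 • ContinuousLinearMap.id ℂ (Ev m)) x.1 :=
      ((hasFDerivAt_id x.1).const_smul x.2.1).const_add z
    have a2 : HasFDerivAt (fun v : Ev m => H (z + x.2.1 • v) (x.2.1 ^ M • x.2.2)) _ x.1 :=
      HasFDerivAt.comp (g := fun y => H y (x.2.1 ^ M • x.2.2)) (f := fun v : Ev m => z + x.2.1 • v) x.1 hHd.hasFDerivAt a1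
    have a3 : HasFDerivAt (fun v : Ev m => x.2.1 ^ k • h (v, x.2)) _ x.1 :=
      (slice_fd (v := x.1) (ε := x.2) (hh x hx).differentiableAt).const_smul (x.2.1 ^ k)
    have a4 : (fun v : Ev m => H (z + x.2.1 • v) (x.2.1 ^ M • x.2.2)) =ᶠ[𝓝 x.1] fun v : Ev m => x.2.1 ^ k • h (v, x.2) := by
      filter_upwards [isOpen_ball.mem_nhds hx.1] with v hv
      exact hhe' (v, x.2) ⟨hv, hx.2⟩
    have a5 := congrArg (fun T : Ev m →L[ℂ] F => T d) (a3.unique (a2.congr_of_eventuallyEq a4.symm))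
    have a6 : x.2.1 ^ k • fderiv ℂ h x (d, 0) = fderiv ℂ (fun y => H y (x.2.1 ^ M • x.2.2)) (z + x.2.1 • x.1) (x.2.1 • d) := a5
    rw [a6, map_smul]

end

end Rig

end

section
open scoped BigOperators
open MeasureTheory Set Filter Topology Metric Asymptotics

namespace Rig

noncomputable section
variable {m p n q : ℕ}

theorem Qm_mem {U : Set (Ev m)} (hU : IsOpen U) {z : Ev m} (hz : z ∈ U) {Θ : Set (Fin n → ℂ)} (hΘ : IsOpen Θ)
    (h0 : (0 : Fin n → ℂ) ∈ Θ) (M : ℕ) {r : ℝ} (hr : 0 < r) :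
    ∃ e > 0, e ≤ 1 ∧ ∀ x ∈ Dom m n r e, Qm z M x ∈ U ×ˢ Θ := by
  obtain ⟨d1, hd1, h1⟩ := Metric.isOpen_iff.1 hU z hz
  obtain ⟨d2, hd2, h2⟩ := Metric.isOpen_iff.1 hΘ 0 h0
  refine ⟨min 1 (min (d1 / r) d2), lt_min one_pos (lt_min (by positivity) hd2), min_le_left _ _, fun x hx => ⟨h1 ?_, h2 ?_⟩⟩
  · have ha : ‖x.2.1‖ < d1 / r := (norm_fst_le x.2).trans_lt ((mem_ball_zero_iff.1 hx.2).trans_le ((min_le_right _ _).trans (min_le_left _ _)))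
    have hb : ‖x.1‖ < r := mem_ball_zero_iff.1 hx.1
    rw [mem_ball_iff_norm]
    show ‖z + x.2.1 • x.1 - z‖ < d1
    rw [add_sub_cancel_left, norm_smul]
    calc ‖x.2.1‖ * ‖x.1‖ ≤ ‖x.2.1‖ * r := by gcongr
      _ < d1 / r * r := by gcongr
      _ = d1 := by field_simp
  · have ha : ‖x.2.1‖ ≤ 1 := (norm_fst_le x.2).trans ((mem_ball_zero_iff.1 hx.2).le.trans (min_le_left _ _))
    have hb : ‖x.2.2‖ < d2 := (norm_snd_le x.2).trans_lt ((mem_ball_zero_iff.1 hx.2).trans_le ((min_le_right _ _).trans (min_le_right _ _)))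
    rw [mem_ball_zero_iff]
    show ‖x.2.1 ^ M • x.2.2‖ < d2
    rw [norm_smul, norm_pow]
    calc _ ≤ 1 * ‖x.2.2‖ := by gcongr; exact pow_le_one₀ (norm_nonneg _) ha
      _ < d2 := by rwa [one_mul]

structure Blow (z : Ev m) (U : Set (Ev m)) (Θ : Set (Fin n → ℂ)) (X : Fin p → Ev m → (Fin n → ℂ) → Ev m)
    (A : Fin p → Matrix (Fin m) (Fin m) ℂ) (G : Fin q → Ev m → ℂ) (M : ℕ) (r e : ℝ)
    (g : Fin p → Ev m × Pm n → Ev m) (f : Fin q → Ev m × Pm n → ℂ) : Prop where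
  pos : 0 < e
  le1 : e ≤ 1
  Q : ∀ x ∈ Dom m n r e, Qm z M x ∈ U ×ˢ Θ
  gan : ∀ i, AnalyticOnNhd ℂ (g i) (Dom m n r e)
  fan : ∀ j, AnalyticOnNhd ℂ (f j) (Dom m n r e)
  gX : ∀ i, ∀ x ∈ Dom m n r e, X i (z + x.2.1 • x.1) (x.2.1 ^ M • x.2.2) = x.2.1 • g i x
  g0 : ∀ i, ∀ x ∈ Dom m n r e, x.2.1 = 0 → g i x = (A i).mulVec x.1
  f0 : ∀ j, ∀ x ∈ Dom m n r e, x.2.1 = 0 → f j x = G j x.1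
  comm : ∀ i l, ∀ x ∈ Dom m n r e, fderiv ℂ (g i) x (g l x, 0) = fderiv ℂ (g l) x (g i x, 0)
  fint : ∀ j i, ∀ x ∈ Dom m n r e, fderiv ℂ (f j) x (g i x, 0) = 0

theorem blowup {U : Set (Fin m → ℂ)} (hUopen : IsOpen U) {z₀ : Fin m → ℂ} (hz₀ : z₀ ∈ U)
    {Θ : Set (Fin n → ℂ)} (hΘopen : IsOpen Θ) (hΘ0 : (0 : Fin n → ℂ) ∈ Θ)
    {X : Fin p → (Fin m → ℂ) → (Fin n → ℂ) → (Fin m → ℂ)}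
    {F : Fin q → (Fin m → ℂ) → (Fin n → ℂ) → ℂ}
    (hXan : ∀ i, AnalyticOnNhd ℂ (fun w : (Fin m → ℂ) × (Fin n → ℂ) => X i w.1 w.2) (U ×ˢ Θ))
    (hFan : ∀ j, AnalyticOnNhd ℂ (fun w : (Fin m → ℂ) × (Fin n → ℂ) => F j w.1 w.2) (U ×ˢ Θ))
    (hcomm : ∀ θ ∈ Θ, ∀ i j, ∀ x ∈ U,
      fderiv ℂ (fun y => X j y θ) x (X i x θ) - fderiv ℂ (fun y => X i y θ) x (X j x θ) = 0)
    (hFint : ∀ θ ∈ Θ, ∀ i j, ∀ x ∈ U, fderiv ℂ (fun y => F j y θ) x (X i x θ) = 0)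
    (hfix : ∀ i, X i z₀ 0 = 0)
    {A : Fin p → Matrix (Fin m) (Fin m) ℂ}
    (hA : ∀ i v, (A i).mulVec v = fderiv ℂ (fun y => X i y 0) z₀ v)
    {k : Fin q → ℕ} {G : Fin q → (Fin m → ℂ) → ℂ}
    (hklow : ∀ j, ∀ l < k j, iteratedFDeriv ℂ l (fun y => F j y 0) z₀ = 0)
    (hG : ∀ j x, G j x = (((k j).factorial : ℂ))⁻¹ •
      iteratedFDeriv ℂ (k j) (fun y => F j y 0) z₀ (fun _ => x))
    {M : ℕ} (hM : ∀ j, k j + 1 ≤ M) (hM2 : 2 ≤ M) {r : ℝ} (hr : 0 < r) :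
    ∃ e g f, Blow z₀ U Θ X A G M r e g f := by
  obtain ⟨e, he, he1, hQ⟩ := Qm_mem hUopen hz₀ hΘopen hΘ0 M hr
  choose g g1 g2 g3 g4 using fun i => blow1 (hXan i) hz₀ hΘ0 (k := 1) hM2 (by
    intro l hl
    obtain rfl : l = 0 := by omega
    ext v
    rw [iteratedFDeriv_zero_apply, hfix]; rfl) hQ
  choose f f1 f2 f3 f4 using fun j => blow1 (hFan j) hz₀ hΘ0 (hM j) (hklow j) hQ
  simp only [pow_one] at g2 g4
  refine ⟨e, g, f, he, he1, hQ, g1, f1, g2, ?_, fun j x hx hs => by rw [f3 j x hx hs, hG], ?_, ?_⟩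
  · intro i x hx hs
    rw [g3 i x hx hs, hA, iteratedFDeriv_one_apply]
    simp
  · intro i l x hx
    rw [← sub_eq_zero]
    refine dense_ext (h := fun x => fderiv ℂ (g i) x (g l x, 0) - fderiv ℂ (g l) x (g i x, 0)) ?_ ?_ x hx
    · intro x hx
      refine ContinuousAt.sub ?_ ?_
      · exact ((g1 i).fderiv x hx).continuousAt.clm_apply ((g1 l x hx).continuousAt.prodMk continuousAt_const)
      · exact ((g1 l).fderiv x hx).continuousAt.clm_apply ((g1 i x hx).continuousAt.prodMk continuousAt_const)
    · intro x hx hs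
      have h1 := hcomm _ (hQ x hx).2 l i _ (hQ x hx).1
      change fderiv ℂ (fun y => X i y (x.2.1 ^ M • x.2.2)) (z₀ + x.2.1 • x.1) (X l (z₀ + x.2.1 • x.1) (x.2.1 ^ M • x.2.2)) -
        fderiv ℂ (fun y => X l y (x.2.1 ^ M • x.2.2)) (z₀ + x.2.1 • x.1) (X i (z₀ + x.2.1 • x.1) (x.2.1 ^ M • x.2.2)) = 0 at h1
      rw [g2 l x hx, g2 i x hx, map_smul, map_smul, ← g4 i x hx, ← g4 l x hx, ← smul_sub] at h1
      exact (smul_eq_zero.1 h1).resolve_left hs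
  · intro j i x hx
    refine dense_ext (h := fun x => fderiv ℂ (f j) x (g i x, 0)) ?_ ?_ x hx
    · intro x hx
      exact ((f1 j).fderiv x hx).continuousAt.clm_apply ((g1 i x hx).continuousAt.prodMk continuousAt_const)
    · intro x hx hs
      have h1 := hFint _ (hQ x hx).2 i j _ (hQ x hx).1
      change fderiv ℂ (fun y => F j y (x.2.1 ^ M • x.2.2)) (z₀ + x.2.1 • x.1) (X i (z₀ + x.2.1 • x.1) (x.2.1 ^ M • x.2.2)) = 0 at h1
      rw [g2 i x hx, map_smul, ← f4 j x hx] at h1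
      exact (smul_eq_zero.1 h1).resolve_left (pow_ne_zero _ hs)

variable {z : Ev m} {U : Set (Ev m)} {Θ : Set (Fin n → ℂ)} {X : Fin p → Ev m → (Fin n → ℂ) → Ev m}
    {A : Fin p → Matrix (Fin m) (Fin m) ℂ} {G : Fin q → Ev m → ℂ} {M : ℕ} {r e : ℝ}
    {g : Fin p → Ev m × Pm n → Ev m} {f : Fin q → Ev m × Pm n → ℂ}

theorem Blow.mem (H : Blow z U Θ X A G M r e g f) {u : Ev m} (hu : ‖u‖ < r) : ((u, 0) : Ev m × Pm n) ∈ Dom m n r e :=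
  ⟨mem_ball_zero_iff.2 hu, mem_ball_self H.pos⟩

theorem Blow.g_fd (H : Blow z U Θ X A G M r e g f) {u : Ev m} (hu : ‖u‖ < r) (i : Fin p) (d : Ev m) :
    fderiv ℂ (g i) (u, 0) (d, 0) = (A i).mulVec d := by
  have h1 := slice_fd (H.gan i _ (H.mem hu)).differentiableAt
  have h2 : HasFDerivAt (fun v : Ev m => (A i).mulVec v) (LinearMap.toContinuousLinearMap (Matrix.mulVecLin (A i))) u :=
    (LinearMap.toContinuousLinearMap (Matrix.mulVecLin (A i))).hasFDerivAt
  have h3 : (fun v : Ev m => g i (v, (0 : Pm n))) =ᶠ[𝓝 u] fun v : Ev m => (A i).mulVec v := by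
    filter_upwards [isOpen_ball.mem_nhds (mem_ball_zero_iff.2 hu)] with v hv
    exact H.g0 i (v, 0) ⟨hv, mem_ball_self H.pos⟩ rfl
  exact congrArg (fun T : Ev m →L[ℂ] Ev m => T d) (h1.unique (h2.congr_of_eventuallyEq h3))

theorem Blow.f_fd (H : Blow z U Θ X A G M r e g f) {u : Ev m} (hu : ‖u‖ < r) (j : Fin q) :
    HasFDerivAt (G j) ((fderiv ℂ (f j) (u, 0)).comp (ContinuousLinearMap.inl ℂ (Ev m) (Pm n))) u := by
  have h1 := slice_fd (H.fan j _ (H.mem hu)).differentiableAt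
  refine h1.congr_of_eventuallyEq ?_
  filter_upwards [isOpen_ball.mem_nhds (mem_ball_zero_iff.2 hu)] with v hv
  exact (H.f0 j (v, 0) ⟨hv, mem_ball_self H.pos⟩ rfl).symm

theorem Blow.A_comm (H : Blow z U Θ X A G M r e g f) {u : Ev m} (hu : ‖u‖ < r) (i l : Fin p) :
    (A i).mulVec ((A l).mulVec u) = (A l).mulVec ((A i).mulVec u) := by
  have h := H.comm i l _ (H.mem hu)
  rwa [H.g_fd hu, H.g_fd hu, H.g0 l _ (H.mem hu) rfl, H.g0 i _ (H.mem hu) rfl] at h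

theorem Blow.G_inv (H : Blow z U Θ X A G M r e g f) {u : Ev m} (hu : ‖u‖ < r) (j : Fin q) (i : Fin p) :
    fderiv ℂ (G j) u ((A i).mulVec u) = 0 := by
  have h := H.fint j i _ (H.mem hu)
  rw [H.g0 i _ (H.mem hu) rfl] at h
  rw [(H.f_fd hu j).fderiv]
  exact h

end

end Rig

end

section
open scoped BigOperators
open MeasureTheory Set Filter Topology Metric Asymptotics

namespace Rig

noncomputable section
variable {m p n q : ℕ}

/-- A spanning subset of `K^m` contains a basis indexed by `Fin m`. -/
theorem basis_in {K : Type*} [Field K] {V : Type*} [AddCommGroup V] [Module K V] [FiniteDimensional K V]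
    {d : ℕ} (hd : Module.finrank K V = d) (S : Set V) (hS : ⊤ ≤ Submodule.span K S) :
    ∃ b : Module.Basis (Fin d) K V, ∀ i, b i ∈ S := by
  let b0 := Module.Basis.ofSpan hS
  haveI : Fintype ((linearIndepOn_empty K id).extend (empty_subset S)) := FiniteDimensional.fintypeBasisIndex b0
  have hc : Fintype.card ((linearIndepOn_empty K id).extend (empty_subset S)) = d := by
    rw [← hd, Module.finrank_eq_card_basis b0]
  let e := Fintype.equivFinOfCardEq hc
  refine ⟨b0.reindex e, fun i => ?_⟩
  rw [Module.Basis.reindex_apply]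
  exact Module.Basis.ofSpan_subset hS ⟨_, rfl⟩

theorem pow_eig (A : Matrix (Fin m) (Fin m) ℂ) (Q : Matrix (Fin m) (Fin m) ℂ) (hQ : IsUnit Q) (d : Fin m → ℂ)
    (hA : A = Q * Matrix.diagonal d * Q⁻¹) (μ : ℂ) (v : Ev m) (k : ℕ)
    (hk : ((A.mulVecLin - μ • (1 : Module.End ℂ (Ev m))) ^ k) v = 0) : A.mulVec v = μ • v := by
  have hQd : IsUnit Q.det := (Matrix.isUnit_iff_isUnit_det Q).1 hQ
  have h1 : Q⁻¹ * A = Matrix.diagonal d * Q⁻¹ := by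
    rw [hA, ← mul_assoc, ← mul_assoc, Matrix.nonsing_inv_mul _ hQd, one_mul]
  have step : ∀ v : Ev m, Q⁻¹.mulVec ((A.mulVecLin - μ • (1 : Module.End ℂ (Ev m))) v)
      = fun l => (d l - μ) * (Q⁻¹.mulVec v) l := by
    intro v
    have : (A.mulVecLin - μ • (1 : Module.End ℂ (Ev m))) v = A.mulVec v - μ • v := by simp
    rw [this, Matrix.mulVec_sub, Matrix.mulVec_smul, Matrix.mulVec_mulVec, h1, ← Matrix.mulVec_mulVec]
    ext l
    rw [Pi.sub_apply, Matrix.mulVec_diagonal, Pi.smul_apply, smul_eq_mul, sub_mul]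
  have hpow : ∀ (k : ℕ) (v : Ev m), Q⁻¹.mulVec (((A.mulVecLin - μ • (1 : Module.End ℂ (Ev m))) ^ k) v)
      = fun l => (d l - μ) ^ k * (Q⁻¹.mulVec v) l := by
    intro k
    induction k with
    | zero => intro v; simp
    | succ k ih =>
      intro v
      rw [pow_succ, Module.End.mul_apply, ih, step]
      ext l; simp only; ring
  have h2 := hpow k v
  rw [hk, Matrix.mulVec_zero] at h2
  have h3 : Q⁻¹.mulVec ((A.mulVecLin - μ • (1 : Module.End ℂ (Ev m))) v) = 0 := by
    rw [step]
    ext l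
    have := congrFun h2 l
    simp only [Pi.zero_apply] at this ⊢
    rcases mul_eq_zero.1 this.symm with h | h
    · rw [eq_zero_of_pow_eq_zero h, zero_mul]
    · rw [h, mul_zero]
  have h4 : (A.mulVecLin - μ • (1 : Module.End ℂ (Ev m))) v = 0 := by
    have := congrArg Q.mulVec h3
    rwa [Matrix.mulVec_mulVec, Matrix.mul_nonsing_inv _ hQd, Matrix.one_mulVec, Matrix.mulVec_zero] at this
  have h5 : A.mulVec v - μ • v = 0 := by simpa using h4
  exact sub_eq_zero.1 h5

theorem simdiag (A : Fin p → Matrix (Fin m) (Fin m) ℂ)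
    (hss : ∀ i, ∃ P : Matrix (Fin m) (Fin m) ℂ, IsUnit P ∧ ∃ d : Fin m → ℂ, A i = P * Matrix.diagonal d * P⁻¹)
    (hc : ∀ i l u, (A i).mulVec ((A l).mulVec u) = (A l).mulVec ((A i).mulVec u)) :
    ∃ (P : Ev m ≃L[ℂ] Ev m) (lam : Fin p → Ev m), ∀ i v, (A i).mulVec (P v) = P (lam i * v) := by
  have h1 := Module.End.iSup_iInf_maxGenEigenspace_eq_top_of_iSup_maxGenEigenspace_eq_top_of_commute
    (fun i => (A i).mulVecLin) (fun i l _ => LinearMap.ext fun u => hc i l u)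
    (fun i => Module.End.iSup_maxGenEigenspace_eq_top _)
  let S : Set (Ev m) := {v | ∃ χ : Fin p → ℂ, ∀ i, (A i).mulVec v = χ i • v}
  have hS : (⊤ : Submodule ℂ (Ev m)) ≤ Submodule.span ℂ S := by
    rw [← h1]
    refine iSup_le fun χ => fun v hv => Submodule.subset_span ⟨χ, fun i => ?_⟩
    rw [Module.End.mem_iInf_maxGenEigenspace_iff] at hv
    obtain ⟨k, hk⟩ := hv i
    obtain ⟨Q, hQ, d, hd⟩ := hss i
    exact pow_eig (A i) Q hQ d hd (χ i) v k hk
  obtain ⟨b, hb⟩ := basis_in (d := m) (by simp) S hS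
  choose χ hχ using hb
  refine ⟨b.equivFun.symm.toContinuousLinearEquiv, fun i l => χ l i, fun i v => ?_⟩
  show (A i).mulVec (b.equivFun.symm v) = b.equivFun.symm _
  rw [Module.Basis.equivFun_symm_apply, Module.Basis.equivFun_symm_apply]
  have : ∀ u, (A i).mulVec u = (A i).mulVecLin u := fun _ => rfl
  rw [this, map_sum]
  refine Finset.sum_congr rfl fun l _ => ?_
  rw [map_smul, ← this, hχ l i, smul_smul]
  congr 1
  simp [mul_comm]

end
end Rig

end

section
open scoped BigOperators
open MeasureTheory Set Filter Topology Metric Asymptotics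

namespace Rig

noncomputable section
variable {m p n q : ℕ}

theorem coeff_euler (f : MvPolynomial (Fin m) ℂ) (l : Fin m) (α : Fin m →₀ ℕ) :
    MvPolynomial.coeff α (MvPolynomial.X l * MvPolynomial.pderiv l f) = (α l : ℂ) * MvPolynomial.coeff α f := by
  classical
  induction f using MvPolynomial.induction_on' with
  | monomial β c =>
    rw [MvPolynomial.X_mul_pderiv_monomial, MvPolynomial.coeff_smul, MvPolynomial.coeff_monomial]
    split_ifs with h
    · rw [h]; simp
    · simp
  | add f g hf hg => rw [map_add, mul_add, MvPolynomial.coeff_add, hf, hg, MvPolynomial.coeff_add, mul_add]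

theorem eval_euler (f : MvPolynomial (Fin m) ℂ) (l : Fin m) (v : Ev m) :
    v l * MvPolynomial.eval v (MvPolynomial.pderiv l f)
      = ∑ α ∈ f.support, (MvPolynomial.eval v (MvPolynomial.monomial α (MvPolynomial.coeff α f))) * (α l : ℂ) := by
  have h : v l * MvPolynomial.eval v (MvPolynomial.pderiv l f)
      = MvPolynomial.eval v (MvPolynomial.X l * MvPolynomial.pderiv l f) := by simp
  rw [h]
  conv_lhs => rw [f.as_sum]
  rw [map_sum, Finset.mul_sum, map_sum]
  refine Finset.sum_congr rfl fun α _ => ?_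
  rw [MvPolynomial.X_mul_pderiv_monomial, map_nsmul, nsmul_eq_mul, mul_comm]

theorem supp_res (f : MvPolynomial (Fin m) ℂ) (c : Ev m)
    (h : ∀ v : Ev m, ∑ l, c l * (v l * MvPolynomial.eval v (MvPolynomial.pderiv l f)) = 0)
    (α : Fin m →₀ ℕ) (hα : α ∈ f.support) : ∑ l, c l * (α l : ℂ) = 0 := by
  have h1 : ∑ l, MvPolynomial.C (c l) * (MvPolynomial.X l * MvPolynomial.pderiv l f) = 0 := by
    refine MvPolynomial.funext fun v => ?_
    rw [map_sum, map_zero, ← h v]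
    refine Finset.sum_congr rfl fun l _ => by simp
  have h2 := congrArg (MvPolynomial.coeff α) h1
  rw [MvPolynomial.coeff_sum, MvPolynomial.coeff_zero] at h2
  simp only [MvPolynomial.coeff_C_mul, coeff_euler] at h2
  simp only [← mul_assoc] at h2
  rw [← Finset.sum_mul] at h2
  exact (mul_eq_zero.1 h2).resolve_right (MvPolynomial.mem_support_iff.1 hα)

/-- A solution of homogeneous linear equations with natural coefficients is a combination of integer solutions. -/
theorem int_span (S : Set (Fin m → ℕ)) (c : Ev m) (hc : ∀ α ∈ S, ∑ l, c l * (α l : ℂ) = 0) :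
    c ∈ Submodule.span ℂ {u : Ev m | ∃ w : Fin m → ℤ, (∀ l, u l = (w l : ℂ)) ∧ ∀ α ∈ S, ∑ l, (w l) * (α l : ℤ) = 0} := by
  classical
  let b := Module.Basis.ofVectorSpace ℚ ℂ
  let r : _ → Fin m → ℚ := fun t l => b.repr (c l) t
  let T := Finset.univ.biUnion fun l => (b.repr (c l)).support
  have h1 : c = ∑ t ∈ T, (b t : ℂ) • (fun l => ((r t l : ℚ) : ℂ) : Ev m) := by
    ext l
    rw [Finset.sum_apply]
    have h := b.linearCombination_repr (c l)
    rw [Finsupp.linearCombination_apply, Finsupp.sum_of_support_subset (s := T)] at h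
    · rw [← h]
      refine Finset.sum_congr rfl fun t _ => ?_
      simp only [Pi.smul_apply, smul_eq_mul, r]
      rw [Rat.smul_def, mul_comm]
    · exact Finset.subset_biUnion_of_mem (fun l => (b.repr (c l)).support) (Finset.mem_univ l)
    · intro i _; simp
  rw [h1]
  refine Submodule.sum_mem _ fun t _ => Submodule.smul_mem _ _ ?_
  let N : ℕ := ∏ l, (r t l).den
  have hN : (N : ℂ) ≠ 0 := by
    exact_mod_cast Finset.prod_ne_zero_iff.2 fun l _ => (r t l).den_nz
  have hNq : (N : ℚ) ≠ 0 := by exact_mod_cast hN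
  have h2 : ∀ l, ∃ z : ℤ, (N : ℚ) * r t l = z := by
    intro l
    obtain ⟨k, hk⟩ : (r t l).den ∣ N := Finset.dvd_prod_of_mem (fun l => (r t l).den) (Finset.mem_univ l)
    refine ⟨k * (r t l).num, ?_⟩
    rw [hk]; push_cast
    have := Rat.den_mul_eq_num (r t l)
    linear_combination (k : ℚ) * this
  choose w hw using h2
  have h3 : (fun l => ((r t l : ℚ) : ℂ) : Ev m) = (N : ℂ)⁻¹ • (fun l => (w l : ℂ) : Ev m) := by
    ext l
    have := congrArg (fun x : ℚ => (x : ℂ)) (hw l)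
    push_cast at this
    rw [Pi.smul_apply, smul_eq_mul, ← this, inv_mul_cancel_left₀ hN]
  rw [h3]
  refine Submodule.smul_mem _ _ (Submodule.subset_span ⟨w, fun l => rfl, fun α hα => ?_⟩)
  have h4 : ∑ l, r t l * (α l : ℚ) = 0 := by
    have h5 := congrArg (fun x => b.repr x t) (hc α hα)
    simp only [map_sum, map_zero, Finsupp.coe_zero, Pi.zero_apply, Finsupp.finsetSum_apply] at h5
    rw [← h5]
    refine Finset.sum_congr rfl fun l _ => ?_
    have : c l * (α l : ℂ) = (α l : ℚ) • c l := by rw [Rat.smul_def, mul_comm]; simp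
    rw [this, map_smul]
    simp [r, mul_comm]
  have h6 : ((∑ l, w l * (α l : ℤ) : ℤ) : ℚ) = 0 := by
    push_cast
    simp only [← hw, mul_assoc]
    rw [← Finset.mul_sum, h4, mul_zero]
  exact_mod_cast h6

theorem integ (hm : m = p + q) (g : Fin q → MvPolynomial (Fin m) ℂ) (lam : Fin p → Ev m)
    (hlam : LinearIndependent ℂ lam)
    (hinv : ∀ j i (v : Ev m), ∑ l, lam i l * (v l * MvPolynomial.eval v (MvPolynomial.pderiv l (g j))) = 0)
    (v0 : Ev m)
    (hLI : LinearIndependent ℂ fun j => (fun l => v0 l * MvPolynomial.eval v0 (MvPolynomial.pderiv l (g j)) : Ev m)) :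
    ∃ w : Fin p → Fin m → ℤ, LinearIndependent ℂ (wt w) ∧ ∃ B C : Matrix (Fin p) (Fin p) ℂ,
      B * C = 1 ∧ C * B = 1 ∧ (∀ j, wt w j = ∑ i, B j i • lam i) ∧ (∀ i, lam i = ∑ j, C i j • wt w j) := by
  classical
  let S : Set (Fin m → ℕ) := {α | ∃ j, ∃ β ∈ (g j).support, ⇑β = α}
  let D : Matrix (Fin q) (Fin m) ℂ := fun j l => v0 l * MvPolynomial.eval v0 (MvPolynomial.pderiv l (g j))
  let S' : Set (Ev m) := {u : Ev m | ∃ w : Fin m → ℤ, (∀ l, u l = (w l : ℂ)) ∧ ∀ α ∈ S, ∑ l, (w l) * (α l : ℤ) = 0}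
  have hlS : ∀ i, lam i ∈ Submodule.span ℂ S' := by
    intro i
    refine int_span S (lam i) ?_
    rintro α ⟨j, β, hβ, rfl⟩
    exact supp_res (g j) (lam i) (hinv j i) β hβ
  have hSK : Submodule.span ℂ S' ≤ LinearMap.ker D.mulVecLin := by
    refine Submodule.span_le.2 ?_
    rintro u ⟨w, hu, hw⟩
    show D.mulVecLin u = 0
    ext j
    show ∑ l, D j l * u l = 0
    simp only [D, eval_euler, Finset.sum_mul]
    rw [Finset.sum_comm]
    refine Finset.sum_eq_zero fun β hβ => ?_
    have := hw β ⟨j, β, hβ, rfl⟩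
    have h2 : ∑ l, (w l : ℂ) * (β l : ℂ) = 0 := by exact_mod_cast congrArg (fun z : ℤ => (z : ℂ)) this
    simp only [hu, mul_assoc]
    rw [← Finset.mul_sum]
    have h3 : ∑ l, (β l : ℂ) * (w l : ℂ) = 0 := by rw [← h2]; exact Finset.sum_congr rfl fun l _ => mul_comm _ _
    rw [h3, mul_zero]
  have hrk : D.rank = q := by
    have := LinearIndependent.rank_matrix (M := D) hLI
    simpa using this
  have hker : Module.finrank ℂ (LinearMap.ker D.mulVecLin) = p := by
    have h := LinearMap.finrank_range_add_finrank_ker D.mulVecLin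
    have h' : Module.finrank ℂ (LinearMap.range D.mulVecLin) = q := hrk
    rw [h'] at h
    simp at h
    omega
  have hl1 : Submodule.span ℂ (range lam) ≤ Submodule.span ℂ S' := by
    refine Submodule.span_le.2 ?_
    rintro _ ⟨i, rfl⟩; exact hlS i
  have hl2 : Module.finrank ℂ (Submodule.span ℂ (range lam)) = p := by
    rw [finrank_span_eq_card hlam]; simp
  have e1 : Module.finrank ℂ (Submodule.span ℂ S') = p :=
    le_antisymm (by rw [← hker]; exact Submodule.finrank_mono hSK) (by rw [← hl2]; exact Submodule.finrank_mono hl1)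
  have e2 : Submodule.span ℂ (range lam) = Submodule.span ℂ S' :=
    Submodule.eq_of_le_of_finrank_eq hl1 (by rw [hl2, e1])
  obtain ⟨b, hbS, hbs, hbL⟩ := exists_linearIndependent ℂ S'
  haveI : Finite b := hbL.finite
  haveI : Fintype b := Fintype.ofFinite b
  have hcard : Fintype.card b = p := by
    have := finrank_span_eq_card hbL
    rw [Subtype.range_coe, hbs, e1] at this
    exact this.symm
  let e := Fintype.equivFinOfCardEq hcard
  have hmem : ∀ j : Fin p, ((e.symm j : b) : Ev m) ∈ S' := fun j => hbS (e.symm j).2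
  choose w hw using hmem
  have hwt : wt w = fun j => ((e.symm j : b) : Ev m) := by
    funext j
    ext l
    exact ((hw j).1 l).symm
  have hwL : LinearIndependent ℂ (wt w) := by
    rw [hwt]
    exact hbL.comp e.symm e.symm.injective
  have hws : Submodule.span ℂ (range (wt w)) = Submodule.span ℂ S' := by
    rw [← hbs, hwt]
    congr 1
    have : (fun j => ((e.symm j : b) : Ev m)) = (Subtype.val : b → Ev m) ∘ e.symm := rfl
    rw [this, e.symm.surjective.range_comp, Subtype.range_coe]
  have hB : ∀ j, ∃ c : Fin p → ℂ, ∑ i, c i • lam i = wt w j := fun j => by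
    have : wt w j ∈ Submodule.span ℂ (range lam) := by
      rw [e2, ← hws]; exact Submodule.subset_span ⟨j, rfl⟩
    exact (Submodule.mem_span_range_iff_exists_fun ℂ).1 this
  have hC : ∀ i, ∃ c : Fin p → ℂ, ∑ j, c j • wt w j = lam i := fun i => by
    have : lam i ∈ Submodule.span ℂ (range (wt w)) := by
      rw [hws]; exact hlS i
    exact (Submodule.mem_span_range_iff_exists_fun ℂ).1 this
  choose B hB using hB
  choose C hC using hC
  have hBC : (Matrix.of B) * (Matrix.of C) = 1 := by
    ext j a
    have h := hB j
    have h2 : ∑ a, ((Matrix.of B) * (Matrix.of C)) j a • wt w a = ∑ a, (1 : Matrix (Fin p) (Fin p) ℂ) j a • wt w a := by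
      have : ∑ a, (1 : Matrix (Fin p) (Fin p) ℂ) j a • wt w a = wt w j := by
        rw [Finset.sum_eq_single j]
        · simp
        · intro b _ hb; rw [Matrix.one_apply_ne hb.symm, zero_smul]
        · simp
      rw [this, ← h]
      simp only [Matrix.mul_apply, Finset.sum_smul, Matrix.of_apply]
      rw [Finset.sum_comm]
      refine Finset.sum_congr rfl fun i _ => ?_
      rw [← hC i, Finset.smul_sum]
      exact Finset.sum_congr rfl fun _ _ => by rw [smul_smul]
    have h3 := Fintype.linearIndependent_iff.1 hwL (fun a => ((Matrix.of B) * (Matrix.of C)) j a - (1 : Matrix (Fin p) (Fin p) ℂ) j a) (by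
      simp only [sub_smul, Finset.sum_sub_distrib]
      rw [h2, sub_self]) a
    exact sub_eq_zero.1 h3
  exact ⟨w, hwL, Matrix.of B, Matrix.of C, hBC, mul_eq_one_comm.1 hBC, fun j => (hB j).symm, fun i => (hC i).symm⟩

end
end Rig

end

section
open scoped BigOperators
open MeasureTheory Set Filter Topology Metric Asymptotics

namespace Rig

noncomputable section
variable {m p n q : ℕ}

theorem eval_fd (f : MvPolynomial (Fin m) ℂ) (v : Ev m) :
    HasFDerivAt (fun u : Ev m => MvPolynomial.eval u f)
      (∑ l, MvPolynomial.eval v (MvPolynomial.pderiv l f) • (ContinuousLinearMap.proj l : Ev m →L[ℂ] ℂ)) v := by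
  classical
  induction f using MvPolynomial.induction_on with
  | C a =>
    have h1 : HasFDerivAt (fun u : Ev m => MvPolynomial.eval u (MvPolynomial.C a)) (0 : Ev m →L[ℂ] ℂ) v := by
      simp only [MvPolynomial.eval_C]
      exact hasFDerivAt_const (𝕜 := ℂ) a v
    refine h1.congr_fderiv ?_
    ext d
    simp [ContinuousLinearMap.sum_apply]
  | add f g hf hg =>
    have h0 : (fun u : Ev m => MvPolynomial.eval u (f + g))
        = (fun u : Ev m => MvPolynomial.eval u f) + fun u : Ev m => MvPolynomial.eval u g := by
      funext u; simp
    rw [h0]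
    refine (hf.add hg).congr_fderiv ?_
    ext d
    simp [ContinuousLinearMap.sum_apply, add_mul, Finset.sum_add_distrib]
  | mul_X f l hf =>
    have h1 : HasFDerivAt (fun u : Ev m => u l) (ContinuousLinearMap.proj l : Ev m →L[ℂ] ℂ) v :=
      (ContinuousLinearMap.proj l : Ev m →L[ℂ] ℂ).hasFDerivAt
    have h2 := hf.mul h1
    have h3 : (fun u : Ev m => MvPolynomial.eval u (f * MvPolynomial.X l)) = fun u : Ev m => MvPolynomial.eval u f * u l := by
      funext u; simp
    rw [h3]
    refine h2.congr_fderiv ?_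
    ext d
    simp only [ContinuousLinearMap.add_apply, ContinuousLinearMap.smul_apply, ContinuousLinearMap.sum_apply,
      ContinuousLinearMap.proj_apply, smul_eq_mul, MvPolynomial.pderiv_mul, map_add, map_mul, MvPolynomial.eval_X, add_mul,
      Finset.sum_add_distrib]
    rw [add_comm]
    congr 1
    · rw [Finset.mul_sum]
      exact Finset.sum_congr rfl fun a _ => by ring
    · rw [Finset.sum_eq_single l]
      · simp
      · intro a _ ha
        rw [MvPolynomial.pderiv_X_of_ne (Ne.symm ha)]; simp
      · simp

theorem poly_rep {k : ℕ} (T : ContinuousMultilinearMap ℂ (fun _ : Fin k => Ev m) ℂ) (L : Ev m ≃L[ℂ] Ev m) (c : ℂ) :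
    ∃ f : MvPolynomial (Fin m) ℂ, ∀ v, c • T (fun _ => L v) = MvPolynomial.eval v f := by
  classical
  refine ⟨∑ σ : Fin k → Fin m, MvPolynomial.C (c * T fun t => L (Pi.single (σ t) 1)) * ∏ t, MvPolynomial.X (σ t), fun v => ?_⟩
  have h1 : L v = ∑ l, v l • L (Pi.single l 1) := by
    conv_lhs => rw [pi_eq_sum_univ' v]
    rw [map_sum]
    exact Finset.sum_congr rfl fun l _ => by rw [map_smul]
  rw [map_sum]
  have h2 : T (fun _ => L v) = ∑ σ : Fin k → Fin m, T fun t => v (σ t) • L (Pi.single (σ t) 1) := by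
    have := T.toMultilinearMap.map_sum (fun (_ : Fin k) (l : Fin m) => v l • L (Pi.single l 1))
    rw [h1]
    exact this
  rw [h2, Finset.smul_sum]
  refine Finset.sum_congr rfl fun σ _ => ?_
  have h3 : (T fun t => v (σ t) • L (Pi.single (σ t) 1)) = (∏ t, v (σ t)) • T fun t => L (Pi.single (σ t) 1) :=
    T.toMultilinearMap.map_smul_univ (fun t => v (σ t)) (fun t => L (Pi.single (σ t) 1))
  rw [h3]
  simp only [map_mul, map_prod, MvPolynomial.eval_C, MvPolynomial.eval_X, smul_eq_mul]
  ring

theorem LI_comp {ι : Type*} [Fintype ι] {L : ι → Ev m →L[ℂ] ℂ} (hL : LinearIndependent ℂ L) (P : Ev m ≃L[ℂ] Ev m) :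
    LinearIndependent ℂ fun j => (L j).comp (P : Ev m →L[ℂ] Ev m) := by
  rw [Fintype.linearIndependent_iff] at hL ⊢
  intro a ha
  refine hL a ?_
  ext d
  have h := congrArg (fun T : Ev m →L[ℂ] ℂ => T (P.symm d)) ha
  simpa [ContinuousLinearMap.sum_apply] using h

theorem lin_data (hm : m = p + q) (A : Fin p → Matrix (Fin m) (Fin m) ℂ) (G : Fin q → Ev m → ℂ)
    (hss : ∀ i, ∃ P : Matrix (Fin m) (Fin m) ℂ, IsUnit P ∧ ∃ d : Fin m → ℂ, A i = P * Matrix.diagonal d * P⁻¹)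
    (hc : ∀ i l u, (A i).mulVec ((A l).mulVec u) = (A l).mulVec ((A i).mulVec u))
    (hinv : ∀ j i u, fderiv ℂ (G j) u ((A i).mulVec u) = 0)
    (hAind : Dense {x : Fin m → ℂ | LinearIndependent ℂ fun i => (A i).mulVec x})
    (k : Fin q → ℕ) (T : ∀ j, ContinuousMultilinearMap ℂ (fun _ : Fin (k j) => Ev m) ℂ) (c : Fin q → ℂ)
    (hG : ∀ j x, G j x = c j • T j (fun _ => x))
    (hGind : Dense {x : Fin m → ℂ | LinearIndependent ℂ fun j => fderiv ℂ (G j) x}) :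
    ∃ (P : Ev m ≃L[ℂ] Ev m) (w : Fin p → Fin m → ℤ) (B C : Matrix (Fin p) (Fin p) ℂ) (v0 : Ev m),
      LinearIndependent ℂ (wt w) ∧ B * C = 1 ∧ C * B = 1 ∧
      (∀ j v, P.symm (∑ i, B j i • (A i).mulVec (P v)) = wt w j * v) ∧
      (∀ l, 1/2 < ‖v0 l‖ ∧ ‖v0 l‖ < 3/2) ∧ LinearIndependent ℂ fun j => fderiv ℂ (G j) (P v0) := by
  obtain ⟨P, lam, hP⟩ := simdiag A hss hc
  have hlam : LinearIndependent ℂ lam := by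
    obtain ⟨x, hx⟩ := hAind.nonempty
    have hx : LinearIndependent ℂ fun i => (A i).mulVec x := hx
    rw [Fintype.linearIndependent_iff] at hx ⊢
    intro a ha
    refine hx a ?_
    have h1 : ∀ i, (A i).mulVec x = P (lam i * P.symm x) := fun i => by rw [← hP i, P.apply_symm_apply]
    simp only [h1, ← map_smul, ← map_sum]
    have h2 : ∑ i, a i • (lam i * P.symm x) = (∑ i, a i • lam i) * P.symm x := by
      rw [Finset.sum_mul]; exact Finset.sum_congr rfl fun i _ => by rw [smul_mul_assoc]
    rw [h2, ha, zero_mul, map_zero]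
  have hO : IsOpen {v : Ev m | ∀ l, 1/2 < ‖v l‖ ∧ ‖v l‖ < 3/2} := by
    simp only [Set.ofPred_forall]
    refine isOpen_iInter_of_finite fun l => ?_
    have hcl : Continuous fun v : Ev m => ‖v l‖ := by fun_prop
    exact (isOpen_lt continuous_const hcl).inter (isOpen_lt hcl continuous_const)
  have hD : Dense (P ⁻¹' {x : Fin m → ℂ | LinearIndependent ℂ fun j => fderiv ℂ (G j) x}) :=
    hGind.preimage P.toHomeomorph.isOpenMap
  obtain ⟨v0, hv0, hv1⟩ := hD.inter_open_nonempty _ hO ⟨fun _ => 1, fun l => by norm_num⟩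
  have hv1 : LinearIndependent ℂ fun j => fderiv ℂ (G j) (P v0) := hv1
  choose g hg using fun j => poly_rep (T j) P (c j)
  have hfd : ∀ j v, (fderiv ℂ (G j) (P v)).comp (P : Ev m →L[ℂ] Ev m)
      = ∑ l, MvPolynomial.eval v (MvPolynomial.pderiv l (g j)) • (ContinuousLinearMap.proj l : Ev m →L[ℂ] ℂ) := by
    intro j v
    rw [← P.comp_right_fderiv]
    have : G j ∘ P = fun u : Ev m => MvPolynomial.eval u (g j) := by
      funext u
      rw [← hg j u, ← hG]; rfl
    rw [this]
    exact (eval_fd (g j) v).fderiv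
  have hinv2 : ∀ j i (v : Ev m), ∑ l, lam i l * (v l * MvPolynomial.eval v (MvPolynomial.pderiv l (g j))) = 0 := by
    intro j i v
    have h1 := hinv j i (P v)
    rw [hP] at h1
    have h2 := congrArg (fun T : Ev m →L[ℂ] ℂ => T (lam i * v)) (hfd j v)
    have h3 : (0 : ℂ) = ∑ l, MvPolynomial.eval v (MvPolynomial.pderiv l (g j)) * (lam i l * v l) := by
      rw [← h1]
      simpa [ContinuousLinearMap.sum_apply] using h2
    rw [h3]
    exact Finset.sum_congr rfl fun l _ => by ring
  have hLI : LinearIndependent ℂ fun j => (fun l => v0 l * MvPolynomial.eval v0 (MvPolynomial.pderiv l (g j)) : Ev m) := by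
    have h1 := LI_comp hv1 P
    rw [Fintype.linearIndependent_iff] at h1 ⊢
    intro a ha
    refine h1 a ?_
    simp only [hfd]
    ext d
    simp only [ContinuousLinearMap.sum_apply, ContinuousLinearMap.smul_apply, ContinuousLinearMap.proj_apply, smul_eq_mul,
      ContinuousLinearMap.zero_apply, Finset.mul_sum]
    rw [Finset.sum_comm]
    refine Finset.sum_eq_zero fun l _ => ?_
    have h2 := congrFun ha l
    simp only [Finset.sum_apply, Pi.smul_apply, smul_eq_mul, Pi.zero_apply] at h2
    have hne : v0 l ≠ 0 := by
      intro h; have := (hv0 l).1; rw [h, norm_zero] at this; norm_num at this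
    have h3 : v0 l * ∑ j, a j * MvPolynomial.eval v0 (MvPolynomial.pderiv l (g j)) = 0 := by
      rw [← h2, Finset.mul_sum]; exact Finset.sum_congr rfl fun j _ => by ring
    have h4 := (mul_eq_zero.1 h3).resolve_left hne
    simp only [← mul_assoc]
    rw [← Finset.sum_mul, h4, zero_mul]
  obtain ⟨w, hw, B, C, hBC, hCB, hwB, -⟩ := integ hm g lam hlam hinv2 v0 hLI
  refine ⟨P, w, B, C, v0, hw, hBC, hCB, fun j v => ?_, hv0, hv1⟩
  simp only [hP, ← map_smul, ← map_sum]
  rw [P.symm_apply_apply, hwB, Finset.sum_mul]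
  exact Finset.sum_congr rfl fun i _ => by rw [smul_mul_assoc]

end
end Rig

end

section
open scoped BigOperators
open MeasureTheory Set Filter Topology Metric Asymptotics

namespace Rig

noncomputable section
variable {m p n q : ℕ}

/-- The linear change of the space variable. -/
def PP (n : ℕ) (P : Ev m ≃L[ℂ] Ev m) : Ev m × Pm n →L[ℂ] Ev m × Pm n :=
  (P : Ev m →L[ℂ] Ev m).prodMap (ContinuousLinearMap.id ℂ (Pm n))

/-- The transformed fields. -/
def Yn (P : Ev m ≃L[ℂ] Ev m) (B : Matrix (Fin p) (Fin p) ℂ) (g : Fin p → Ev m × Pm n → Ev m) (j : Fin p)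
    (x : Ev m × Pm n) : Ev m :=
  P.symm (∑ i, B j i • g i (PP n P x))

theorem Yn_fd (P : Ev m ≃L[ℂ] Ev m) (B : Matrix (Fin p) (Fin p) ℂ) (g : Fin p → Ev m × Pm n → Ev m) (j : Fin p)
    (x : Ev m × Pm n) (hg : ∀ i, DifferentiableAt ℂ (g i) (PP n P x)) :
    HasFDerivAt (Yn P B g j) ((P.symm : Ev m →L[ℂ] Ev m).comp
      (∑ i, B j i • (fderiv ℂ (g i) (PP n P x)).comp (PP n P))) x := by
  have h1 : ∀ i ∈ (Finset.univ : Finset (Fin p)), HasFDerivAt (fun y => B j i • g i (PP n P y))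
      (B j i • (fderiv ℂ (g i) (PP n P x)).comp (PP n P)) x := fun i _ =>
    (HasFDerivAt.comp (g := g i) (f := PP n P) x (hg i).hasFDerivAt (PP n P).hasFDerivAt).const_smul (B j i)
  have h2 := HasFDerivAt.fun_sum h1
  exact HasFDerivAt.comp (g := P.symm) (f := fun y => ∑ i, B j i • g i (PP n P y)) x
    (P.symm : Ev m →L[ℂ] Ev m).hasFDerivAt h2

variable {z : Ev m} {U : Set (Ev m)} {Θ : Set (Fin n → ℂ)} {X : Fin p → Ev m → (Fin n → ℂ) → Ev m}
  {A : Fin p → Matrix (Fin m) (Fin m) ℂ} {G : Fin q → Ev m → ℂ} {M : ℕ} {r e : ℝ}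
  {g : Fin p → Ev m × Pm n → Ev m} {f : Fin q → Ev m × Pm n → ℂ}

theorem Blow.sys (H : Blow z U Θ X A G M r e g f) (hm : m = p + q) (P : Ev m ≃L[ℂ] Ev m) (hr : ∀ v, ‖v‖ < 4 → ‖P v‖ < r)
    (w : Fin p → Fin m → ℤ) (hw : LinearIndependent ℂ (wt w)) (B : Matrix (Fin p) (Fin p) ℂ)
    (hB : ∀ j v, P.symm (∑ i, B j i • (A i).mulVec (P v)) = wt w j * v)
    (v0 : Ev m) (hv0 : ∀ l, 1/2 < ‖v0 l‖ ∧ ‖v0 l‖ < 3/2) (hLI : LinearIndependent ℂ fun j => fderiv ℂ (G j) (P v0)) :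
    ∃ R : Fin p → Ev m × Pm n → Ev m, Sys w R (fun j x => f j (PP n P x)) e v0 ∧
      ∀ x ∈ Dom m n 4 e, ∀ j, Yf w R j x = Yn P B g j x := by
  have hmaps : ∀ x ∈ Dom m n 4 e, PP n P x ∈ Dom m n r e := fun x hx =>
    ⟨mem_ball_zero_iff.2 (hr x.1 (mem_ball_zero_iff.1 hx.1)), hx.2⟩
  have hgd : ∀ x ∈ Dom m n 4 e, ∀ i, DifferentiableAt ℂ (g i) (PP n P x) := fun x hx i =>
    (H.gan i _ (hmaps x hx)).differentiableAt
  have hfd : ∀ x ∈ Dom m n 4 e, ∀ j, DifferentiableAt ℂ (f j) (PP n P x) := fun x hx i =>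
    (H.fan i _ (hmaps x hx)).differentiableAt
  have hYd : ∀ j, DifferentiableOn ℂ (Yn P B g j) (Dom m n 4 e) := fun j x hx =>
    (Yn_fd P B g j x (hgd x hx)).differentiableAt.differentiableWithinAt
  have hdiv : ∀ j, ∃ Rj : Ev m × Pm n → Ev m, AnalyticOnNhd ℂ Rj (Dom m n 4 e) ∧
      ∀ x ∈ Dom m n 4 e, Yn P B g j x - wt w j * x.1 = x.2.1 • Rj x := by
    intro j
    refine division (f := fun x : Ev m × Pm n => Yn P B g j x - wt w j * x.1) (isOpen_Dom 4 e) Dom_star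
      (analytic_of_diff (isOpen_Dom 4 e) ((hYd j).sub (by fun_prop))) ?_
    intro a b hab
    have h1 : Yn P B g j (a, (0, b)) = wt w j * a := by
      rw [← hB j a]
      unfold Yn
      congr 1
      refine Finset.sum_congr rfl fun i _ => ?_
      rw [H.g0 i _ (hmaps _ hab) rfl]
      rfl
    show Yn P B g j (a, (0, b)) - wt w j * a = 0
    rw [h1, sub_self]
  choose R hR1 hR2 using hdiv
  have hY : ∀ x ∈ Dom m n 4 e, ∀ j, Yf w R j x = Yn P B g j x := by
    intro x hx j
    unfold Yf
    rw [← hR2 j x hx]; abel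
  have hYfd : ∀ x ∈ Dom m n 4 e, ∀ j, fderiv ℂ (Yf w R j) x = fderiv ℂ (Yn P B g j) x := by
    intro x hx j
    refine Filter.EventuallyEq.fderiv_eq ?_
    filter_upwards [(isOpen_Dom 4 e).mem_nhds hx] with y hy
    exact hY y hy j
  have hPPY : ∀ x i, PP n P (Yn P B g i x, 0) = (∑ a, B i a • (g a (PP n P x), (0 : Pm n))) := by
    intro x i
    refine Prod.ext ?_ ?_
    · rw [Prod.fst_sum]
      show P (Yn P B g i x) = _
      unfold Yn
      rw [P.apply_symm_apply]
      rfl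
    · rw [Prod.snd_sum]
      show (0 : Pm n) = _
      simp
  refine ⟨R, ⟨H.pos, hm, hw, hR1, ?_, ?_, ?_, hv0, ?_⟩, hY⟩
  · intro x hx i j
    rw [hYfd x hx, hYfd x hx, hY x hx, hY x hx, (Yn_fd P B g j x (hgd x hx)).fderiv, (Yn_fd P B g i x (hgd x hx)).fderiv]
    simp only [ContinuousLinearMap.comp_apply, ContinuousLinearMap.sum_apply, ContinuousLinearMap.smul_apply, hPPY, map_sum, map_smul,
      Finset.smul_sum]
    rw [Finset.sum_comm]
    refine Finset.sum_congr rfl fun a _ => Finset.sum_congr rfl fun b _ => ?_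
    rw [H.comm b a _ (hmaps x hx), smul_comm]
  · intro j
    refine analytic_of_diff (isOpen_Dom 4 e) fun x hx => ?_
    exact (DifferentiableAt.comp (g := f j) (f := PP n P) x (hfd x hx j) (PP n P).differentiableAt).differentiableWithinAt
  · intro j i x hx
    have h1 : HasFDerivAt (fun y => f j (PP n P y)) ((fderiv ℂ (f j) (PP n P x)).comp (PP n P)) x :=
      HasFDerivAt.comp (g := f j) (f := PP n P) x (hfd x hx j).hasFDerivAt (PP n P).hasFDerivAt
    rw [h1.fderiv, hY x hx, ContinuousLinearMap.comp_apply, hPPY, map_sum]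
    refine Finset.sum_eq_zero fun a _ => ?_
    rw [map_smul, H.fint j a _ (hmaps x hx), smul_zero]
  · have hv4 : ‖v0‖ < 4 := by
      rw [pi_norm_lt_iff (by norm_num)]
      intro l; linarith [(hv0 l).2]
    have hx : ((v0, 0) : Ev m × Pm n) ∈ Dom m n 4 e := ⟨mem_ball_zero_iff.2 hv4, mem_ball_self H.pos⟩
    have h2 : (fun j => (fderiv ℂ (fun x => f j (PP n P x)) ((v0, 0) : Ev m × Pm n)).comp (ContinuousLinearMap.inl ℂ (Ev m) (Pm n)))
        = fun j => (fderiv ℂ (G j) (P v0)).comp (P : Ev m →L[ℂ] Ev m) := by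
      funext j
      have h1 : HasFDerivAt (fun y => f j (PP n P y)) ((fderiv ℂ (f j) (PP n P (v0, 0))).comp (PP n P)) (v0, 0) :=
        HasFDerivAt.comp (g := f j) (f := PP n P) _ (hfd _ hx j).hasFDerivAt (PP n P).hasFDerivAt
      rw [h1.fderiv, (H.f_fd (hr v0 hv4) j).fderiv]
      ext d
      rfl
    rw [h2]
    exact LI_comp hLI P

theorem Blow.hz (H : Blow z U Θ X A G M r e g f) (hr : 0 < r) (hfix : ∀ i, X i z 0 = 0) (P : Ev m ≃L[ℂ] Ev m)
    (B : Matrix (Fin p) (Fin p) ℂ) (i : Fin p) (s : ℂ) (hs : ‖s‖ < e) : Yn P B g i (0, (s, 0)) = 0 := by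
  have hmem : ((0, (s, 0)) : Ev m × Pm n) ∈ Dom m n r e := by
    refine ⟨mem_ball_self hr, ?_⟩
    rw [mem_ball_zero_iff, Prod.norm_def]
    simp [hs, H.pos]
  have h1 : PP n P ((0, (s, 0)) : Ev m × Pm n) = (0, (s, 0)) := by
    refine Prod.ext ?_ rfl
    show P 0 = 0
    simp
  have h2 : ∀ a, g a ((0, (s, 0)) : Ev m × Pm n) = 0 := by
    intro a
    by_cases hs0 : s = 0
    · rw [H.g0 a _ hmem hs0]; simp
    · have := H.gX a _ hmem
      simp only [smul_zero, add_zero, hfix] at this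
      exact (smul_eq_zero.1 this.symm).resolve_left hs0
  unfold Yn
  rw [h1]
  simp [h2]

end
end Rig

end

section
open scoped BigOperators
open MeasureTheory Set Filter Topology Metric Asymptotics

namespace Rig

noncomputable section
variable {m p n q : ℕ}

/-- The affine change of coordinates and its inverse. -/
def af (z : Ev m) (s : ℂ) (P : Ev m ≃L[ℂ] Ev m) (v : Ev m) : Ev m := z + s • P v
def ag (z : Ev m) (s : ℂ) (P : Ev m ≃L[ℂ] Ev m) (x : Ev m) : Ev m := s⁻¹ • P.symm (x - z)

theorem af_ag {z : Ev m} {s : ℂ} (hs : s ≠ 0) (P : Ev m ≃L[ℂ] Ev m) (x : Ev m) : af z s P (ag z s P x) = x := by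
  unfold af ag
  rw [map_smul, P.apply_symm_apply, smul_inv_smul₀ hs, add_sub_cancel]

theorem ag_af {z : Ev m} {s : ℂ} (hs : s ≠ 0) (P : Ev m ≃L[ℂ] Ev m) (x : Ev m) : ag z s P (af z s P x) = x := by
  unfold af ag
  rw [add_sub_cancel_left, map_smul, P.symm_apply_apply, inv_smul_smul₀ hs]

theorem af_fd (z : Ev m) (s : ℂ) (P : Ev m ≃L[ℂ] Ev m) (v : Ev m) :
    HasFDerivAt (af z s P) (s • (P : Ev m →L[ℂ] Ev m)) v :=
  ((P : Ev m →L[ℂ] Ev m).hasFDerivAt.const_smul s).const_add z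

theorem ag_fd (z : Ev m) (s : ℂ) (P : Ev m ≃L[ℂ] Ev m) (v : Ev m) :
    HasFDerivAt (ag z s P) (s⁻¹ • (P.symm : Ev m →L[ℂ] Ev m)) v := by
  have h1 : HasFDerivAt (fun x : Ev m => x - z) (ContinuousLinearMap.id ℂ (Ev m)) v := (hasFDerivAt_id v).sub_const z
  exact (HasFDerivAt.comp (g := P.symm) (f := fun x : Ev m => x - z) v (P.symm : Ev m →L[ℂ] Ev m).hasFDerivAt h1).const_smul s⁻¹

theorem transfer {z : Ev m} {s : ℂ} (hs : s ≠ 0) (P : Ev m ≃L[ℂ] Ev m) {B C : Matrix (Fin p) (Fin p) ℂ}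
    (hBC : B * C = 1) (hCB : C * B = 1) {X1 X0 Y1 Y0 : Fin p → Ev m → Ev m} {V W : Set (Ev m)} {U : Set (Ev m)} {ζ : Ev m}
    (hU : ∀ v ∈ ball (0 : Ev m) 1, af z s P v ∈ U)
    (hX1 : ∀ i, ∀ v ∈ ball (0 : Ev m) 1, X1 i (af z s P v) = s • P (∑ a, C i a • Y1 a v))
    (hX0 : ∀ i, ∀ v ∈ ball (0 : Ev m) 1, X0 i (af z s P v) = s • P (∑ a, C i a • Y0 a v))
    (hVo : IsOpen V) (hV : V ⊆ ball 0 1) (hζ : ζ ∈ V) (hWo : IsOpen W) (hW : W ⊆ ball 0 1) (h0 : (0 : Ev m) ∈ W)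
    {T S : Ev m → Ev m} (hT : DifferentiableOn ℂ T V) (hS : DifferentiableOn ℂ S W) (hTm : MapsTo T V W) (hSm : MapsTo S W V)
    (hST : ∀ x ∈ V, S (T x) = x) (hTS : ∀ y ∈ W, T (S y) = y) (hTζ : T ζ = 0)
    {g : Fin p → Fin p → Ev m → ℂ} (hg : ∀ i j, DifferentiableOn ℂ (g i j) W)
    (hdet : ∀ y ∈ W, (Matrix.of fun i j => g i j y).det ≠ 0)
    (hgi : ∀ i j l, ∀ y ∈ W, fderiv ℂ (g i j) y (Y0 l y) = 0)
    (hTY : ∀ i, ∀ x ∈ V, fderiv ℂ T x (Y1 i x) = ∑ j, g i j (T x) • Y0 j (T x)) :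
    ∃ V' W' : Set (Fin m → ℂ), IsOpen V' ∧ V' ⊆ U ∧ af z s P ζ ∈ V' ∧
            IsOpen W' ∧ W' ⊆ U ∧ z ∈ W' ∧
            ∃ φ ψ : (Fin m → ℂ) → (Fin m → ℂ),
              AnalyticOnNhd ℂ φ V' ∧ AnalyticOnNhd ℂ ψ W' ∧
              Set.MapsTo φ V' W' ∧ Set.MapsTo ψ W' V' ∧
              (∀ x ∈ V', ψ (φ x) = x) ∧ (∀ y ∈ W', φ (ψ y) = y) ∧ φ '' V' = W' ∧
              φ (af z s P ζ) = z ∧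
              ∃ f : Fin p → Fin p → (Fin m → ℂ) → ℂ,
                (∀ i j, AnalyticOnNhd ℂ (f i j) W') ∧
                (∀ y ∈ W', (Matrix.of fun i j => f i j y).det ≠ 0) ∧
                (∀ i j l, ∀ y ∈ W', fderiv ℂ (f i j) y (X0 l y) = 0) ∧
                (∀ i, ∀ x ∈ V', fderiv ℂ φ x (X1 i x) =
                  ∑ j, f i j (φ x) • X0 j (φ x)) := by
  have hagc : Continuous (ag z s P) := by unfold ag; fun_prop
  have hVo' : IsOpen (ag z s P ⁻¹' V) := hVo.preimage hagc
  have hWo' : IsOpen (ag z s P ⁻¹' W) := hWo.preimage hagc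
  have hz : af z s P 0 = z := by simp [af]
  have hTd : ∀ v ∈ V, DifferentiableAt ℂ T v := fun v hv => hT.differentiableAt (hVo.mem_nhds hv)
  have hSd : ∀ v ∈ W, DifferentiableAt ℂ S v := fun v hv => hS.differentiableAt (hWo.mem_nhds hv)
  have hgd : ∀ i j, ∀ v ∈ W, DifferentiableAt ℂ (g i j) v := fun i j v hv => (hg i j).differentiableAt (hWo.mem_nhds hv)
  have hconj : ∀ (K : Ev m → Ev m) (x : Ev m), DifferentiableAt ℂ K (ag z s P x) →
      HasFDerivAt (fun x => af z s P (K (ag z s P x)))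
        ((s • (P : Ev m →L[ℂ] Ev m)).comp ((fderiv ℂ K (ag z s P x)).comp (s⁻¹ • (P.symm : Ev m →L[ℂ] Ev m)))) x := by
    intro K x hK
    have h1 : HasFDerivAt (fun x => K (ag z s P x)) ((fderiv ℂ K (ag z s P x)).comp (s⁻¹ • (P.symm : Ev m →L[ℂ] Ev m))) x :=
      HasFDerivAt.comp (g := K) (f := ag z s P) x hK.hasFDerivAt (ag_fd z s P x)
    exact HasFDerivAt.comp (g := af z s P) (f := fun x => K (ag z s P x)) x (af_fd z s P _) h1
  have hpull : ∀ v : Ev m, (s⁻¹ • (P.symm : Ev m →L[ℂ] Ev m)) (s • P v) = v := by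
    intro v
    rw [ContinuousLinearMap.smul_apply, map_smul, inv_smul_smul₀ hs]
    exact P.symm_apply_apply v
  have hBX : ∀ b, ∀ v ∈ ball (0 : Ev m) 1, ∑ j, B b j • X0 j (af z s P v) = s • P (Y0 b v) := by
    intro b v hv
    have h1 : ∀ j, B b j • X0 j (af z s P v) = s • P (B b j • ∑ a, C j a • Y0 a v) := fun j => by
      rw [hX0 j v hv, map_smul, smul_comm]
    simp only [h1]
    rw [← Finset.smul_sum, ← map_sum]
    congr 2
    simp only [Finset.smul_sum, smul_smul]
    rw [Finset.sum_comm]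
    simp only [← Finset.sum_smul]
    have h2 : ∀ a, ∑ j, B b j * C j a = (1 : Matrix (Fin p) (Fin p) ℂ) b a := fun a => by rw [← hBC]; rfl
    simp only [h2]
    rw [Finset.sum_eq_single b]
    · simp
    · intro c _ hc; rw [Matrix.one_apply_ne hc.symm, zero_smul]
    · simp
  refine ⟨ag z s P ⁻¹' V, ag z s P ⁻¹' W, hVo', ?_, ?_, hWo', ?_, ?_, fun x => af z s P (T (ag z s P x)),
    fun x => af z s P (S (ag z s P x)), ?_, ?_, ?_, ?_, ?_, ?_, ?_, ?_, ?_⟩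
  · intro x hx
    rw [← af_ag hs P x (z := z)]; exact hU _ (hV hx)
  · show ag z s P (af z s P ζ) ∈ V
    rw [ag_af hs]; exact hζ
  · intro x hx
    rw [← af_ag hs P x (z := z)]; exact hU _ (hW hx)
  · show ag z s P z ∈ W
    have : ag z s P z = 0 := by simp [ag]
    rw [this]; exact h0
  · exact analytic_of_diff hVo' fun x hx => (hconj T x (hTd _ hx)).differentiableAt.differentiableWithinAt
  · exact analytic_of_diff hWo' fun x hx => (hconj S x (hSd _ hx)).differentiableAt.differentiableWithinAt
  · intro x hx
    show ag z s P (af z s P (T (ag z s P x))) ∈ W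
    rw [ag_af hs]; exact hTm hx
  · intro x hx
    show ag z s P (af z s P (S (ag z s P x))) ∈ V
    rw [ag_af hs]; exact hSm hx
  · intro x hx
    simp only [ag_af hs]
    rw [hST _ hx, af_ag hs]
  · intro x hx
    simp only [ag_af hs]
    rw [hTS _ hx, af_ag hs]
  · refine Subset.antisymm ?_ ?_
    · rintro _ ⟨x, hx, rfl⟩
      show ag z s P (af z s P (T (ag z s P x))) ∈ W
      rw [ag_af hs]; exact hTm hx
    · intro y hy
      refine ⟨af z s P (S (ag z s P y)), ?_, ?_⟩
      · show ag z s P (af z s P (S (ag z s P y))) ∈ V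
        rw [ag_af hs]; exact hSm hy
      · simp only [ag_af hs]
        rw [hTS _ hy, af_ag hs]
  · simp only [ag_af hs]
    rw [hTζ, hz]
  · have hf : ∀ i j, ∀ y ∈ ag z s P ⁻¹' W, HasFDerivAt (fun y => ∑ b, (∑ a, C i a * g a b (ag z s P y)) * B b j)
        (∑ b, B b j • ∑ a, C i a • (fderiv ℂ (g a b) (ag z s P y)).comp (s⁻¹ • (P.symm : Ev m →L[ℂ] Ev m))) y := by
      intro i j y hy
      refine HasFDerivAt.fun_sum fun b _ => ?_
      refine HasFDerivAt.mul_const ?_ (B b j)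
      refine HasFDerivAt.fun_sum fun a _ => ?_
      refine HasFDerivAt.const_mul ?_ (C i a)
      exact HasFDerivAt.comp (g := g a b) (f := ag z s P) y (hgd a b _ hy).hasFDerivAt (ag_fd z s P y)
    refine ⟨fun i j y => ∑ b, (∑ a, C i a * g a b (ag z s P y)) * B b j, ?_, ?_, ?_, ?_⟩
    · intro i j
      exact analytic_of_diff hWo' fun y hy => (hf i j y hy).differentiableAt.differentiableWithinAt
    · intro y hy
      have h1 : (Matrix.of fun i j => ∑ b, (∑ a, C i a * g a b (ag z s P y)) * B b j)
          = C * (Matrix.of fun i j => g i j (ag z s P y)) * B := by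
        ext i j
        simp [Matrix.mul_apply]
      rw [h1, Matrix.det_mul, Matrix.det_mul]
      have h2 : C.det * B.det = 1 := by rw [← Matrix.det_mul, hCB, Matrix.det_one]
      exact mul_ne_zero (mul_ne_zero (left_ne_zero_of_mul_eq_one h2) (hdet _ hy)) (right_ne_zero_of_mul_eq_one h2)
    · intro i j l y hy
      have h1 : X0 l y = s • P (∑ a, C l a • Y0 a (ag z s P y)) := by
        rw [← hX0 l _ (hW hy), af_ag hs]
      rw [(hf i j y hy).fderiv, h1]
      have key : ∀ a b, ((fderiv ℂ (g a b) (ag z s P y)).comp (s⁻¹ • (P.symm : Ev m →L[ℂ] Ev m)))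
          (s • P (∑ a, C l a • Y0 a (ag z s P y))) = 0 := by
        intro a b
        rw [ContinuousLinearMap.comp_apply, hpull, map_sum]
        refine Finset.sum_eq_zero fun c _ => ?_
        rw [map_smul, hgi a b c _ hy, smul_zero]
      simp only [ContinuousLinearMap.sum_apply, ContinuousLinearMap.smul_apply, key, smul_zero, Finset.sum_const_zero]
    · intro i x hx
      have h1 : X1 i x = s • P (∑ a, C i a • Y1 a (ag z s P x)) := by
        rw [← hX1 i _ (hV hx), af_ag hs]
      rw [(hconj T x (hTd _ hx)).fderiv, h1, ContinuousLinearMap.comp_apply, ContinuousLinearMap.comp_apply, hpull]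
      simp only [ag_af hs]
      set u := T (ag z s P x) with hu
      have huW : u ∈ W := hTm hx
      simp only [Finset.sum_smul]
      rw [Finset.sum_comm]
      simp only [mul_smul, ← Finset.smul_sum, hBX _ u (hW huW)]
      rw [ContinuousLinearMap.smul_apply]
      show s • P _ = _
      simp only [map_sum, map_smul, hTY _ _ hx, Finset.smul_sum, Finset.sum_smul, smul_smul]
      rw [Finset.sum_comm]
      refine Finset.sum_congr rfl fun b _ => ?_
      rw [Finset.sum_mul, Finset.sum_smul]
      refine Finset.sum_congr rfl fun a _ => ?_
      congr 1; ring

end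
end Rig

end

section
open scoped BigOperators
open MeasureTheory Set Filter Topology Metric Asymptotics

namespace Rig

noncomputable section

theorem main
    (p q m s : ℕ) (hm : m = p + q)
    (U : Set (Fin m → ℂ)) (hUopen : IsOpen U)
    (z₀ : Fin m → ℂ) (hz₀ : z₀ ∈ U)
    (Θ : Set (Fin s → ℂ)) (hΘopen : IsOpen Θ) (hΘ0 : (0 : Fin s → ℂ) ∈ Θ)
    (X : Fin p → (Fin m → ℂ) → (Fin s → ℂ) → (Fin m → ℂ))
    (F : Fin q → (Fin m → ℂ) → (Fin s → ℂ) → ℂ)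
    -- joint analyticity in (x, θ)
    (hXan : ∀ i, AnalyticOnNhd ℂ (fun w : (Fin m → ℂ) × (Fin s → ℂ) => X i w.1 w.2) (U ×ˢ Θ))
    (hFan : ∀ j, AnalyticOnNhd ℂ (fun w : (Fin m → ℂ) × (Fin s → ℂ) => F j w.1 w.2) (U ×ˢ Θ))
    -- for each fixed θ, an integrable system of type (p,q) on U
    (hcomm : ∀ θ ∈ Θ, ∀ i j, ∀ x ∈ U,
      fderiv ℂ (fun y => X j y θ) x (X i x θ) - fderiv ℂ (fun y => X i y θ) x (X j x θ) = 0)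
    (hFint : ∀ θ ∈ Θ, ∀ i j, ∀ x ∈ U, fderiv ℂ (fun y => F j y θ) x (X i x θ) = 0)
    (hXind : ∀ θ ∈ Θ, U ⊆ closure {x ∈ U | LinearIndependent ℂ fun i => X i x θ})
    (hFind : ∀ θ ∈ Θ, U ⊆ closure {x ∈ U | LinearIndependent ℂ fun j =>
      fderiv ℂ (fun y => F j y θ) x})
    -- z₀ is a nondegenerate fixed point at θ = 0 :
    (hfix : ∀ i, X i z₀ 0 = 0)
    (A : Fin p → Matrix (Fin m) (Fin m) ℂ)
    (hA : ∀ i v, (A i).mulVec v = fderiv ℂ (fun y => X i y 0) z₀ v)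
    (hss : ∀ i, ∃ P : Matrix (Fin m) (Fin m) ℂ, IsUnit P ∧ ∃ d : Fin m → ℂ, A i = P * Matrix.diagonal d * P⁻¹)
    (hAind : Dense {x : Fin m → ℂ | LinearIndependent ℂ fun i => (A i).mulVec x})
    (k : Fin q → ℕ) (G : Fin q → (Fin m → ℂ) → ℂ)
    (hklow : ∀ j, ∀ l < k j, iteratedFDeriv ℂ l (fun y => F j y 0) z₀ = 0)
    (hG : ∀ j x, G j x = (((k j).factorial : ℂ))⁻¹ •
      iteratedFDeriv ℂ (k j) (fun y => F j y 0) z₀ (fun _ => x))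
    (hGne : ∀ j, G j ≠ 0)
    (hGind : Dense {x : Fin m → ℂ | LinearIndependent ℂ fun j => fderiv ℂ (G j) x}) :
    ∃ Θ' : Set (Fin s → ℂ), IsOpen Θ' ∧ Θ' ⊆ Θ ∧ (0 : Fin s → ℂ) ∈ Θ' ∧
      ∃ z : (Fin s → ℂ) → (Fin m → ℂ),
        AnalyticOnNhd ℂ z Θ' ∧ z 0 = z₀ ∧
        ∀ θ ∈ Θ',
          (∀ i, X i (z θ) θ = 0) ∧
          ∃ V W : Set (Fin m → ℂ), IsOpen V ∧ V ⊆ U ∧ z θ ∈ V ∧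
            IsOpen W ∧ W ⊆ U ∧ z₀ ∈ W ∧
            ∃ φ ψ : (Fin m → ℂ) → (Fin m → ℂ),
              AnalyticOnNhd ℂ φ V ∧ AnalyticOnNhd ℂ ψ W ∧
              Set.MapsTo φ V W ∧ Set.MapsTo ψ W V ∧
              (∀ x ∈ V, ψ (φ x) = x) ∧ (∀ y ∈ W, φ (ψ y) = y) ∧ φ '' V = W ∧
              φ (z θ) = z₀ ∧
              ∃ f : Fin p → Fin p → (Fin m → ℂ) → ℂ,
                (∀ i j, AnalyticOnNhd ℂ (f i j) W) ∧
                (∀ y ∈ W, (Matrix.of fun i j => f i j y).det ≠ 0) ∧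
                -- each f_{ij} is a common first integral of the system at θ = 0
                (∀ i j l, ∀ y ∈ W, fderiv ℂ (f i j) y (X l y 0) = 0) ∧
                (∀ i, ∀ x ∈ V, fderiv ℂ φ x (X i x θ) =
                  ∑ j, f i j (φ x) • X j (φ x) 0) := by
  let M : ℕ := 2 + ∑ j, k j
  have hM : ∀ j, k j + 1 ≤ M := fun j => by
    have : k j ≤ ∑ j, k j := Finset.single_le_sum (fun _ _ => Nat.zero_le _) (Finset.mem_univ j)
    show k j + 1 ≤ 2 + ∑ j, k j
    omega
  have hM2 : 2 ≤ M := Nat.le_add_right _ _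
  have hbl : ∀ r : ℝ, 0 < r → ∃ e g f, Blow z₀ U Θ X A G M r e g f := fun r hr =>
    blowup hUopen hz₀ hΘopen hΘ0 hXan hFan hcomm hFint hfix hA hklow hG hM hM2 hr
  have hc : ∀ i l u, (A i).mulVec ((A l).mulVec u) = (A l).mulVec ((A i).mulVec u) := by
    intro i l u
    obtain ⟨e, g, f, H⟩ := hbl (‖u‖ + 1) (by positivity)
    exact H.A_comm (lt_add_one _) i l
  have hinv : ∀ j i u, fderiv ℂ (G j) u ((A i).mulVec u) = 0 := by
    intro j i u
    obtain ⟨e, g, f, H⟩ := hbl (‖u‖ + 1) (by positivity)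
    exact H.G_inv (lt_add_one _) j i
  obtain ⟨P, w, B, C, v0, hw, hBC, hCB, hB, hv0, hLI⟩ := lin_data hm A G hss hc hinv hAind k
    (fun j => iteratedFDeriv ℂ (k j) (fun y => F j y 0) z₀) (fun j => (((k j).factorial : ℂ))⁻¹) hG hGind
  let r : ℝ := ‖(P : Ev m →L[ℂ] Ev m)‖ * 4 + 1
  have hr0 : 0 < r := by positivity
  have hr : ∀ v, ‖v‖ < 4 → ‖P v‖ < r := by
    intro v hv
    have h1 : ‖P v‖ ≤ ‖(P : Ev m →L[ℂ] Ev m)‖ * ‖v‖ := (P : Ev m →L[ℂ] Ev m).le_opNorm v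
    have h2 : ‖(P : Ev m →L[ℂ] Ev m)‖ * ‖v‖ ≤ ‖(P : Ev m →L[ℂ] Ev m)‖ * 4 := by gcongr
    show ‖P v‖ < ‖(P : Ev m →L[ℂ] Ev m)‖ * 4 + 1
    linarith
  obtain ⟨e, g, f, H⟩ := hbl r hr0
  obtain ⟨R, hsys, hY⟩ := H.sys hm P hr w hw B hB v0 hv0 hLI
  have hD0 : ∀ s0 : ℂ, ‖s0‖ < e → ∀ η : Fin s → ℂ, ‖η‖ < e → ∀ v : Ev m, ‖v‖ < 4 →
      ((v, (s0, η)) : Ev m × Pm s) ∈ Dom m s 4 e := by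
    intro s0 hs0 η hη v hv
    refine ⟨mem_ball_zero_iff.2 hv, ?_⟩
    rw [mem_ball_zero_iff, Prod.norm_def]
    exact max_lt hs0 hη
  have he0 : ‖(0 : Fin s → ℂ)‖ < e := by rw [norm_zero]; exact H.pos
  have hz : ∀ i (t : ℂ), ‖t‖ < e → Yf w R i (0, (t, 0)) = 0 := by
    intro i t ht
    rw [hY _ (hD0 t ht 0 he0 0 (by simp)) i]
    exact H.hz hr0 hfix P B i t ht
  obtain ⟨s0, hs0, hs0e, ρ, hρ, hρe, ζ, hζan, hζ0, hmain⟩ := hsys.rigid hz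
  have hsM : s0 ^ M ≠ 0 := pow_ne_zero _ hs0
  have hDr : ∀ η : Fin s → ℂ, ‖η‖ < e → ∀ v : Ev m, ‖v‖ < 4 → ((P v, (s0, η)) : Ev m × Pm s) ∈ Dom m s r e := by
    intro η hη v hv
    exact ⟨mem_ball_zero_iff.2 (hr v hv), (hD0 s0 hs0e η hη v hv).2⟩
  have hXY : ∀ η : Fin s → ℂ, ‖η‖ < e → ∀ v : Ev m, ‖v‖ < 4 → ∀ i,
      X i (af z₀ s0 P v) (s0 ^ M • η) = s0 • P (∑ a, C i a • Yf w R a (v, (s0, η))) := by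
    intro η hη v hv i
    have h1 := H.gX i _ (hDr η hη v hv)
    have h2 : X i (af z₀ s0 P v) (s0 ^ M • η) = s0 • g i (P v, (s0, η)) := h1
    rw [h2]
    congr 1
    have h3 : ∀ a, P (Yf w R a (v, (s0, η))) = ∑ b, B a b • g b (P v, (s0, η)) := by
      intro a
      rw [hY _ (hD0 s0 hs0e η hη v hv) a]
      unfold Yn
      rw [P.apply_symm_apply]
      rfl
    simp only [map_sum, map_smul, h3, Finset.smul_sum, smul_smul]
    rw [Finset.sum_comm]
    simp only [← Finset.sum_smul]
    have h4 : ∀ b, ∑ a, C i a * B a b = (1 : Matrix (Fin p) (Fin p) ℂ) i b := fun b => by rw [← hCB]; rfl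
    simp only [h4]
    rw [Finset.sum_eq_single i]
    · simp
    · intro c _ hc; rw [Matrix.one_apply_ne hc.symm, zero_smul]
    · simp
  let sc : (Fin s → ℂ) → (Fin s → ℂ) := fun θ => (s0 ^ M)⁻¹ • θ
  have hscd : Differentiable ℂ sc := by fun_prop
  have hsc : ∀ θ, s0 ^ M • sc θ = θ := fun θ => smul_inv_smul₀ hsM θ
  have hsc0 : sc 0 = 0 := smul_zero _
  have hO : IsOpen (sc ⁻¹' ball 0 ρ) := isOpen_ball.preimage hscd.continuous
  have hlt : ∀ θ ∈ sc ⁻¹' ball 0 ρ, ‖sc θ‖ < e := fun θ hθ => (mem_ball_zero_iff.1 hθ).trans_le hρe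
  have hlt4 : ∀ v ∈ ball (0 : Ev m) 1, ‖v‖ < 4 := fun v hv => (mem_ball_zero_iff.1 hv).trans (by norm_num)
  refine ⟨sc ⁻¹' ball 0 ρ, hO, ?_, ?_, fun θ => af z₀ s0 P (ζ (sc θ)), ?_, ?_, ?_⟩
  · intro θ hθ
    have h1 := (H.Q _ (hDr (sc θ) (hlt θ hθ) 0 (by simp))).2
    have h2 : s0 ^ M • sc θ ∈ Θ := h1
    rwa [hsc] at h2
  · show sc 0 ∈ ball 0 ρ
    rw [hsc0]; exact mem_ball_self hρ
  · refine analytic_of_diff hO fun θ hθ => ?_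
    have h1 : DifferentiableAt ℂ (fun θ => ζ (sc θ)) θ :=
      DifferentiableAt.comp (g := ζ) (f := sc) θ (hζan _ hθ).differentiableAt (hscd θ)
    exact (DifferentiableAt.comp (g := af z₀ s0 P) (f := fun θ => ζ (sc θ)) θ
      (af_fd z₀ s0 P _).differentiableAt h1).differentiableWithinAt
  · show af z₀ s0 P (ζ (sc 0)) = z₀
    rw [hsc0, hζ0]; simp [af]
  · intro θ hθ
    obtain ⟨hfx, V, W, hVo, hV, hζV, hWo, hW, h0W, T, S, hT, hS, hTm, hSm, hST, hTS, hTζ, gg, hg, hdet, hgi, hTY⟩ :=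
      hmain (sc θ) hθ
    refine ⟨fun i => ?_, ?_⟩
    · have h1 := hXY (sc θ) (hlt θ hθ) (ζ (sc θ)) (hlt4 _ (hV hζV)) i
      rw [hsc] at h1
      rw [h1]
      simp [hfx]
    · refine transfer (X1 := fun i x => X i x θ) (X0 := fun i x => X i x 0) (Y1 := fun i v => Yf w R i (v, (s0, sc θ)))
        (Y0 := fun i v => Yf w R i (v, (s0, 0))) hs0 P hBC hCB ?_ ?_ ?_ hVo hV hζV hWo hW h0W hT hS hTm hSm hST hTS hTζ
        hg hdet hgi hTY
      · intro v hv
        exact (H.Q _ (hDr 0 he0 v (hlt4 v hv))).1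
      · intro i v hv
        have h1 := hXY (sc θ) (hlt θ hθ) v (hlt4 v hv) i
        rwa [hsc] at h1
      · intro i v hv
        have h1 := hXY 0 he0 v (hlt4 v hv) i
        rwa [smul_zero] at h1

end
end Rig

end

/-- Rigidity of nondegenerate singularities: in an analytic family of integrable
systems, a nondegenerate fixed point persists and the local structure does not
depend on the parameter, up to geometric equivalence. -/
theorem rigidity_of_nondegenerate_singularities
    (p q m s : ℕ) (hm : m = p + q)
    (U : Set (Fin m → ℂ)) (hUopen : IsOpen U)
    (z₀ : Fin m → ℂ) (hz₀ : z₀ ∈ U)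
    (Θ : Set (Fin s → ℂ)) (hΘopen : IsOpen Θ) (hΘ0 : (0 : Fin s → ℂ) ∈ Θ)
    (X : Fin p → (Fin m → ℂ) → (Fin s → ℂ) → (Fin m → ℂ))
    (F : Fin q → (Fin m → ℂ) → (Fin s → ℂ) → ℂ)
    -- joint analyticity in (x, θ)
    (hXan : ∀ i, AnalyticOnNhd ℂ (fun w : (Fin m → ℂ) × (Fin s → ℂ) => X i w.1 w.2) (U ×ˢ Θ))
    (hFan : ∀ j, AnalyticOnNhd ℂ (fun w : (Fin m → ℂ) × (Fin s → ℂ) => F j w.1 w.2) (U ×ˢ Θ))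
    -- for each fixed θ, an integrable system of type (p,q) on U
    (hcomm : ∀ θ ∈ Θ, ∀ i j, ∀ x ∈ U,
      fderiv ℂ (fun y => X j y θ) x (X i x θ) - fderiv ℂ (fun y => X i y θ) x (X j x θ) = 0)
    (hFint : ∀ θ ∈ Θ, ∀ i j, ∀ x ∈ U, fderiv ℂ (fun y => F j y θ) x (X i x θ) = 0)
    (hXind : ∀ θ ∈ Θ, U ⊆ closure {x ∈ U | LinearIndependent ℂ fun i => X i x θ})
    (hFind : ∀ θ ∈ Θ, U ⊆ closure {x ∈ U | LinearIndependent ℂ fun j =>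
      fderiv ℂ (fun y => F j y θ) x})
    -- z₀ is a nondegenerate fixed point at θ = 0 :
    (hfix : ∀ i, X i z₀ 0 = 0)
    (A : Fin p → Matrix (Fin m) (Fin m) ℂ)
    (hA : ∀ i v, (A i).mulVec v = fderiv ℂ (fun y => X i y 0) z₀ v)
    (hss : ∀ i, IsSemisimpleMatrixC (A i))
    (hAind : Dense {x : Fin m → ℂ | LinearIndependent ℂ fun i => (A i).mulVec x})
    (k : Fin q → ℕ) (G : Fin q → (Fin m → ℂ) → ℂ)
    (hklow : ∀ j, ∀ l < k j, iteratedFDeriv ℂ l (fun y => F j y 0) z₀ = 0)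
    (hG : ∀ j x, G j x = (((k j).factorial : ℂ))⁻¹ •
      iteratedFDeriv ℂ (k j) (fun y => F j y 0) z₀ (fun _ => x))
    (hGne : ∀ j, G j ≠ 0)
    (hGind : Dense {x : Fin m → ℂ | LinearIndependent ℂ fun j => fderiv ℂ (G j) x}) :
    ∃ Θ' : Set (Fin s → ℂ), IsOpen Θ' ∧ Θ' ⊆ Θ ∧ (0 : Fin s → ℂ) ∈ Θ' ∧
      ∃ z : (Fin s → ℂ) → (Fin m → ℂ),
        AnalyticOnNhd ℂ z Θ' ∧ z 0 = z₀ ∧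
        ∀ θ ∈ Θ',
          (∀ i, X i (z θ) θ = 0) ∧
          ∃ V W : Set (Fin m → ℂ), IsOpen V ∧ V ⊆ U ∧ z θ ∈ V ∧
            IsOpen W ∧ W ⊆ U ∧ z₀ ∈ W ∧
            ∃ φ ψ : (Fin m → ℂ) → (Fin m → ℂ),
              AnalyticOnNhd ℂ φ V ∧ AnalyticOnNhd ℂ ψ W ∧
              Set.MapsTo φ V W ∧ Set.MapsTo ψ W V ∧
              (∀ x ∈ V, ψ (φ x) = x) ∧ (∀ y ∈ W, φ (ψ y) = y) ∧ φ '' V = W ∧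
              φ (z θ) = z₀ ∧
              ∃ f : Fin p → Fin p → (Fin m → ℂ) → ℂ,
                (∀ i j, AnalyticOnNhd ℂ (f i j) W) ∧
                (∀ y ∈ W, (Matrix.of fun i j => f i j y).det ≠ 0) ∧
                -- each f_{ij} is a common first integral of the system at θ = 0
                (∀ i j l, ∀ y ∈ W, fderiv ℂ (f i j) y (X l y 0) = 0) ∧
                (∀ i, ∀ x ∈ V, fderiv ℂ φ x (X i x θ) =
                  ∑ j, f i j (φ x) • X j (φ x) 0) := by
  exact Rig.main p q m s hm U hUopen z₀ hz₀ Θ hΘopen hΘ0 X F hXan hFan hcomm hFint hXind hFind hfix A hA hss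
    hAind k G hklow hG hGne hGind
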